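/- Let 1 < p, q < ∞, 1 ≤ r, s ≤ 2, and let t > 0 satisfy 1/t ≤ 1/r + 1/s, with (max(r,s) < 2 or t > rs/(r+s)), and fix φ and φ_i as in the context. There exists a constant C such that for all sequences (f_i)_{i∈ℤ} and (g_j)_{j∈ℤ} of measurable functions on ℝ with ‖(f_i)‖_{p,r} < ∞ and ‖(g_j)‖_{q,s} < ∞, and every jump collection (N_k)_{k≥0}, one has ‖ (Σ_{k≥1} |Σ_{N_{k−1}(x) < i < j ≤ N_k(x)} (φ_i * f_i)(x) (φ_j * g_j)(x)|^t)^{1/t} ‖_{pq/(p+q)} ≤ C ‖(f_i)‖_{p,r} ‖(g_j)‖_{q,s}. -/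

import Mathlib

open MeasureTheory ENNReal
open scoped FourierTransform NNReal

noncomputable section

/-- A jump collection: a sequence of measurable integer-valued functions on `ℝ`,
nondecreasing in the index. -/
def IsJumpCollection (Nk : ℕ → ℝ → ℤ) : Prop :=
  (∀ k, Measurable (Nk k)) ∧ ∀ (k : ℕ) (x : ℝ), Nk k x ≤ Nk (k + 1) x

/-- The dilate `φ_i(x) = 2^i φ(2^i x)` of a Schwartz function `φ`. -/
def dilate (φ : SchwartzMap ℝ ℂ) (i : ℤ) : ℝ → ℂ :=
  fun x => ((2 : ℝ) ^ i : ℝ) • φ (((2 : ℝ) ^ i) * x)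

/-- Convolution `(φ_i * h)(x) = ∫ φ_i(x - y) h(y) dy`. -/
def conv (φi : ℝ → ℂ) (h : ℝ → ℂ) : ℝ → ℂ :=
  fun x => ∫ y : ℝ, φi (x - y) * h y

/-- The mixed norm `‖(f_i)‖_{p,r} = ‖(∑_i |f_i|^r)^(1/r)‖_{L^p}`. -/
def mixedNorm (p r : ℝ) (f : ℤ → ℝ → ℂ) : ℝ≥0∞ :=
  (∫⁻ x : ℝ, ((∑' i : ℤ, (ENNReal.ofReal ‖f i x‖) ^ r) ^ (1 / r)) ^ p) ^ (1 / p)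

/-- Symmetric power estimate. -/
lemma sym_pow_aux (c : ℝ) (hc : 0 ≤ c) (K : ℕ) : ∃ C : ℝ, 0 ≤ C ∧ ∀ y a b : ℝ, 0 ≤ y → 0 ≤ a →
    a ≤ y → b ^ 2 ≤ c * a * y →
    ((y + b) ^ (K+1) + (y - b) ^ (K+1)) ≤ 2 * y ^ (K+1) + C * a * y ^ K ∧
    b * ((y + b) ^ (K+1) - (y - b) ^ (K+1)) ≤ C * a * y ^ (K+1) := by
  induction K with
  | zero =>
    refine ⟨2 * c, by positivity, fun y a b hy ha hay hb => ⟨?_, ?_⟩⟩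
    · have : 0 ≤ c * a := by positivity
      simp; nlinarith
    · simp; nlinarith
  | succ K ih =>
    obtain ⟨C, hC, h⟩ := ih
    refine ⟨2 * C + c * (2 + C), by positivity, fun y a b hy ha hay hb => ?_⟩
    obtain ⟨h1, h2⟩ := h y a b hy ha hay hb
    set P := (y + b) ^ (K+1) with hP
    set M := (y - b) ^ (K+1) with hM
    have e1 : (y + b) ^ (K+1+1) = (y + b) * P := by rw [hP]; ring
    have e2 : (y - b) ^ (K+1+1) = (y - b) * M := by rw [hM]; ring
    have hs : P + M ≤ (2 + C) * y ^ (K+1) := by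
      have : C * a * y ^ K ≤ C * y ^ (K+1) := by
        rw [pow_succ]
        have : a * y ^ K ≤ y * y ^ K := by gcongr
        nlinarith
      linarith
    rw [e1, e2]
    constructor
    · have : y * (P + M) ≤ y * (2 * y ^ (K+1) + C * a * y ^ K) := by gcongr
      have e3 : y * (2 * y ^ (K+1) + C * a * y ^ K) = 2 * y ^ (K+1+1) + C * a * y ^ (K+1) := by ring
      have : 0 ≤ c * (2 + C) * a * y ^ (K+1) := by positivity
      nlinarith
    · have i1 : y * (b * (P - M)) ≤ y * (C * a * y ^ (K+1)) := by gcongr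
      have i2 : b ^ 2 * (P + M) ≤ b ^ 2 * ((2 + C) * y ^ (K+1)) := by gcongr
      have i3 : b ^ 2 * ((2 + C) * y ^ (K+1)) ≤ (c * a * y) * ((2 + C) * y ^ (K+1)) := by gcongr
      have : 0 ≤ C * a * y ^ (K+1+1) := by positivity
      have e : (c * a * y) * ((2 + C) * y ^ (K+1)) = c * (2 + C) * a * y ^ (K+1+1) := by ring
      have e' : y * (C * a * y ^ (K+1)) = C * a * y ^ (K+1+1) := by ring
      nlinarith

lemma pow_avg_ge (k : ℕ) (y b : ℝ) (h1 : 0 ≤ y + b) (h2 : 0 ≤ y - b) :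
    2 * y ^ k ≤ (y + b) ^ k + (y - b) ^ k := by
  have := (convexOn_pow (𝕜 := ℝ) k).2 (Set.mem_Ici.2 h1) (Set.mem_Ici.2 h2)
    (show (0:ℝ) ≤ 1/2 by norm_num) (show (0:ℝ) ≤ 1/2 by norm_num) (by norm_num)
  simp only [smul_eq_mul] at this
  have e : 1 / 2 * (y + b) + 1 / 2 * (y - b) = y := by ring
  rw [e] at this
  linarith

lemma pow_add_le_aux (k : ℕ) (Q a : ℝ) (hQ : 0 ≤ Q) (ha : 0 ≤ a) :
    (Q + a) ^ (k+1) ≤ Q ^ (k+1) + (k+1) * a * (Q + a) ^ k := by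
  induction k with
  | zero => simp
  | succ k ih =>
    have h1 : Q ^ (k+1) ≤ (Q + a) ^ (k+1) := by gcongr; linarith
    have : (Q + a) ^ (k+1+1) = Q * (Q+a)^(k+1) + a * (Q + a) ^ (k+1) := by ring
    rw [this]
    have h2 : Q * (Q + a) ^ (k+1) ≤ Q * (Q ^ (k+1) + (k+1) * a * (Q + a) ^ k) := by gcongr
    have h3 : Q * ((k+1) * a * (Q + a) ^ k) ≤ (Q + a) * ((k+1) * a * (Q + a) ^ k) := by
      gcongr; linarith
    have h4 : (Q + a) * ((k+1) * a * (Q + a) ^ k) = (k+1) * a * (Q + a)^(k+1) := by ring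
    push_cast
    have h5 : Q * Q ^ (k+1) = Q ^ (k+1+1) := by ring
    nlinarith

lemma one_step (c : ℝ) (hc : 0 ≤ c) (k : ℕ) : ∃ C : ℝ, 0 ≤ C ∧ ∀ Q X a b : ℝ, 0 ≤ Q → 0 ≤ X →
    0 ≤ a → b ^ 2 ≤ c * a * Q → 0 ≤ Q + a + b → 0 ≤ Q + a - b →
    (Q + a + b) ^ (k+1) + (Q + a - b) ^ (k+1) + 2 * (C * (X * (Q + X) ^ k)) ≤
    2 * Q ^ (k+1) + (C * ((X + a) * (Q + a + b + (X + a)) ^ k) +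
      C * ((X + a) * (Q + a - b + (X + a)) ^ k)) := by
  obtain ⟨C, hC, h⟩ := sym_pow_aux c hc k
  refine ⟨(k + 1) + C, by positivity, fun Q X a b hQ hX ha hb hp hm => ?_⟩
  have h1 := (h (Q + a) a b (by positivity) ha (by linarith)
    (hb.trans (by have : 0 ≤ c * a * a := by positivity
                  nlinarith))).1
  have h2 := pow_add_le_aux k Q a hQ ha
  have h3 := pow_avg_ge k (Q + a + (X + a)) b (by linarith) (by linarith)
  rw [show Q + a + (X + a) + b = Q + a + b + (X + a) by ring,
    show Q + a + (X + a) - b = Q + a - b + (X + a) by ring] at h3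
  have h4 : (X + a) * (2 * (Q + a + (X + a)) ^ k) ≤ (X + a) *
    ((Q + a + b + (X + a)) ^ k + (Q + a - b + (X + a)) ^ k) := by gcongr
  have h5 : X * (Q + X) ^ k ≤ X * (Q + a + (X + a)) ^ k := by
    gcongr X * ?_ ^ k; linarith
  have h6 : a * (Q + a) ^ k ≤ a * (Q + a + (X + a)) ^ k := by
    gcongr a * ?_ ^ k; linarith
  have h7 : 2 * (X * (Q + X) ^ k) + 2 * (a * (Q + a) ^ k) ≤ (X + a) *
    ((Q + a + b + (X + a)) ^ k + (Q + a - b + (X + a)) ^ k) := by linarith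
  have h8 := mul_le_mul_of_nonneg_left h7 (show (0:ℝ) ≤ (k+1) + C by positivity)
  have h9 : 0 ≤ C * (a * (Q + a) ^ k) := by positivity
  nlinarith

lemma young_aux (C : ℝ) (hC : 0 ≤ C) (k : ℕ) : ∃ C' : ℝ, 0 ≤ C' ∧ ∀ Q X : ℝ, 0 ≤ Q → 0 ≤ X →
    C * (X * (Q + X) ^ k) ≤ (1/2) * Q ^ (k+1) + C' * X ^ (k+1) := by
  -- either X small compared to Q or not
  set D : ℝ := 2 * C * 2 ^ k + 1 with hD
  have hD1 : 1 ≤ D := by rw [hD]; have : 0 ≤ 2 * C * 2 ^ k := by positivity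
                         linarith
  refine ⟨C * (D + 1) ^ k, by positivity, fun Q X hQ hX => ?_⟩
  rcases le_total (D * X) Q with h | h
  · have hXQ : X ≤ Q := by nlinarith
    have h1 : (Q + X) ^ k ≤ (2 * Q) ^ k := by gcongr; linarith
    have h2 : C * (X * (Q + X) ^ k) ≤ C * (X * (2 * Q) ^ k) := by gcongr
    have h3 : C * (X * (2 * Q) ^ k) = (C * 2 ^ k * X) * Q ^ k := by rw [mul_pow]; ring
    have h4 : C * 2 ^ k * X ≤ 1/2 * Q := by nlinarith
    have h5 : (C * 2 ^ k * X) * Q ^ k ≤ (1/2 * Q) * Q ^ k := by gcongr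
    have h6 : 0 ≤ C * (D + 1) ^ k * X ^ (k+1) := by positivity
    rw [show (1/2) * Q ^ (k+1) = (1/2 * Q) * Q ^ k by ring]
    linarith
  · have h1 : (Q + X) ^ k ≤ ((D + 1) * X) ^ k := by gcongr; linarith
    have h2 : C * (X * (Q + X) ^ k) ≤ C * (X * ((D + 1) * X) ^ k) := by gcongr
    have h3 : C * (X * ((D + 1) * X) ^ k) = C * (D + 1) ^ k * X ^ (k+1) := by rw [mul_pow]; ring
    have : 0 ≤ (1/2) * Q ^ (k+1) := by positivity
    linarith

/-- Abstract moment inequality. -/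
lemma moment_ineq {Ω : Type*} [MeasurableSpace Ω] (μ : Measure Ω) (c : ℝ) (hc : 0 ≤ c) (k : ℕ) :
    ∃ C : ℝ≥0, ∀ (T : ℕ) (τ : ℕ → Ω → Ω) (a b : ℕ → Ω → ℝ),
      (∀ n, MeasurePreserving (τ n) μ μ) → (∀ n, Measurable (a n)) → (∀ n, Measurable (b n)) →
      (∀ n x, 0 ≤ a n x) → (∀ n x, a n (τ n x) = a n x) → (∀ n x, b n (τ n x) = - b n x) →
      (∀ j n x, j < n → a j (τ n x) = a j x) → (∀ j n x, j < n → b j (τ n x) = b j x) →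
      (∀ n x, 0 ≤ ∑ j ∈ Finset.range n, (a j x + b j x)) →
      (∀ n x, (b n x) ^ 2 ≤ c * a n x * ∑ j ∈ Finset.range n, (a j x + b j x)) →
      ∫⁻ x, ENNReal.ofReal ((∑ j ∈ Finset.range T, (a j x + b j x)) ^ (k+1)) ∂μ ≤
        C * ∫⁻ x, ENNReal.ofReal ((∑ j ∈ Finset.range T, a j x) ^ (k+1)) ∂μ := by
  obtain ⟨C, hC, hstep⟩ := one_step c hc k
  obtain ⟨C', hC', hY⟩ := young_aux C hC k
  refine ⟨Real.toNNReal (2 * C' + 1), ?_⟩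
  intro T τ a b hτ ham hbm ha haτ hbτ haj hbj hQ0 hb2
  set Q : ℕ → Ω → ℝ := fun n x => ∑ j ∈ Finset.range n, (a j x + b j x) with hQ
  set X : ℕ → Ω → ℝ := fun n x => ∑ j ∈ Finset.range n, a j x with hX
  replace hQ0 : ∀ n x, 0 ≤ Q n x := hQ0
  have hQm : ∀ n, Measurable (Q n) := fun n => by
    simp only [hQ]; fun_prop
  have hXm : ∀ n, Measurable (X n) := fun n => by
    simp only [hX]; fun_prop
  have hX0 : ∀ n x, 0 ≤ X n x := fun n x => Finset.sum_nonneg fun j _ => ha j x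
  have hQτ : ∀ n x, Q n (τ n x) = Q n x := fun n x => Finset.sum_congr rfl fun j hj => by
    rw [haj j n x (Finset.mem_range.1 hj), hbj j n x (Finset.mem_range.1 hj)]
  have hXτ : ∀ n x, X n (τ n x) = X n x := fun n x => Finset.sum_congr rfl fun j hj => by
    rw [haj j n x (Finset.mem_range.1 hj)]
  have hQs : ∀ n x, Q (n+1) x = Q n x + a n x + b n x := fun n x => by
    simp only [hQ, Finset.sum_range_succ]; ring
  have hXs : ∀ n x, X (n+1) x = X n x + a n x := fun n x => by
    simp only [hX, Finset.sum_range_succ]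
  have hXmono : ∀ n m, n ≤ m → ∀ x, X n x ≤ X m x := fun n m hnm x => by
    apply Finset.sum_le_sum_of_subset_of_nonneg
    · exact Finset.range_mono hnm
    · intro i _ _; exact ha i x
  by_cases hfin : ∫⁻ x, ENNReal.ofReal ((X T x) ^ (k+1)) ∂μ = ⊤
  · have : (0 : ℝ≥0) < Real.toNNReal (2 * C' + 1) := by
      rw [Real.toNNReal_pos]; linarith
    change _ ≤ _ * ∫⁻ x, ENNReal.ofReal ((X T x) ^ (k+1)) ∂μ
    rw [hfin, ENNReal.mul_top (by simpa using this.ne')]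
    exact le_top
  -- crude bound
  have hcrude : ∀ n, ∃ D : ℝ, 0 ≤ D ∧ ∀ x, Q n x ≤ D * X n x := by
    intro n
    induction n with
    | zero => exact ⟨0, le_rfl, fun x => by simp [hQ, hX]⟩
    | succ n ih =>
      obtain ⟨D, hD, h⟩ := ih
      refine ⟨2 * D + 1 + c, by positivity, fun x => ?_⟩
      rw [hQs, hXs]
      have h1 := hb2 n x
      have h2 : b n x ≤ Q n x + c * a n x := by
        by_contra hcon
        push Not at hcon
        have q0 := hQ0 n x
        have a0 : 0 ≤ c * a n x := mul_nonneg hc (ha n x)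
        change 0 ≤ Q n x at q0
        change _ ≤ c * a n x * Q n x at h1
        have hh : (Q n x + c * a n x)^2 < (b n x) ^ 2 := by gcongr
        nlinarith [mul_nonneg a0 q0]
      have := h x
      have := hX0 n x
      have := ha n x
      nlinarith [mul_nonneg hD this, mul_nonneg hc (hX0 n x)]
  have hfinX : ∀ n, n ≤ T → ∫⁻ x, ENNReal.ofReal ((X n x) ^ (k+1)) ∂μ ≠ ⊤ := fun n hn => by
    refine ne_top_of_le_ne_top hfin (lintegral_mono fun x => ENNReal.ofReal_le_ofReal ?_)
    exact pow_le_pow_left₀ (hX0 n x) (hXmono n T hn x) _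
  have hfinQ : ∀ n, n ≤ T → ∫⁻ x, ENNReal.ofReal ((Q n x) ^ (k+1)) ∂μ ≠ ⊤ := fun n hn => by
    obtain ⟨D, hD, h⟩ := hcrude n
    have : ∫⁻ x, ENNReal.ofReal ((Q n x) ^ (k+1)) ∂μ ≤
      ENNReal.ofReal (D ^ (k+1)) * ∫⁻ x, ENNReal.ofReal ((X n x) ^ (k+1)) ∂μ := by
      rw [← lintegral_const_mul' _ _ ENNReal.ofReal_ne_top]
      refine lintegral_mono fun x => ?_
      rw [← ENNReal.ofReal_mul (by positivity), ← mul_pow]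
      exact ENNReal.ofReal_le_ofReal (pow_le_pow_left₀ (hQ0 n x) (h x) _)
    exact ne_top_of_le_ne_top (ENNReal.mul_ne_top ENNReal.ofReal_ne_top (hfinX n hn)) this
  set R : ℕ → Ω → ℝ := fun n x => C * (X n x * (Q n x + X n x) ^ k) with hR
  have hR0 : ∀ n x, 0 ≤ R n x := fun n x =>
    mul_nonneg hC (mul_nonneg (hX0 n x) (pow_nonneg (add_nonneg (hQ0 n x) (hX0 n x)) _))
  have hRm : ∀ n, Measurable (R n) := fun n => by
    simp only [hR]; have := hQm n; have := hXm n; fun_prop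
  have hRle : ∀ n, ∫⁻ x, ENNReal.ofReal (R n x) ∂μ ≤
      ENNReal.ofReal (1/2) * ∫⁻ x, ENNReal.ofReal ((Q n x) ^ (k+1)) ∂μ +
      ENNReal.ofReal C' * ∫⁻ x, ENNReal.ofReal ((X n x) ^ (k+1)) ∂μ := fun n => by
    rw [← lintegral_const_mul' _ _ ENNReal.ofReal_ne_top,
      ← lintegral_const_mul' _ _ ENNReal.ofReal_ne_top, ← lintegral_add_left]
    · refine lintegral_mono fun x => ?_
      rw [← ENNReal.ofReal_mul (by positivity), ← ENNReal.ofReal_mul (by positivity),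
        ← ENNReal.ofReal_add]
      · exact ENNReal.ofReal_le_ofReal (hY _ _ (hQ0 n x) (hX0 n x))
      · exact mul_nonneg (by norm_num) (pow_nonneg (hQ0 n x) _)
      · exact mul_nonneg hC' (pow_nonneg (hX0 n x) _)
    · have := hQm n; fun_prop
  have hfinR : ∀ n, n ≤ T → ∫⁻ x, ENNReal.ofReal (R n x) ∂μ ≠ ⊤ := fun n hn => by
    refine ne_top_of_le_ne_top (ENNReal.add_ne_top.2 ⟨?_, ?_⟩) (hRle n)
    · exact ENNReal.mul_ne_top ENNReal.ofReal_ne_top (hfinQ n hn)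
    · exact ENNReal.mul_ne_top ENNReal.ofReal_ne_top (hfinX n hn)
  -- symmetrization
  have hsym : ∀ n (H : Ω → ℝ≥0∞), Measurable H →
      2 * ∫⁻ x, H x ∂μ = ∫⁻ x, (H x + H (τ n x)) ∂μ := fun n H hH => by
    rw [lintegral_add_left hH, (hτ n).lintegral_comp hH, two_mul]
  have hind : ∀ n, n ≤ T → ∫⁻ x, ENNReal.ofReal ((Q n x) ^ (k+1)) ∂μ ≤
      ∫⁻ x, ENNReal.ofReal (R n x) ∂μ := by
    intro n
    induction n with
    | zero => intro _; simp [hQ]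
    | succ n ih =>
      intro hn
      have ih' := ih (by omega)
      have key : 2 * ∫⁻ x, ENNReal.ofReal ((Q (n+1) x) ^ (k+1)) ∂μ +
          2 * ∫⁻ x, ENNReal.ofReal (R n x) ∂μ ≤ 2 * ∫⁻ x, ENNReal.ofReal ((Q n x) ^ (k+1)) ∂μ +
          2 * ∫⁻ x, ENNReal.ofReal (R (n+1) x) ∂μ := by
        have mQ := hQm n
        have mQ' := hQm (n+1)
        have mR := hRm n
        have mR' := hRm (n+1)
        rw [hsym n (fun x => ENNReal.ofReal ((Q (n+1) x) ^ (k+1))) (by fun_prop),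
          hsym n (fun x => ENNReal.ofReal (R n x)) (by fun_prop),
          hsym n (fun x => ENNReal.ofReal ((Q n x) ^ (k+1))) (by fun_prop),
          hsym n (fun x => ENNReal.ofReal (R (n+1) x)) (by fun_prop)]
        have mτ := (hτ n).measurable
        rw [← lintegral_add_left (by fun_prop), ← lintegral_add_left (by fun_prop)]
        refine lintegral_mono fun x => ?_
        have p1 := hQ0 (n+1) x
        have p2 := hQ0 (n+1) (τ n x)
        change 0 ≤ Q (n+1) x at p1
        change 0 ≤ Q (n+1) (τ n x) at p2
        have q2 : Q (n+1) (τ n x) = Q n x + a n x - b n x := by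
          rw [hQs, hQτ, haτ, hbτ]; ring
        have r2 : R n (τ n x) = R n x := by simp only [hR]; rw [hQτ, hXτ]
        have x2 : X (n+1) (τ n x) = X n x + a n x := by rw [hXs, hXτ, haτ]
        rw [← ENNReal.ofReal_add (pow_nonneg p1 _) (pow_nonneg p2 _),
          ← ENNReal.ofReal_add (hR0 _ _) (hR0 _ _), ← ENNReal.ofReal_add (hR0 _ _) (hR0 _ _),
          ← ENNReal.ofReal_add (pow_nonneg (hQ0 n x) _) (pow_nonneg (hQ0 _ _) _),
          ← ENNReal.ofReal_add (add_nonneg (pow_nonneg p1 _) (pow_nonneg p2 _))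
            (add_nonneg (hR0 _ _) (hR0 _ _)),
          ← ENNReal.ofReal_add (add_nonneg (pow_nonneg (hQ0 n x) _) (pow_nonneg (hQ0 _ _) _))
            (add_nonneg (hR0 _ _) (hR0 _ _))]
        apply ENNReal.ofReal_le_ofReal
        have := hstep (Q n x) (X n x) (a n x) (b n x) (hQ0 n x) (hX0 n x) (ha n x) (hb2 n x)
          (by rw [← hQs]; exact p1) (by rw [← q2]; exact p2)
        rw [r2, hQτ]
        simp only [hR]
        rw [q2, x2, hQs, hXs]
        linarith
      have key2 : ∫⁻ x, ENNReal.ofReal ((Q (n+1) x) ^ (k+1)) ∂μ +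
          ∫⁻ x, ENNReal.ofReal (R n x) ∂μ ≤ ∫⁻ x, ENNReal.ofReal ((Q n x) ^ (k+1)) ∂μ +
          ∫⁻ x, ENNReal.ofReal (R (n+1) x) ∂μ := by
        rw [← mul_add, ← mul_add] at key
        exact (ENNReal.mul_le_mul_iff_right (by norm_num) (by norm_num)).1 key
      have key3 := key2.trans (add_le_add_left ih' _)
      rw [add_comm] at key3
      exact (ENNReal.add_le_add_iff_left (hfinR n (by omega))).1 key3
  have h1 := (hind T le_rfl).trans (hRle T)
  change ∫⁻ x, ENNReal.ofReal ((Q T x) ^ (k+1)) ∂μ ≤ _ * ∫⁻ x, ENNReal.ofReal ((X T x) ^ (k+1)) ∂μ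
  have f1 := hfinQ T le_rfl
  lift ∫⁻ x, ENNReal.ofReal ((Q T x) ^ (k+1)) ∂μ to ℝ≥0 using f1 with q
  lift ∫⁻ x, ENNReal.ofReal ((X T x) ^ (k+1)) ∂μ to ℝ≥0 using hfin with z
  simp only [ENNReal.ofReal] at h1
  norm_cast at h1 ⊢
  rw [← NNReal.coe_le_coe] at h1 ⊢
  push_cast at h1 ⊢
  rw [Real.coe_toNNReal _ (by positivity), Real.coe_toNNReal _ (by positivity)] at h1
  rw [Real.coe_toNNReal _ (by positivity)]
  have := z.2
  have hz : (0:ℝ) ≤ z := z.2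
  nlinarith

def DD (d : ℕ → ℂ) (a b : ℕ) : ℂ := ∑ i ∈ Finset.Ico a b, d i
def BB (d e : ℕ → ℂ) (a b : ℕ) : ℂ := ∑ j ∈ Finset.Ico a b, ∑ i ∈ Finset.Ico a j, d i * e j

lemma DD_self (d : ℕ → ℂ) (a : ℕ) : DD d a a = 0 := by simp [DD]
lemma BB_self (d e : ℕ → ℂ) (a : ℕ) : BB d e a a = 0 := by simp [BB]
lemma DD_succ (d : ℕ → ℂ) {a b : ℕ} (h : a ≤ b) : DD d a (b+1) = DD d a b + d b := by
  simp [DD, Finset.sum_Ico_succ_top h]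
lemma BB_succ (d e : ℕ → ℂ) {a b : ℕ} (h : a ≤ b) :
    BB d e a (b+1) = BB d e a b + DD d a b * e b := by
  simp [BB, DD, Finset.sum_Ico_succ_top h, Finset.sum_mul]

abbrev St := ℕ × ℂ × ℂ × ℂ

def Bad (s : St) (d e : ℂ) : Prop := 1 < ‖d‖ ∨ 1 < ‖e‖ ∨ 1 < ‖s.2.1 + d‖ ∨ 1 < ‖s.2.2.1 + e‖ ∨
  1 < ‖s.2.2.2 + s.2.1 * e‖

open Classical in
def stp (s : St) (d e : ℂ) : St :=
  if Bad s d e then (s.1 + 1, 0, 0, 0) else (s.1, s.2.1 + d, s.2.2.1 + e, s.2.2.2 + s.2.1 * e)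

def sts (d e : ℕ → ℂ) : ℕ → St
  | 0 => (0, 0, 0, 0)
  | n + 1 => stp (sts d e n) (d n) (e n)

def alphaF (d e : ℂ) : ℝ := 2 * ((min ‖d‖ 1) ^ 2 + (min ‖e‖ 1) ^ 2)

open Classical in
def betaF (s : St) (d e : ℂ) : ℝ := if 1 < ‖d‖ ∨ 1 < ‖e‖ then 0 else
  2 * (d * (starRingEnd ℂ) s.2.1 + e * (starRingEnd ℂ) s.2.2.1 +
    s.2.1 * e * (starRingEnd ℂ) s.2.2.2).re

def pot (s : St) : ℝ := s.1 + ‖s.2.1‖ ^ 2 + ‖s.2.2.1‖ ^ 2 + ‖s.2.2.2‖ ^ 2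

def okSt (s : St) : Prop := ‖s.2.1‖ ≤ 1 ∧ ‖s.2.2.1‖ ≤ 1 ∧ ‖s.2.2.2‖ ≤ 1

lemma okSt_stp (s : St) (d e : ℂ) : okSt (stp s d e) := by
  unfold stp
  split_ifs with h
  · simp [okSt]
  · simp only [Bad, not_or, not_lt] at h
    exact h.2.2

lemma okSt_sts (d e : ℕ → ℂ) (n : ℕ) : okSt (sts d e n) := by
  cases n with
  | zero => simp [sts, okSt]
  | succ n => exact okSt_stp _ _ _

lemma pot_nonneg (s : St) : 0 ≤ pot s := by unfold pot; positivity

lemma alphaF_nonneg (d e : ℂ) : 0 ≤ alphaF d e := by unfold alphaF; positivity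

lemma norm_add_sq_c (x d : ℂ) : ‖x + d‖ ^ 2 =
    ‖x‖ ^ 2 + ‖d‖ ^ 2 + 2 * (d * (starRingEnd ℂ) x).re := by
  rw [← Complex.normSq_eq_norm_sq, ← Complex.normSq_eq_norm_sq, ← Complex.normSq_eq_norm_sq,
    add_comm x d, Complex.normSq_add]
  ring

lemma pot_stp (s : St) (hs : okSt s) (d e : ℂ) :
    pot (stp s d e) ≤ pot s + alphaF d e + betaF s d e := by
  obtain ⟨n, x, y, z⟩ := s
  obtain ⟨hx, hy, hz⟩ := hs
  simp only at hx hy hz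
  by_cases hb : 1 < ‖d‖ ∨ 1 < ‖e‖
  · have hB : Bad (n, x, y, z) d e := by
      rcases hb with h | h
      · exact Or.inl h
      · exact Or.inr (Or.inl h)
    have ha : 2 ≤ alphaF d e := by
      unfold alphaF
      rcases hb with h | h
      · rw [min_eq_right h.le]; have := sq_nonneg (min ‖e‖ 1); linarith
      · rw [min_eq_right h.le]; have := sq_nonneg (min ‖d‖ 1); linarith
    simp only [stp, hB, if_true, betaF, hb, pot]
    push_cast
    have h1 := sq_nonneg ‖x‖
    have h2 := sq_nonneg ‖y‖
    have h3 := sq_nonneg ‖z‖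
    simp
    linarith
  · have hd : ‖d‖ ≤ 1 := by push Not at hb; exact hb.1
    have he : ‖e‖ ≤ 1 := by push Not at hb; exact hb.2
    have e1 := norm_add_sq_c x d
    have e2 := norm_add_sq_c y e
    have e3 := norm_add_sq_c z (x * e)
    have hxe : ‖x * e‖ ^ 2 ≤ ‖e‖ ^ 2 := by
      rw [norm_mul, mul_pow]
      have : ‖x‖ ^ 2 ≤ 1 := by nlinarith [norm_nonneg x]
      nlinarith [sq_nonneg ‖e‖]
    have key : n + ‖x + d‖ ^ 2 + ‖y + e‖ ^ 2 + ‖z + x * e‖ ^ 2 ≤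
        pot (n, x, y, z) + alphaF d e + betaF (n, x, y, z) d e := by
      simp only [alphaF, betaF, hb, if_false, pot, min_eq_left hd, min_eq_left he]
      rw [e1, e2, e3]
      simp only [Complex.add_re]
      have := sq_nonneg ‖d‖
      linarith
    refine le_trans ?_ key
    unfold stp
    split_ifs with hB
    · have h1 := sq_nonneg ‖x + d‖
      have h2 := sq_nonneg ‖y + e‖
      have h3 := sq_nonneg ‖z + x * e‖
      simp only [Bad] at hB
      simp only [pot]
      push_cast
      simp only [norm_zero]
      rcases hB with h | h | h | h | h
      · exact absurd (Or.inl h) hb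
      · exact absurd (Or.inr h) hb
      all_goals nlinarith
    · simp [pot]

lemma betaF_sq (s : St) (hs : okSt s) (d e : ℂ) : (betaF s d e) ^ 2 ≤ 4 * alphaF d e * pot s := by
  obtain ⟨n, x, y, z⟩ := s
  obtain ⟨hx, hy, hz⟩ := hs
  simp only at hx hy hz
  by_cases hb : 1 < ‖d‖ ∨ 1 < ‖e‖
  · simp only [betaF, hb, if_true]
    rw [zero_pow two_ne_zero]
    exact mul_nonneg (mul_nonneg (by norm_num) (alphaF_nonneg _ _)) (pot_nonneg _)
  · have hd : ‖d‖ ≤ 1 := by push Not at hb; exact hb.1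
    have he : ‖e‖ ≤ 1 := by push Not at hb; exact hb.2
    simp only [alphaF, betaF, hb, if_false, pot, min_eq_left hd, min_eq_left he]
    set w := d * (starRingEnd ℂ) x + e * (starRingEnd ℂ) y + x * e * (starRingEnd ℂ) z
    have hw : |w.re| ≤ ‖d‖ * ‖x‖ + ‖e‖ * ‖y‖ + ‖e‖ * ‖z‖ := by
      refine (Complex.abs_re_le_norm w).trans ((norm_add₃_le).trans ?_)
      simp only [norm_mul, RCLike.norm_conj]
      have : ‖x‖ * ‖e‖ * ‖z‖ ≤ 1 * ‖e‖ * ‖z‖ := by gcongr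
      linarith
    have h1 : w.re ^ 2 ≤ (‖d‖ * ‖x‖ + ‖e‖ * ‖y‖ + ‖e‖ * ‖z‖) ^ 2 := by
      rw [← sq_abs]; gcongr
    have h2 : (‖d‖ * ‖x‖ + ‖e‖ * ‖y‖ + ‖e‖ * ‖z‖) ^ 2 ≤ (‖d‖ ^ 2 + ‖e‖ ^ 2 + ‖e‖ ^ 2) *
        (‖x‖ ^ 2 + ‖y‖ ^ 2 + ‖z‖ ^ 2) := by
      nlinarith [sq_nonneg (‖d‖ * ‖y‖ - ‖e‖ * ‖x‖), sq_nonneg (‖d‖ * ‖z‖ - ‖e‖ * ‖x‖),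
        sq_nonneg (‖e‖ * ‖z‖ - ‖e‖ * ‖y‖)]
    have h3 : (‖d‖ ^ 2 + ‖e‖ ^ 2 + ‖e‖ ^ 2) * (‖x‖ ^ 2 + ‖y‖ ^ 2 + ‖z‖ ^ 2) ≤
        (2 * (‖d‖ ^ 2 + ‖e‖ ^ 2)) * (n + ‖x‖ ^ 2 + ‖y‖ ^ 2 + ‖z‖ ^ 2) := by
      have : (0:ℝ) ≤ n := Nat.cast_nonneg n
      have := sq_nonneg ‖d‖
      gcongr <;> linarith
    nlinarith

lemma sts_mono (d e : ℕ → ℂ) : Monotone fun n => (sts d e n).1 := by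
  refine monotone_nat_of_le_succ fun n => ?_
  simp only [sts, stp]
  split_ifs <;> simp

lemma sts_const (d e : ℕ → ℂ) (a : ℕ) : ∀ b, a ≤ b → (sts d e b).1 = (sts d e a).1 →
    (sts d e b).2.1 = (sts d e a).2.1 + DD d a b ∧
    (sts d e b).2.2.1 = (sts d e a).2.2.1 + DD e a b ∧
    (sts d e b).2.2.2 = (sts d e a).2.2.2 + BB d e a b + (sts d e a).2.1 * DD e a b := by
  intro b hab
  induction b, hab using Nat.le_induction with
  | base => intro _; simp [DD_self, BB_self]
  | succ b hab ih =>
    intro h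
    have m1 := sts_mono d e hab
    have m2 := sts_mono d e (Nat.le_succ b)
    simp only [Nat.succ_eq_add_one] at m1 m2
    have hb : (sts d e b).1 = (sts d e a).1 := by omega
    obtain ⟨i1, i2, i3⟩ := ih hb
    have hnB : ¬ Bad (sts d e b) (d b) (e b) := by
      intro hB
      simp only [sts, stp, hB, if_true] at h
      omega
    simp only [sts, stp, hnB, if_false, DD_succ d hab, DD_succ e hab, BB_succ d e hab]
    rw [i1, i2, i3]
    refine ⟨by ring, by ring, by ring⟩

/-- the jump set at unit level. -/
def Jmp (d e : ℕ → ℂ) (a b : ℕ) : Prop :=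
  4 < ‖BB d e a b‖ ∨ 2 < ‖DD d a b‖ ∨ 2 < ‖DD e a b‖

lemma jmp_lt (d e : ℕ → ℂ) (a b : ℕ) (hab : a ≤ b) (h : Jmp d e a b) :
    (sts d e a).1 + 1 ≤ (sts d e b).1 := by
  by_contra hcon
  have m1 := sts_mono d e hab
  simp only at m1
  have hb : (sts d e b).1 = (sts d e a).1 := by omega
  obtain ⟨i1, i2, i3⟩ := sts_const d e a b hab hb
  obtain ⟨a1, a2, a3⟩ := okSt_sts d e a
  obtain ⟨b1, b2, b3⟩ := okSt_sts d e b
  have k1 : ‖DD d a b‖ ≤ 2 := by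
    rw [show DD d a b = (sts d e b).2.1 - (sts d e a).2.1 by rw [i1]; ring]
    exact (norm_sub_le _ _).trans (by linarith)
  have k2 : ‖DD e a b‖ ≤ 2 := by
    rw [show DD e a b = (sts d e b).2.2.1 - (sts d e a).2.2.1 by rw [i2]; ring]
    exact (norm_sub_le _ _).trans (by linarith)
  have k3 : ‖BB d e a b‖ ≤ 4 := by
    rw [show BB d e a b = (sts d e b).2.2.2 - (sts d e a).2.2.2 - (sts d e a).2.1 * DD e a b by
      rw [i3]; ring]
    refine (norm_sub_le _ _).trans ?_
    have : ‖(sts d e a).2.1 * DD e a b‖ ≤ 1 * 2 := by rw [norm_mul]; gcongr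
    have := norm_sub_le (sts d e b).2.2.2 (sts d e a).2.2.2
    linarith
  rcases h with h | h | h <;> linarith

open Classical in
lemma jmp_count (d e : ℕ → ℂ) (T M : ℕ) (n : ℕ → ℕ) (hn : Monotone n) (hT : ∀ k, n k ≤ T) :
    (∑ k ∈ Finset.range M, if Jmp d e (n k) (n (k+1)) then (1:ℝ) else 0) ≤ (sts d e T).1 := by
  have : (∑ k ∈ Finset.range M, if Jmp d e (n k) (n (k+1)) then (1:ℝ) else 0) ≤
      (sts d e (n M)).1 - (sts d e (n 0)).1 := by
    induction M with
    | zero => simp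
    | succ M ih =>
      rw [Finset.sum_range_succ]
      split_ifs with h
      · have := jmp_lt d e _ _ (hn (Nat.le_succ M)) h
        have : ((sts d e (n M)).1 : ℝ) + 1 ≤ (sts d e (n (M+1))).1 := by exact_mod_cast this
        linarith
      · have := sts_mono d e (hn (Nat.le_succ M))
        have : ((sts d e (n M)).1 : ℝ) ≤ (sts d e (n (M+1))).1 := by exact_mod_cast this
        linarith
  have h2 : ((sts d e (n M)).1 : ℝ) ≤ (sts d e T).1 := by exact_mod_cast sts_mono d e (hT M)
  have h3 : (0:ℝ) ≤ (sts d e (n 0)).1 := Nat.cast_nonneg _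
  linarith

-- measurability
open Classical in
lemma measurable_sts {Ω : Type*} [MeasurableSpace Ω] (d e : ℕ → Ω → ℂ) (hd : ∀ n, Measurable (d n))
    (he : ∀ n, Measurable (e n)) (n : ℕ) :
    Measurable fun x => sts (fun j => d j x) (fun j => e j x) n := by
  induction n with
  | zero => simp only [sts]; exact measurable_const
  | succ n ih =>
    simp only [sts, stp]
    have hd' := hd n
    have he' := he n
    have m1 := ih.fst
    have m2 := ih.snd.fst
    have m3 := ih.snd.snd.fst
    have m4 := ih.snd.snd.snd
    refine Measurable.ite ?_ (by fun_prop) (by fun_prop)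
    simp only [Bad, Set.ofPred_or]
    refine MeasurableSet.union ?_ (MeasurableSet.union ?_ (MeasurableSet.union ?_
      (MeasurableSet.union ?_ ?_)))
    all_goals exact measurableSet_lt measurable_const (by fun_prop)

lemma sts_congr (d e d' e' : ℕ → ℂ) (n : ℕ) (h : ∀ j < n, d j = d' j) (h' : ∀ j < n, e j = e' j) :
    sts d e n = sts d' e' n := by
  induction n with
  | zero => rfl
  | succ n ih =>
    simp only [sts]
    rw [ih (fun j hj => h j (by omega)) (fun j hj => h' j (by omega)), h n (by omega),
      h' n (by omega)]

lemma alphaF_neg (d e : ℂ) : alphaF (-d) (-e) = alphaF d e := by simp [alphaF]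
lemma betaF_neg (s : St) (d e : ℂ) : betaF s (-d) (-e) = - betaF s d e := by
  simp only [betaF, norm_neg]
  split_ifs
  · simp
  · simp; ring

open Classical in
lemma measurable_betaF {Ω : Type*} [MeasurableSpace Ω] (s : Ω → St) (d e : Ω → ℂ)
    (hs : Measurable s) (hd : Measurable d) (he : Measurable e) :
    Measurable fun x => betaF (s x) (d x) (e x) := by
  simp only [betaF]
  have m2 := hs.snd.fst
  have m3 := hs.snd.snd.fst
  have m4 := hs.snd.snd.snd
  refine Measurable.ite ?_ measurable_const ?_
  · simp only [Set.ofPred_or]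
    exact MeasurableSet.union (measurableSet_lt measurable_const (by fun_prop))
      (measurableSet_lt measurable_const (by fun_prop))
  · have c : Measurable (starRingEnd ℂ : ℂ → ℂ) := Complex.continuous_conj.measurable
    have k1 := c.comp m2
    have k2 := c.comp m3
    have k3 := c.comp m4
    simp only [Function.comp_def] at k1 k2 k3
    exact (Complex.measurable_re.comp (((hd.mul k1).add (he.mul k2)).add
      ((m2.mul he).mul k3))).const_mul 2

lemma measurable_alphaF {Ω : Type*} [MeasurableSpace Ω] (d e : Ω → ℂ)
    (hd : Measurable d) (he : Measurable e) :
    Measurable fun x => alphaF (d x) (e x) := by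
  simp only [alphaF]
  fun_prop

lemma summable_geom_int (γ : ℝ) (h0 : 0 ≤ γ) (h1 : γ < 1) : Summable fun l : ℤ => γ ^ l.natAbs := by
  apply Summable.of_nat_of_neg
  · simpa using summable_geometric_of_lt_one h0 h1
  · simpa using summable_geometric_of_lt_one h0 h1

lemma sum_geom_int (γ : ℝ) (h0 : 0 ≤ γ) (h1 : γ < 1) (s : Finset ℤ) (l0 : ℤ) :
    ∑ l ∈ s, γ ^ (l - l0).natAbs ≤ ∑' l : ℤ, γ ^ l.natAbs := by
  have := (summable_geom_int γ h0 h1).sum_le_tsum (s.image (fun l => l - l0))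
    (fun i _ => by positivity)
  rwa [Finset.sum_image (by intro a _ b _ h; simpa using h)] at this

lemma geom_sum_min (θ c b : ℝ) (hθ : 1 < θ) (hc : 0 < c) (hcb : c < b) :
    ∃ C : ℝ, 0 ≤ C ∧ ∀ (s : Finset ℤ) (y : ℝ), 0 ≤ y →
      ∑ l ∈ s, (θ ^ (l:ℝ)) ^ c * (min (y / θ ^ (l:ℝ)) 1) ^ b ≤ C * y ^ c := by
  have hθ0 : 0 < θ := by linarith
  set γ := max (θ ^ (-c)) (θ ^ (-(b-c))) with hγ
  have hγ0 : 0 ≤ γ := le_max_of_le_left (by positivity)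
  have hγ1 : γ < 1 := max_lt (Real.rpow_lt_one_of_one_lt_of_neg hθ (by linarith))
    (Real.rpow_lt_one_of_one_lt_of_neg hθ (by linarith))
  set S := ∑' l : ℤ, γ ^ l.natAbs
  have hS : 0 ≤ S := tsum_nonneg fun _ => by positivity
  refine ⟨θ ^ (b-c) * S, by positivity, fun s y hy => ?_⟩
  rcases hy.eq_or_lt with rfl | hy
  · rw [Real.zero_rpow hc.ne', mul_zero]
    apply le_of_eq
    apply Finset.sum_eq_zero
    intro l _
    simp [Real.zero_rpow (by linarith : b ≠ 0)]
  obtain ⟨l0, hl1, hl2⟩ := exists_mem_Ico_zpow hy hθ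
  rw [← Real.rpow_intCast] at hl1 hl2
  have key : ∀ l ∈ s, (θ ^ (l:ℝ)) ^ c * (min (y / θ ^ (l:ℝ)) 1) ^ b ≤
      θ ^ (b-c) * y ^ c * γ ^ (l - l0).natAbs := by
    intro l _
    have hone : 1 ≤ θ ^ (b - c) := Real.one_le_rpow hθ.le (by linarith)
    have hm0 : 0 ≤ min (y / θ ^ (l:ℝ)) 1 := le_min (by positivity) zero_le_one
    rcases le_total l l0 with h | h
    · obtain ⟨n, rfl⟩ : ∃ n : ℕ, l0 = l + n := ⟨(l0 - l).toNat, by omega⟩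
      have e1 : (θ ^ (l:ℝ)) ^ c * (min (y / θ ^ (l:ℝ)) 1) ^ b ≤ (θ ^ (l:ℝ)) ^ c * 1 := by
        gcongr
        exact Real.rpow_le_one hm0 (min_le_right _ _) (by linarith)
      have e2 : (θ ^ (l:ℝ)) ^ c = (θ ^ (((l + n : ℤ)):ℝ)) ^ c * (θ ^ (-c)) ^ n := by
        rw [← Real.rpow_natCast, ← Real.rpow_mul hθ0.le, ← Real.rpow_mul hθ0.le,
          ← Real.rpow_mul hθ0.le, ← Real.rpow_add hθ0]
        push_cast; congr 1; ring
      have e3 : (θ ^ (((l + n : ℤ)):ℝ)) ^ c ≤ y ^ c := by gcongr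
      have e4 : (θ ^ (-c)) ^ n ≤ γ ^ n := by gcongr; exact le_max_left _ _
      have e5 : (l - (l + (n:ℤ))).natAbs = n := by omega
      rw [e5]
      calc _ ≤ _ := e1
        _ = (θ ^ (((l + n : ℤ)):ℝ)) ^ c * (θ ^ (-c)) ^ n := by rw [mul_one, e2]
        _ ≤ y ^ c * γ ^ n := by gcongr
        _ ≤ θ ^ (b-c) * y ^ c * γ ^ n := by
          have : 0 ≤ y ^ c * γ ^ n := by positivity
          nlinarith
    · obtain ⟨n, rfl⟩ : ∃ n : ℕ, l = l0 + n := ⟨(l - l0).toNat, by omega⟩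
      have e5 : (l0 + (n:ℤ) - l0).natAbs = n := by omega
      rw [e5]
      set z := θ ^ (((l0 + n : ℤ)):ℝ) with hz
      have hz0 : 0 < z := by positivity
      have e1 : z ^ c * (min (y / z) 1) ^ b ≤ z ^ c * (y / z) ^ b := by
        gcongr
        · linarith
        · exact min_le_left _ _
      have e2 : z ^ c * (y / z) ^ b = y ^ c * (y / z) ^ (b - c) := by
        rw [Real.div_rpow hy.le hz0.le, Real.div_rpow hy.le hz0.le, Real.rpow_sub hy,
          Real.rpow_sub hz0]
        have := Real.rpow_pos_of_pos hy c
        have := Real.rpow_pos_of_pos hz0 c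
        have := Real.rpow_pos_of_pos hz0 b
        field_simp
      have e3 : (y / z) ^ (b - c) ≤ (θ ^ ((1:ℝ) - n)) ^ (b-c) := by
        have : y / z ≤ θ ^ ((1:ℝ) - n) := by
          rw [div_le_iff₀ hz0, hz, ← Real.rpow_add hθ0]
          refine hl2.le.trans (le_of_eq ?_)
          push_cast; congr 1; ring
        apply Real.rpow_le_rpow (by positivity) this (by linarith)
      have e4 : (θ ^ ((1:ℝ) - n)) ^ (b-c) = θ ^ (b-c) * (θ ^ (-(b-c))) ^ n := by
        rw [← Real.rpow_natCast, ← Real.rpow_mul hθ0.le, ← Real.rpow_mul hθ0.le,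
          ← Real.rpow_add hθ0]
        congr 1; ring
      have e6 : (θ ^ (-(b-c))) ^ n ≤ γ ^ n := by gcongr; exact le_max_right _ _
      calc _ ≤ _ := e1
        _ = _ := e2
        _ ≤ y ^ c * (θ ^ (b-c) * (θ ^ (-(b-c))) ^ n) := by rw [← e4]; gcongr
        _ ≤ y ^ c * (θ ^ (b-c) * γ ^ n) := by gcongr
        _ = _ := by ring
  calc _ ≤ ∑ l ∈ s, θ ^ (b-c) * y ^ c * γ ^ (l - l0).natAbs := Finset.sum_le_sum key
    _ = θ ^ (b-c) * y ^ c * ∑ l ∈ s, γ ^ (l - l0).natAbs := by rw [Finset.mul_sum]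
    _ ≤ θ ^ (b-c) * y ^ c * S := by gcongr; exact sum_geom_int γ hγ0 hγ1 s l0
    _ = _ := by ring

open Classical in
/-- layer-cake: discrete decomposition. -/
lemma layer_le (η : ℝ) (h0 : 0 < η) (h1 : η < 1) (ξ : ℝ) (hξ1 : ξ ≤ 1) (L : ℕ) :
    ξ ≤ η⁻¹ * (∑ m ∈ Finset.range L, if η ^ (m+1) < ξ then η ^ (m+1) else 0) + η ^ L := by
  induction L with
  | zero => simpa using hξ1
  | succ L ih =>
    by_cases h : ξ ≤ η ^ (L+1)
    · refine h.trans ?_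
      have : 0 ≤ η⁻¹ * (∑ m ∈ Finset.range (L+1), if η ^ (m+1) < ξ then η ^ (m+1) else 0) := by
        refine mul_nonneg (by positivity) (Finset.sum_nonneg fun m _ => ?_)
        split_ifs <;> positivity
      linarith
    · push Not at h
      rw [Finset.sum_range_succ, if_pos h]
      refine ih.trans ?_
      rw [mul_add]
      have : η⁻¹ * η ^ (L+1) = η ^ L := by rw [pow_succ]; field_simp
      rw [this]
      have : 0 ≤ η ^ (L+1) := by positivity
      linarith

def Adm (r ρ : ℝ) : Prop := (ρ = r ∧ r < 2) ∨ (r = 2 ∧ 2 < ρ)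

lemma level_sum (r ρ η : ℝ) (hr : 1 ≤ r) (h : Adm r ρ) (h0 : 0 < η) (h1 : η < 1) :
    ∃ C : ℝ, 0 ≤ C ∧ ∀ (L : ℕ) (y : ℝ), 0 ≤ y →
      ∑ m ∈ Finset.range L, (η ^ m) ^ ρ * (min (y / η ^ m) 1) ^ 2 ≤ C * y ^ r := by
  rcases h with ⟨rfl, h2⟩ | ⟨rfl, h2⟩
  · obtain ⟨C, hC, h⟩ := geom_sum_min η⁻¹ ρ 2 ((one_lt_inv₀ h0).2 h1) (by linarith) h2
    refine ⟨C, hC, fun L y hy => ?_⟩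
    have := h ((Finset.range L).image (fun m : ℕ => -(m:ℤ))) y hy
    rw [Finset.sum_image (by intro a _ b _ h; simpa using h)] at this
    refine le_trans (le_of_eq ?_) this
    refine Finset.sum_congr rfl fun m _ => ?_
    have : η⁻¹ ^ (((-(m:ℤ) : ℤ)):ℝ) = η ^ m := by
      rw [Real.rpow_intCast]; simp
    rw [this]
    congr 1
    exact_mod_cast (Real.rpow_natCast _ 2).symm
  · set γ := η ^ (ρ - 2) with hγ
    have hγ1 : γ < 1 := Real.rpow_lt_one h0.le h1 (by linarith)
    have hγ0 : 0 ≤ γ := by positivity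
    refine ⟨(1 - γ)⁻¹, inv_nonneg.2 (by linarith), fun L y hy => ?_⟩
    have key : ∀ m ∈ Finset.range L, (η ^ m) ^ ρ * (min (y / η ^ m) 1) ^ 2 ≤ γ ^ m * y ^ 2 := by
      intro m _
      have hm : 0 < η ^ m := by positivity
      have : (min (y / η ^ m) 1) ^ 2 ≤ (y / η ^ m) ^ 2 := by
        have : 0 ≤ min (y / η ^ m) 1 := le_min (by positivity) zero_le_one
        gcongr
        exact min_le_left _ _
      calc _ ≤ (η ^ m) ^ ρ * (y / η ^ m) ^ 2 := by gcongr
        _ = (η ^ m) ^ (ρ - 2) * y ^ 2 := by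
          rw [Real.rpow_sub hm, Real.rpow_two, div_pow]; field_simp
        _ = _ := by
          rw [hγ, ← Real.rpow_natCast η m, ← Real.rpow_natCast (η ^ (ρ - 2)) m, ← Real.rpow_mul h0.le,
            ← Real.rpow_mul h0.le, mul_comm (m:ℝ)]
    rw [Real.rpow_two]
    calc _ ≤ ∑ m ∈ Finset.range L, γ ^ m * y ^ 2 := Finset.sum_le_sum key
      _ = (∑ m ∈ Finset.range L, γ ^ m) * y ^ 2 := by rw [Finset.sum_mul]
      _ ≤ _ := by
        gcongr
        rw [← tsum_geometric_of_lt_one hγ0 hγ1]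
        exact (summable_geometric_of_lt_one hγ0 hγ1).sum_le_tsum _ (fun i _ => by positivity)

def VarB (A : ℝ) (t ρ σ : ℝ) (T : ℕ) (d e : ℕ → ℂ) : Prop :=
  ∀ (n : ℕ → ℕ), Monotone n → (∀ k, n k ≤ T) → ∀ M : ℕ,
    (∑ k ∈ Finset.range M, ‖BB d e (n k) (n (k+1))‖ ^ t ≤ A) ∧
    (∑ k ∈ Finset.range M, ‖DD d (n k) (n (k+1))‖ ^ ρ ≤ A) ∧
    (∑ k ∈ Finset.range M, ‖DD e (n k) (n (k+1))‖ ^ σ ≤ A)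

lemma pot_sts (d e : ℕ → ℂ) (n : ℕ) : pot (sts d e n) ≤
    ∑ j ∈ Finset.range n, (alphaF (d j) (e j) + betaF (sts d e j) (d j) (e j)) := by
  induction n with
  | zero => simp [sts, pot]
  | succ n ih =>
    rw [Finset.sum_range_succ]
    have := pot_stp (sts d e n) (okSt_sts d e n) (d n) (e n)
    simp only [sts]
    linarith

lemma DD_div (d : ℕ → ℂ) (c : ℂ) (a b : ℕ) : DD (fun j => d j / c) a b = DD d a b / c := by
  simp [DD, Finset.sum_div]
lemma BB_div (d e : ℕ → ℂ) (c c' : ℂ) (a b : ℕ) :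
    BB (fun j => d j / c) (fun j => e j / c') a b = BB d e a b / (c * c') := by
  simp only [BB, Finset.sum_div]
  refine Finset.sum_congr rfl fun i _ => Finset.sum_congr rfl fun j _ => ?_
  rw [div_mul_div_comm]

lemma nontriv_count (T M : ℕ) (n : ℕ → ℕ) (hn : Monotone n) (hT : ∀ k, n k ≤ T) :
    (∑ k ∈ Finset.range M, if n k < n (k+1) then (1:ℝ) else 0) ≤ T := by
  have : (∑ k ∈ Finset.range M, if n k < n (k+1) then (1:ℝ) else 0) ≤ n M - n 0 := by
    induction M with
    | zero => simp
    | succ M ih =>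
      rw [Finset.sum_range_succ]
      split_ifs with h
      · have : (n M : ℝ) + 1 ≤ n (M+1) := by exact_mod_cast h
        linarith
      · have : (n M : ℝ) ≤ n (M+1) := by exact_mod_cast hn (Nat.le_succ M)
        linarith
  have h2 : (n M : ℝ) ≤ T := by exact_mod_cast hT M
  have h3 : (0:ℝ) ≤ n 0 := Nat.cast_nonneg _
  linarith

open Classical in
/-- abstract summation over levels -/
lemma level_assemble (w : ℝ) (hw0 : 0 < w) (hw1 : w < 1) (T L M : ℕ) (hL : T * w ^ L ≤ 1)
    (n : ℕ → ℕ) (hn : Monotone n) (hT : ∀ k, n k ≤ T) (J : ℕ → ℕ → Prop) (N : ℕ → ℝ)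
    (hJN : ∀ m, ∑ k ∈ Finset.range M, (if J m k then (1:ℝ) else 0) ≤ N m)
    (hN0 : ∀ m, 0 ≤ N m)
    (hN : ∑ m ∈ Finset.range (L+1), w ^ m * N m ≤ 1) (v : ℕ → ℝ) (hv1 : ∀ k < M, v k ≤ 1)
    (hvt : ∀ k, n k = n (k+1) → v k = 0) (hvJ : ∀ m k, w ^ m < v k → J m k) :
    ∑ k ∈ Finset.range M, v k ≤ w⁻¹ + 1 := by
  have h1 : ∀ k ∈ Finset.range M, v k ≤ w⁻¹ * (∑ m ∈ Finset.range L,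
      w ^ (m+1) * (if J (m+1) k then 1 else 0)) + w ^ L * (if n k < n (k+1) then 1 else 0) := by
    intro k hk
    by_cases hh : n k < n (k+1)
    · rw [if_pos hh, mul_one]
      refine (layer_le w hw0 hw1 (v k) (hv1 k (Finset.mem_range.1 hk)) L).trans ?_
      gcongr with m _
      by_cases h : w ^ (m+1) < v k
      · rw [if_pos h, if_pos (hvJ _ _ h), mul_one]
      · rw [if_neg h]; split_ifs <;> positivity
    · rw [hvt k (le_antisymm (hn (Nat.le_succ k)) (not_lt.1 hh)), if_neg hh, mul_zero, add_zero]
      refine mul_nonneg (by positivity) (Finset.sum_nonneg fun m _ => ?_)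
      split_ifs <;> positivity
  refine (Finset.sum_le_sum h1).trans ?_
  rw [Finset.sum_add_distrib, ← Finset.mul_sum, ← Finset.mul_sum, Finset.sum_comm]
  have h2 : w ^ L * ∑ k ∈ Finset.range M, (if n k < n (k+1) then (1:ℝ) else 0) ≤ 1 := by
    refine le_trans ?_ hL
    rw [mul_comm]
    gcongr
    exact nontriv_count T M n hn hT
  have h3 : ∑ m ∈ Finset.range L, ∑ k ∈ Finset.range M, w ^ (m+1) * (if J (m+1) k then (1:ℝ) else 0)
      ≤ 1 := by
    refine le_trans ?_ hN
    rw [Finset.sum_range_succ']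
    have : ∑ m ∈ Finset.range L, ∑ k ∈ Finset.range M, w ^ (m+1) * (if J (m+1) k then (1:ℝ) else 0)
      ≤ ∑ m ∈ Finset.range L, w ^ (m+1) * N (m+1) := by
      refine Finset.sum_le_sum fun m _ => ?_
      rw [← Finset.mul_sum]
      gcongr
      exact hJN _
    have := hN0 0
    simp only [pow_zero, one_mul]
    linarith
  have h4 : 0 < w⁻¹ := by positivity
  nlinarith

lemma exp_t (ρ σ t : ℝ) (hρ : 0 < ρ) (hσ : 0 < σ) (ht : 0 < t) (h : 1 / t = 1 / ρ + 1 / σ) :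
    ∃ η1 η2 w : ℝ, 0 < η1 ∧ η1 < 1 ∧ 0 < η2 ∧ η2 < 1 ∧ 0 < w ∧ w < 1 ∧ η1 ^ ρ = w ∧ η2 ^ σ = w ∧
      (η1 * η2) ^ t = w := by
  refine ⟨2 ^ (-(t/ρ)), 2 ^ (-(t/σ)), 2 ^ (-t), by positivity, 
    Real.rpow_lt_one_of_one_lt_of_neg (by norm_num) (by simp; positivity), by positivity, 
    Real.rpow_lt_one_of_one_lt_of_neg (by norm_num) (by simp; positivity), by positivity,
    Real.rpow_lt_one_of_one_lt_of_neg (by norm_num) (by simp; positivity), ?_, ?_, ?_⟩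
  · rw [← Real.rpow_mul (by norm_num)]; congr 1; field_simp
  · rw [← Real.rpow_mul (by norm_num)]; congr 1; field_simp
  · rw [← Real.rpow_add (by norm_num), ← Real.rpow_mul (by norm_num)]
    congr 1
    have : t / ρ + t / σ = 1 := by
      have : t * (1/t) = 1 := by field_simp
      rw [h] at this; rw [← this]; ring
    nlinarith

lemma pow_comm_rpow (η ρ : ℝ) (h : 0 ≤ η) (m : ℕ) : (η ^ m) ^ ρ = (η ^ ρ) ^ m := by
  rw [← Real.rpow_natCast, ← Real.rpow_natCast, ← Real.rpow_mul h, ← Real.rpow_mul h, mul_comm]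

section
variable (η1 η2 w : ℝ)

def qa (L : ℕ) (d e : ℕ → ℂ) (n : ℕ) : ℝ := ∑ m ∈ Finset.range (L+1),
  w ^ m * alphaF (d n / (η1 ^ m : ℝ)) (e n / (η2 ^ m : ℝ))
def qs (m : ℕ) (d e : ℕ → ℂ) (n : ℕ) : St :=
  sts (fun j => d j / (η1 ^ m : ℝ)) (fun j => e j / (η2 ^ m : ℝ)) n
def qb (L : ℕ) (d e : ℕ → ℂ) (n : ℕ) : ℝ := ∑ m ∈ Finset.range (L+1),
  w ^ m * betaF (qs η1 η2 m d e n) (d n / (η1 ^ m : ℝ)) (e n / (η2 ^ m : ℝ))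

lemma qQ_ge (hw : 0 < w) (L : ℕ) (d e : ℕ → ℂ) (n : ℕ) :
    ∑ m ∈ Finset.range (L+1), w ^ m * pot (qs η1 η2 m d e n) ≤
      ∑ j ∈ Finset.range n, (qa η1 η2 w L d e j + qb η1 η2 w L d e j) := by
  simp only [qa, qb, ← Finset.sum_add_distrib, ← mul_add]
  rw [Finset.sum_comm]
  refine Finset.sum_le_sum fun m _ => ?_
  rw [← Finset.mul_sum]
  gcongr
  exact pot_sts _ _ n

lemma qa_nonneg (hw : 0 < w) (L : ℕ) (d e : ℕ → ℂ) (n : ℕ) : 0 ≤ qa η1 η2 w L d e n :=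
  Finset.sum_nonneg fun m _ => mul_nonneg (by positivity) (alphaF_nonneg _ _)

lemma qb_sq (hw : 0 < w) (L : ℕ) (d e : ℕ → ℂ) (n : ℕ) :
    (qb η1 η2 w L d e n) ^ 2 ≤ 4 * qa η1 η2 w L d e n *
      ∑ j ∈ Finset.range n, (qa η1 η2 w L d e j + qb η1 η2 w L d e j) := by
  have h1 : (qb η1 η2 w L d e n) ^ 2 ≤ (∑ m ∈ Finset.range (L+1),
      4 * (w ^ m * alphaF (d n / (η1 ^ m : ℝ)) (e n / (η2 ^ m : ℝ)))) *
      (∑ m ∈ Finset.range (L+1), w ^ m * pot (qs η1 η2 m d e n)) := by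
    apply Finset.sum_sq_le_sum_mul_sum_of_sq_le_mul
    · intro m _
      exact mul_nonneg (by norm_num) (mul_nonneg (by positivity) (alphaF_nonneg _ _))
    · intro m _
      exact mul_nonneg (by positivity) (pot_nonneg _)
    · intro m _
      have := betaF_sq (qs η1 η2 m d e n) (okSt_sts _ _ _) (d n / (η1 ^ m : ℝ)) (e n / (η2 ^ m : ℝ))
      have hw2 : 0 ≤ (w ^ m) ^ 2 := by positivity
      have := mul_le_mul_of_nonneg_left this hw2
      nlinarith
  rw [← Finset.mul_sum] at h1
  refine h1.trans ?_
  have := qa_nonneg η1 η2 w hw L d e n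
  change 4 * qa η1 η2 w L d e n * _ ≤ _
  gcongr
  exact qQ_ge η1 η2 w hw L d e n

lemma qs_congr (m : ℕ) (d e d' e' : ℕ → ℂ) (n : ℕ) (h : ∀ j < n, d j = d' j)
    (h' : ∀ j < n, e j = e' j) : qs η1 η2 m d e n = qs η1 η2 m d' e' n :=
  sts_congr _ _ _ _ n (fun j hj => by rw [h j hj]) (fun j hj => by rw [h' j hj])

end

lemma qa_le (r s ρ σ η1 η2 w : ℝ) (hr : 1 ≤ r) (hs : 1 ≤ s) (h : Adm r ρ) (h' : Adm s σ)
    (h10 : 0 < η1) (h11 : η1 < 1) (h20 : 0 < η2) (h21 : η2 < 1) (e1 : η1 ^ ρ = w)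
    (e2 : η2 ^ σ = w) : ∃ C : ℝ, 0 ≤ C ∧ ∀ L d e n,
      qa η1 η2 w L d e n ≤ C * (‖d n‖ ^ r + ‖e n‖ ^ s) := by
  obtain ⟨C1, hC1, b1⟩ := level_sum r ρ η1 hr h h10 h11
  obtain ⟨C2, hC2, b2⟩ := level_sum s σ η2 hs h' h20 h21
  refine ⟨2 * (C1 + C2), by positivity, fun L d e n => ?_⟩
  have k1 := b1 (L+1) ‖d n‖ (norm_nonneg _)
  have k2 := b2 (L+1) ‖e n‖ (norm_nonneg _)
  have : qa η1 η2 w L d e n = 2 * (∑ m ∈ Finset.range (L+1),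
      (η1 ^ m) ^ ρ * (min (‖d n‖ / η1 ^ m) 1) ^ 2) + 2 * (∑ m ∈ Finset.range (L+1),
      (η2 ^ m) ^ σ * (min (‖e n‖ / η2 ^ m) 1) ^ 2) := by
    rw [Finset.mul_sum, Finset.mul_sum, ← Finset.sum_add_distrib, qa]
    refine Finset.sum_congr rfl fun m _ => ?_
    rw [pow_comm_rpow _ _ h10.le, pow_comm_rpow _ _ h20.le, e1, e2, alphaF, norm_div, norm_div,
      Complex.norm_real, Complex.norm_real, Real.norm_of_nonneg (by positivity),
      Real.norm_of_nonneg (by positivity)]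
    ring
  have p1 : 0 ≤ ‖d n‖ ^ r := by positivity
  have p2 : 0 ≤ ‖e n‖ ^ s := by positivity
  rw [this]
  nlinarith [mul_nonneg hC1 p2, mul_nonneg hC2 p1]

open Classical in
lemma var_of_Q (ρ σ t η1 η2 w : ℝ) (hρ : 0 < ρ) (hσ : 0 < σ) (ht : 0 < t)
    (h10 : 0 < η1) (h20 : 0 < η2) (hw0 : 0 < w) (hw1 : w < 1) (e1 : η1 ^ ρ = w)
    (e2 : η2 ^ σ = w) (e3 : (η1 * η2) ^ t = w) (T L : ℕ) (hL : T * w ^ L ≤ 1) (d e : ℕ → ℂ)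
    (hQ : ∑ j ∈ Finset.range T, (qa η1 η2 w L d e j + qb η1 η2 w L d e j) < 1) :
    VarB ((4 ^ t + 2 ^ ρ + 2 ^ σ) * (w⁻¹ + 1)) t ρ σ T d e := by
  intro n hn hT M
  have hN1 : ∑ m ∈ Finset.range (L+1), w ^ m * ((qs η1 η2 m d e T).1 : ℝ) < 1 := by
    refine lt_of_le_of_lt ?_ hQ
    refine le_trans ?_ (qQ_ge η1 η2 w hw0 L d e T)
    refine Finset.sum_le_sum fun m _ => ?_
    gcongr
    simp only [pot]
    nlinarith [sq_nonneg ‖(qs η1 η2 m d e T).2.1‖, sq_nonneg ‖(qs η1 η2 m d e T).2.2.1‖,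
      sq_nonneg ‖(qs η1 η2 m d e T).2.2.2‖]
  have hc0 : ((qs η1 η2 0 d e T).1 : ℝ) < 1 := by
    refine lt_of_le_of_lt ?_ hN1
    rw [Finset.sum_range_succ']
    have : 0 ≤ ∑ m ∈ Finset.range L, w ^ (m+1) * ((qs η1 η2 (m+1) d e T).1 : ℝ) :=
      Finset.sum_nonneg fun m _ => by positivity
    simp only [pow_zero, one_mul]
    linarith
  set J : ℕ → ℕ → Prop := fun m k => Jmp (fun j => d j / (η1 ^ m : ℝ)) (fun j => e j / (η2 ^ m : ℝ))
    (n k) (n (k+1)) with hJ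
  have hJN : ∀ m, ∑ k ∈ Finset.range M, (if J m k then (1:ℝ) else 0) ≤ (qs η1 η2 m d e T).1 :=
    fun m => jmp_count _ _ T M n hn hT
  have hJ0 : ∀ k < M, ¬ J 0 k := by
    intro k hk hj
    have : (1:ℝ) ≤ ∑ k ∈ Finset.range M, (if J 0 k then (1:ℝ) else 0) := by
      refine le_trans ?_ (Finset.single_le_sum (f := fun k => if J 0 k then (1:ℝ) else 0)
        (fun i _ => by split_ifs <;> simp) (Finset.mem_range.2 hk))
      simp [hj]
    have := hJN 0
    linarith
  have main := level_assemble w hw0 hw1 T L M hL n hn hT J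
    (fun m => ((qs η1 η2 m d e T).1 : ℝ)) hJN (fun m => Nat.cast_nonneg _) hN1.le
  -- characterise J
  have hJiff : ∀ m k, J m k ↔ 4 * (η1 ^ m * η2 ^ m) < ‖BB d e (n k) (n (k+1))‖ ∨
      2 * η1 ^ m < ‖DD d (n k) (n (k+1))‖ ∨ 2 * η2 ^ m < ‖DD e (n k) (n (k+1))‖ := by
    intro m k
    simp only [hJ, Jmp, DD_div, BB_div, norm_div, norm_mul, Complex.norm_real]
    rw [Real.norm_of_nonneg (by positivity), Real.norm_of_nonneg (by positivity),
      lt_div_iff₀ (by positivity), lt_div_iff₀ (by positivity), lt_div_iff₀ (by positivity)]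
  -- general extraction
  have ext : ∀ (F : ℕ → ℝ) (c κ ζ : ℝ), 0 < c → 0 < κ → 0 < ζ → ζ ^ κ = w → (∀ k, 0 ≤ F k) →
      (∀ k, n k = n (k+1) → F k = 0) → (∀ m k, c * ζ ^ m < F k → J m k) →
      ∑ k ∈ Finset.range M, F k ^ κ ≤ c ^ κ * (w⁻¹ + 1) := by
    intro F c κ ζ hc hκ hζ hζw hF hFt hFJ
    have hlt : ∀ m k, w ^ m < (F k / c) ^ κ → c * ζ ^ m < F k := by
      intro m k h
      rw [← hζw, ← pow_comm_rpow _ _ hζ.le] at h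
      have := (Real.rpow_lt_rpow_iff (by positivity) (div_nonneg (hF k) hc.le) hκ).1 h
      rw [lt_div_iff₀ hc] at this
      linarith
    have := main (fun k => (F k / c) ^ κ) ?_ ?_ ?_
    · have e : ∑ k ∈ Finset.range M, F k ^ κ = c ^ κ * ∑ k ∈ Finset.range M, (F k / c) ^ κ := by
        rw [Finset.mul_sum]
        refine Finset.sum_congr rfl fun k _ => ?_
        rw [Real.div_rpow (hF k) hc.le, mul_div_cancel₀ _ (by positivity)]
      rw [e]; gcongr
    · intro k hk
      by_contra hcon
      push Not at hcon
      exact hJ0 k hk (hFJ 0 k (hlt 0 k (by simpa using hcon)))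
    · intro k hk; simp only [hFt k hk, zero_div]; exact Real.zero_rpow hκ.ne'
    · intro m k h; exact hFJ m k (hlt m k h)
  have hp : 0 < w⁻¹ + 1 := by positivity
  have q1 : (0:ℝ) < 4 ^ t := by positivity
  have q2 : (0:ℝ) < 2 ^ ρ := by positivity
  have q3 : (0:ℝ) < 2 ^ σ := by positivity
  refine ⟨?_, ?_, ?_⟩
  · refine (ext (fun k => ‖BB d e (n k) (n (k+1))‖) 4 t (η1 * η2) (by norm_num) ht (by positivity)
      e3 (fun _ => norm_nonneg _) (fun k hk => by simp [← hk, BB_self]) ?_).trans ?_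
    · intro m k h; rw [hJiff]; left; rwa [← mul_pow]
    · gcongr; linarith
  · refine (ext (fun k => ‖DD d (n k) (n (k+1))‖) 2 ρ η1 (by norm_num) hρ (by positivity)
      e1 (fun _ => norm_nonneg _) (fun k hk => by simp [← hk, DD_self]) ?_).trans ?_
    · intro m k h; rw [hJiff]; right; left; exact h
    · gcongr; linarith
  · refine (ext (fun k => ‖DD e (n k) (n (k+1))‖) 2 σ η2 (by norm_num) hσ (by positivity)
      e2 (fun _ => norm_nonneg _) (fun k hk => by simp [← hk, DD_self]) ?_).trans ?_
    · intro m k h; rw [hJiff]; right; right; exact h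
    · gcongr; linarith

lemma propM {Ω : Type*} [MeasurableSpace Ω] (μ : Measure Ω) (r s ρ σ t : ℝ)
    (hr : 1 ≤ r) (hs : 1 ≤ s) (h : Adm r ρ) (h' : Adm s σ) (ht : 0 < t)
    (hts : 1 / t = 1 / ρ + 1 / σ) (K : ℕ) :
    ∃ (C : ℝ≥0) (A : ℝ), 0 ≤ A ∧ ∀ (T : ℕ) (τ : ℕ → Ω → Ω) (d e : ℕ → Ω → ℂ),
      (∀ n, MeasurePreserving (τ n) μ μ) → (∀ n, Measurable (d n)) → (∀ n, Measurable (e n)) →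
      (∀ n x, d n (τ n x) = - d n x) → (∀ n x, e n (τ n x) = - e n x) →
      (∀ j n x, j < n → d j (τ n x) = d j x) → (∀ j n x, j < n → e j (τ n x) = e j x) →
      ∃ Z : Ω → ℝ≥0∞, Measurable Z ∧
        ∫⁻ x, Z x ∂μ ≤ C * ∫⁻ x, ENNReal.ofReal
          ((∑ j ∈ Finset.range T, (‖d j x‖ ^ r + ‖e j x‖ ^ s)) ^ (K+1)) ∂μ ∧
        ∀ x, Z x < 1 → VarB A t ρ σ T (fun j => d j x) (fun j => e j x) := by
  have hρ : 0 < ρ := by rcases h with ⟨rfl, _⟩ | ⟨_, h⟩ <;> linarith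
  have hσ : 0 < σ := by rcases h' with ⟨rfl, _⟩ | ⟨_, h⟩ <;> linarith
  obtain ⟨η1, η2, w, h10, h11, h20, h21, hw0, hw1, e1, e2, e3⟩ := exp_t ρ σ t hρ hσ ht hts
  obtain ⟨C1, hC1, hqa⟩ := qa_le r s ρ σ η1 η2 w hr hs h h' h10 h11 h20 h21 e1 e2
  obtain ⟨C2, hmom⟩ := moment_ineq μ 4 (by norm_num) K
  refine ⟨C2 * (Real.toNNReal C1) ^ (K+1), (4 ^ t + 2 ^ ρ + 2 ^ σ) * (w⁻¹ + 1), ?_, fun T τ d e hτ hdm hem hdτ heτ hdj hej => ?_⟩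
  rotate_left
  · obtain ⟨L, hL⟩ : ∃ L : ℕ, (T:ℝ) * w ^ L ≤ 1 := by
      obtain ⟨L, hL⟩ := exists_pow_lt_of_lt_one (show (0:ℝ) < 1 / (T+1) by positivity) hw1
      refine ⟨L, ?_⟩
      rw [lt_div_iff₀ (by positivity)] at hL
      have : 0 < w ^ L := by positivity
      nlinarith
    set a : ℕ → Ω → ℝ := fun n x => qa η1 η2 w L (fun j => d j x) (fun j => e j x) n with ha
    set b : ℕ → Ω → ℝ := fun n x => qb η1 η2 w L (fun j => d j x) (fun j => e j x) n with hb
    have ham : ∀ n, Measurable (a n) := by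
      intro n
      refine Finset.measurable_sum _ fun m _ => ?_
      exact (measurable_alphaF _ _ ((hdm n).div_const _) ((hem n).div_const _)).const_mul _
    have hbm : ∀ n, Measurable (b n) := by
      intro n
      refine Finset.measurable_sum _ fun m _ => ?_
      refine Measurable.const_mul (measurable_betaF _ _ _ ?_ ((hdm n).div_const _)
        ((hem n).div_const _)) _
      exact measurable_sts _ _ (fun n => (hdm n).div_const _) (fun n => (hem n).div_const _) n
    have hQ0 : ∀ n x, 0 ≤ ∑ j ∈ Finset.range n, (a j x + b j x) := fun n x => by
      refine le_trans ?_ (qQ_ge η1 η2 w hw0 L _ _ n)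
      exact Finset.sum_nonneg fun m _ => mul_nonneg (by positivity) (pot_nonneg _)
    have key := hmom T τ a b hτ ham hbm (fun n x => qa_nonneg η1 η2 w hw0 _ _ _ _)
      (fun n x => by
        simp only [ha, qa, hdτ, heτ, neg_div, alphaF_neg])
      (fun n x => by
        simp only [hb, qb, hdτ, heτ, neg_div, betaF_neg]
        rw [← Finset.sum_neg_distrib]
        refine Finset.sum_congr rfl fun m _ => ?_
        rw [qs_congr η1 η2 m (fun j => d j (τ n x)) (fun j => e j (τ n x)) (fun j => d j x)
          (fun j => e j x) n (fun j hj => hdj j n x hj) (fun j hj => hej j n x hj)]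
        ring)
      (fun j n x hj => by simp only [ha, qa, hdj j n x hj, hej j n x hj])
      (fun j n x hj => by
        simp only [hb, qb, hdj j n x hj, hej j n x hj]
        refine Finset.sum_congr rfl fun m _ => ?_
        rw [qs_congr η1 η2 m (fun j => d j (τ n x)) (fun j => e j (τ n x)) (fun j => d j x)
          (fun j => e j x) j (fun i hi => hdj i n x (hi.trans hj))
            (fun i hi => hej i n x (hi.trans hj))])
      hQ0 (fun n x => qb_sq η1 η2 w hw0 L _ _ n)
    refine ⟨fun x => ENNReal.ofReal ((∑ j ∈ Finset.range T, (a j x + b j x)) ^ (K+1)), ?_, ?_, ?_⟩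
    · exact ENNReal.measurable_ofReal.comp ((Finset.measurable_sum _ fun j _ =>
        (ham j).add (hbm j)).pow_const _)
    · refine key.trans ?_
      push_cast
      rw [mul_assoc]
      refine mul_le_mul_right ?_ _
      rw [← lintegral_const_mul' _ _ (by simp)]
      refine lintegral_mono fun x => ?_
      have hx : (∑ j ∈ Finset.range T, a j x) ≤ C1 *
          ∑ j ∈ Finset.range T, (‖d j x‖ ^ r + ‖e j x‖ ^ s) := by
        rw [Finset.mul_sum]
        exact Finset.sum_le_sum fun j _ => hqa L _ _ j
      have hx0 : 0 ≤ ∑ j ∈ Finset.range T, a j x :=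
        Finset.sum_nonneg fun j _ => qa_nonneg η1 η2 w hw0 _ _ _ _
      have : ((C1.toNNReal : ℝ≥0∞)) ^ (K+1) = ENNReal.ofReal (C1 ^ (K+1)) := by
        rw [ENNReal.ofReal_pow hC1]; rfl
      rw [this, ← ENNReal.ofReal_mul (by positivity), ← mul_pow]
      gcongr
    · intro x hx
      refine var_of_Q ρ σ t η1 η2 w hρ hσ ht h10 h20 hw0 hw1 e1 e2 e3 T L hL _ _ ?_
      have h1 : (∑ j ∈ Finset.range T, (a j x + b j x)) ^ (K+1) < 1 := by
        rwa [ENNReal.ofReal_lt_one] at hx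
      by_contra hcon
      push Not at hcon
      exact absurd (one_le_pow₀ hcon (n := K+1)) (not_le.2 h1)
  · positivity

open Classical in
/-- stopped sequence -/
def stopd (r α : ℝ) (d : ℕ → ℂ) (n : ℕ) : ℂ :=
  if ∑ i ∈ Finset.range (n+1), ‖d i‖ ^ r ≤ α ^ r then d n / (α : ℝ) else 0

lemma stopd_sum (r α : ℝ) (hr : 1 ≤ r) (hα : 0 < α) (d : ℕ → ℂ) (T : ℕ) :
    ∑ n ∈ Finset.range T, ‖stopd r α d n‖ ^ r ≤
      min ((∑ n ∈ Finset.range T, ‖d n‖ ^ r) / α ^ r) 1 := by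
  have hαr : 0 < α ^ r := by positivity
  have term : ∀ n, ‖stopd r α d n‖ ^ r ≤ ‖d n‖ ^ r / α ^ r := by
    intro n
    unfold stopd
    split_ifs
    · rw [norm_div, Complex.norm_real, Real.norm_of_nonneg hα.le, Real.div_rpow (norm_nonneg _) hα.le]
    · rw [norm_zero, Real.zero_rpow (by linarith)]; positivity
  have h1 : ∀ T, ∑ n ∈ Finset.range T, ‖stopd r α d n‖ ^ r ≤
      (∑ n ∈ Finset.range T, ‖d n‖ ^ r) / α ^ r := by
    intro T
    rw [Finset.sum_div]
    exact Finset.sum_le_sum fun n _ => term n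
  refine le_min (h1 T) ?_
  induction T with
  | zero => simp
  | succ T ih =>
    by_cases hc : ∑ i ∈ Finset.range (T+1), ‖d i‖ ^ r ≤ α ^ r
    · exact (h1 _).trans ((div_le_one hαr).2 hc)
    · rw [Finset.sum_range_succ]
      have : ‖stopd r α d T‖ ^ r = 0 := by
        rw [stopd, if_neg hc, norm_zero, Real.zero_rpow (by linarith)]
      linarith

lemma stopd_eq (r α : ℝ) (d : ℕ → ℂ) (T : ℕ)
    (h : ∑ n ∈ Finset.range T, ‖d n‖ ^ r ≤ α ^ r) (n : ℕ) (hn : n < T) :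
    stopd r α d n = d n / (α : ℝ) := by
  rw [stopd, if_pos]
  refine le_trans ?_ h
  exact Finset.sum_le_sum_of_subset_of_nonneg (Finset.range_mono (by omega))
    (fun i _ _ => by positivity)

lemma VarB_congr (A t ρ σ : ℝ) (T : ℕ) (d e d' e' : ℕ → ℂ) (h : ∀ n < T, d n = d' n)
    (h' : ∀ n < T, e n = e' n) (hV : VarB A t ρ σ T d e) : VarB A t ρ σ T d' e' := by
  intro n hn hT M
  have := hV n hn hT M
  have D1 : ∀ k, DD d (n k) (n (k+1)) = DD d' (n k) (n (k+1)) := fun k =>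
    Finset.sum_congr rfl fun i hi => h i ((Finset.mem_Ico.1 hi).2.trans_le (hT _))
  have D2 : ∀ k, DD e (n k) (n (k+1)) = DD e' (n k) (n (k+1)) := fun k =>
    Finset.sum_congr rfl fun i hi => h' i ((Finset.mem_Ico.1 hi).2.trans_le (hT _))
  have D3 : ∀ k, BB d e (n k) (n (k+1)) = BB d' e' (n k) (n (k+1)) := fun k =>
    Finset.sum_congr rfl fun j hj => Finset.sum_congr rfl fun i hi => by
      have := (Finset.mem_Ico.1 hj).2.trans_le (hT _)
      rw [h' j this, h i ((Finset.mem_Ico.1 hi).2.trans this)]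
  simpa only [D1, D2, D3] using this

lemma measurable_stopd {Ω : Type*} [MeasurableSpace Ω] (r α : ℝ) (d : ℕ → Ω → ℂ)
    (hd : ∀ n, Measurable (d n)) (n : ℕ) : Measurable fun x => stopd r α (fun j => d j x) n := by
  classical
  unfold stopd
  refine Measurable.ite ?_ ((hd n).div_const _) measurable_const
  exact measurableSet_le (Finset.measurable_sum _ fun i _ => (hd i).norm.pow_const r)
    measurable_const

lemma propD {Ω : Type*} [MeasurableSpace Ω] (μ : Measure Ω) (r s ρ σ t : ℝ)
    (hr : 1 ≤ r) (hs : 1 ≤ s) (h : Adm r ρ) (h' : Adm s σ) (ht : 0 < t)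
    (hts : 1 / t = 1 / ρ + 1 / σ) (K : ℕ) :
    ∃ (C : ℝ≥0) (A : ℝ), 0 ≤ A ∧ ∀ (T : ℕ) (τ : ℕ → Ω → Ω) (d e : ℕ → Ω → ℂ),
      (∀ n, MeasurePreserving (τ n) μ μ) → (∀ n, Measurable (d n)) → (∀ n, Measurable (e n)) →
      (∀ n x, d n (τ n x) = - d n x) → (∀ n x, e n (τ n x) = - e n x) →
      (∀ j n x, j < n → d j (τ n x) = d j x) → (∀ j n x, j < n → e j (τ n x) = e j x) →
      ∀ α β : ℝ, 0 < α → 0 < β →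
      ∃ Z : Ω → ℝ≥0∞, Measurable Z ∧
        ∫⁻ x, Z x ∂μ ≤ C * ∫⁻ x, ENNReal.ofReal
          ((min ((∑ j ∈ Finset.range T, ‖d j x‖ ^ r) / α ^ r) 1 +
            min ((∑ j ∈ Finset.range T, ‖e j x‖ ^ s) / β ^ s) 1) ^ (K+1)) ∂μ ∧
        ∀ x, Z x < 1 → ∑ j ∈ Finset.range T, ‖d j x‖ ^ r ≤ α ^ r →
          ∑ j ∈ Finset.range T, ‖e j x‖ ^ s ≤ β ^ s →
          VarB A t ρ σ T (fun j => d j x / (α:ℝ)) (fun j => e j x / (β:ℝ)) := by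
  obtain ⟨C, A, hA, hM⟩ := propM μ r s ρ σ t hr hs h h' ht hts K
  refine ⟨C, A, hA, fun T τ d e hτ hdm hem hdτ heτ hdj hej α β hα hβ => ?_⟩
  have aux1 : ∀ (r α : ℝ) (d : ℕ → Ω → ℂ), (∀ n x, d n (τ n x) = - d n x) →
      (∀ j n x, j < n → d j (τ n x) = d j x) → ∀ n x, stopd r α (fun j => d j (τ n x)) n =
        - stopd r α (fun j => d j x) n := by
    intro r α d h1 h2 n x
    have : ∑ i ∈ Finset.range (n+1), ‖d i (τ n x)‖ ^ r = ∑ i ∈ Finset.range (n+1), ‖d i x‖ ^ r := by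
      refine Finset.sum_congr rfl fun i hi => ?_
      rcases Nat.lt_succ_iff_lt_or_eq.1 (Finset.mem_range.1 hi) with h | rfl
      · rw [h2 i n x h]
      · rw [h1, norm_neg]
    simp only [stopd, this, h1]
    split_ifs <;> simp [neg_div]
  have aux2 : ∀ (r α : ℝ) (d : ℕ → Ω → ℂ),
      (∀ j n x, j < n → d j (τ n x) = d j x) → ∀ j n x, j < n →
        stopd r α (fun j => d j (τ n x)) j = stopd r α (fun j => d j x) j := by
    intro r α d h2 j n x hj
    have : ∑ i ∈ Finset.range (j+1), ‖d i (τ n x)‖ ^ r = ∑ i ∈ Finset.range (j+1), ‖d i x‖ ^ r := by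
      refine Finset.sum_congr rfl fun i hi => ?_
      have := Finset.mem_range.1 hi
      rw [h2 i n x (by omega)]
    simp only [stopd, this, h2 j n x hj]
  obtain ⟨Z, hZm, hZ, hZV⟩ := hM T τ (fun n x => stopd r α (fun j => d j x) n)
    (fun n x => stopd s β (fun j => e j x) n) hτ (measurable_stopd r α d hdm)
    (measurable_stopd s β e hem) (aux1 r α d hdτ hdj) (aux1 s β e heτ hej)
    (aux2 r α d hdj) (aux2 s β e hej)
  refine ⟨Z, hZm, hZ.trans ?_, fun x hx h1 h2 => ?_⟩
  · gcongr with x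
    rw [Finset.sum_add_distrib]
    exact add_le_add (stopd_sum r α hr hα _ T) (stopd_sum s β hs hβ _ T)
  · exact VarB_congr A t ρ σ T _ _ _ _ (fun n hn => stopd_eq r α _ T h1 n hn)
      (fun n hn => stopd_eq s β _ T h2 n hn) (hZV x hx)

lemma add_rpow_le2 (x y κ : ℝ) (hx : 0 ≤ x) (hy : 0 ≤ y) (hκ : 0 ≤ κ) :
    (x + y) ^ κ ≤ 2 ^ κ * (x ^ κ + y ^ κ) := by
  have hx' : 0 ≤ x ^ κ := by positivity
  have hy' : 0 ≤ y ^ κ := by positivity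
  have h2 : (0:ℝ) ≤ 2 ^ κ := by positivity
  rcases le_total x y with h | h
  · calc (x + y) ^ κ ≤ (2 * y) ^ κ := by gcongr; linarith
      _ = 2 ^ κ * y ^ κ := Real.mul_rpow (by norm_num) hy
      _ ≤ _ := by nlinarith
  · calc (x + y) ^ κ ≤ (2 * x) ^ κ := by gcongr; linarith
      _ = 2 ^ κ * x ^ κ := Real.mul_rpow (by norm_num) hx
      _ ≤ _ := by nlinarith

lemma sum_rpow_le_card {n : ℕ} (x : Fin n → ℝ) (hx : ∀ i, 0 ≤ x i) (κ : ℝ) (hκ : 0 < κ) :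
    (∑ i, x i) ^ κ ≤ (n:ℝ) ^ κ * ∑ i, x i ^ κ := by
  have hS : 0 ≤ ∑ i, x i ^ κ := Finset.sum_nonneg fun i _ => Real.rpow_nonneg (hx i) _
  have h : ∀ i, x i ≤ (∑ i, x i ^ κ) ^ κ⁻¹ := fun i => by
    rw [Real.le_rpow_inv_iff_of_pos (hx i) hS hκ]
    exact Finset.single_le_sum (f := fun i => x i ^ κ) (fun i _ => Real.rpow_nonneg (hx i) _)
      (Finset.mem_univ i)
  have h2 : ∑ i, x i ≤ n * (∑ i, x i ^ κ) ^ κ⁻¹ := by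
    refine (Finset.sum_le_sum fun i _ => h i).trans ?_
    simp
  calc (∑ i, x i) ^ κ ≤ (n * (∑ i, x i ^ κ) ^ κ⁻¹) ^ κ :=
        Real.rpow_le_rpow (Finset.sum_nonneg fun i _ => hx i) h2 hκ.le
    _ = _ := by rw [Real.mul_rpow (by positivity) (by positivity), Real.rpow_inv_rpow hS hκ.ne']

lemma young_t (ρ σ t x y : ℝ) (hρ : 0 < ρ) (hσ : 0 < σ) (ht : 0 < t) (h : 1 / t = 1 / ρ + 1 / σ)
    (hx : 0 ≤ x) (hy : 0 ≤ y) : (x * y) ^ t ≤ x ^ ρ + y ^ σ := by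
  have h1 : t / ρ + t / σ = 1 := by
    have : t * (1/t) = 1 := by field_simp
    rw [h] at this; rw [← this]; ring
  have := Real.geom_mean_le_arith_mean2_weighted (w₁ := t/ρ) (w₂ := t/σ) (p₁ := x ^ ρ)
    (p₂ := y ^ σ) (by positivity) (by positivity) (by positivity) (by positivity) h1
  rw [← Real.rpow_mul hx, ← Real.rpow_mul hy, mul_div_cancel₀ _ hρ.ne', mul_div_cancel₀ _ hσ.ne',
    ← Real.mul_rpow hx hy] at this
  refine this.trans ?_
  have a1 : t / ρ ≤ 1 := by have : 0 ≤ t / σ := by positivity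
                            linarith
  have a2 : t / σ ≤ 1 := by have : 0 ≤ t / ρ := by positivity
                            linarith
  have b1 : 0 ≤ x ^ ρ := by positivity
  have b2 : 0 ≤ y ^ σ := by positivity
  nlinarith

lemma sum_blocks (c : ℕ → ℝ) (n : ℕ → ℕ) (hn : Monotone n) (M : ℕ) :
    ∑ k ∈ Finset.range M, ∑ i ∈ Finset.Ico (n k) (n (k+1)), c i = ∑ i ∈ Finset.Ico (n 0) (n M), c i := by
  induction M with
  | zero => simp
  | succ M ih =>
    rw [Finset.sum_range_succ, ih, Finset.sum_Ico_consecutive _ (hn (Nat.zero_le _))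
      (hn (Nat.le_succ _))]

lemma sum_blocks_le (c : ℕ → ℝ) (hc : ∀ i, 0 ≤ c i) (n : ℕ → ℕ) (hn : Monotone n) (T M : ℕ)
    (hT : ∀ k, n k ≤ T) :
    ∑ k ∈ Finset.range M, ∑ i ∈ Finset.Ico (n k) (n (k+1)), c i ≤ ∑ i ∈ Finset.range T, c i := by
  rw [sum_blocks c n hn M]
  refine Finset.sum_le_sum_of_subset_of_nonneg ?_ fun i _ _ => hc i
  intro i hi
  have := (Finset.mem_Ico.1 hi).2.trans_le (hT M)
  exact Finset.mem_range.2 this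

lemma rpow_sum_le_sum {ι : Type*} (s : Finset ι) (c : ι → ℝ) (hc : ∀ i, 0 ≤ c i) (t : ℝ)
    (ht : 0 < t) (ht1 : t ≤ 1) : (∑ i ∈ s, c i) ^ t ≤ ∑ i ∈ s, c i ^ t := by
  classical
  induction s using Finset.induction_on with
  | empty => simp [Real.zero_rpow ht.ne']
  | insert a s ha ih =>
    rw [Finset.sum_insert ha, Finset.sum_insert ha]
    refine (Real.rpow_add_le_add_rpow (hc a) (Finset.sum_nonneg fun i _ => hc i) ht.le ht1).trans ?_
    linarith

lemma sum_rpow_le_rpow_sum (s : Finset ℕ) (c : ℕ → ℝ) (hc : ∀ i, 0 ≤ c i) (t : ℝ)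
    (ht : 1 ≤ t) : ∑ i ∈ s, c i ^ t ≤ (∑ i ∈ s, c i) ^ t := by
  set S := ∑ i ∈ s, c i with hS
  have hS0 : 0 ≤ S := Finset.sum_nonneg fun i _ => hc i
  have : ∀ i ∈ s, c i ^ t ≤ c i * S ^ (t-1) := by
    intro i hi
    have hle : c i ≤ S := Finset.single_le_sum (f := c) (fun i _ => hc i) hi
    have e : c i ^ t = c i * c i ^ (t-1) := by
      rcases (hc i).eq_or_lt with h | h
      · rw [← h, Real.zero_rpow (by linarith), zero_mul]
      · rw [Real.rpow_sub h, Real.rpow_one]; field_simp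
    rw [e]
    have := hc i
    gcongr
  refine (Finset.sum_le_sum this).trans ?_
  rw [← Finset.sum_mul, ← hS]
  rcases hS0.eq_or_lt with h | h
  · rw [← h, zero_mul]; positivity
  · rw [Real.rpow_sub h, Real.rpow_one]; apply le_of_eq; field_simp

/-- block sums of products -/
lemma block_prod (ρ σ t : ℝ) (hρ : 0 < ρ) (hσ : 0 < σ) (ht : 0 < t) (h : 1 / t = 1 / ρ + 1 / σ)
    (T M : ℕ) (a b : ℕ → ℝ) (ha : ∀ i, 0 ≤ a i) (hb : ∀ i, 0 ≤ b i) (A1 A2 : ℝ)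
    (h1 : ∑ i ∈ Finset.range T, a i ^ ρ ≤ A1) (h2 : ∑ i ∈ Finset.range T, a i ^ 2 ≤ A1)
    (h3 : ∑ i ∈ Finset.range T, b i ^ σ ≤ A2) (h4 : ∑ i ∈ Finset.range T, b i ^ 2 ≤ A2)
    (n : ℕ → ℕ) (hn : Monotone n) (hT : ∀ k, n k ≤ T) :
    ∑ k ∈ Finset.range M, (∑ i ∈ Finset.Ico (n k) (n (k+1)), a i * b i) ^ t ≤
      (A1 + A2) + (A1 + A2) ^ t := by
  have hab : ∀ i, 0 ≤ a i * b i := fun i => mul_nonneg (ha i) (hb i)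
  have hA1 : 0 ≤ A1 := le_trans (Finset.sum_nonneg fun i _ => sq_nonneg _) h2
  have hA2 : 0 ≤ A2 := le_trans (Finset.sum_nonneg fun i _ => sq_nonneg _) h4
  have hAt : 0 ≤ (A1 + A2) ^ t := by positivity
  rcases le_total t 1 with ht1 | ht1
  · calc _ ≤ ∑ k ∈ Finset.range M, ∑ i ∈ Finset.Ico (n k) (n (k+1)), (a i * b i) ^ t :=
          Finset.sum_le_sum fun k _ => rpow_sum_le_sum _ _ hab t ht ht1
      _ ≤ ∑ i ∈ Finset.range T, (a i * b i) ^ t :=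
          sum_blocks_le _ (fun i => Real.rpow_nonneg (hab i) _) n hn T M hT
      _ ≤ ∑ i ∈ Finset.range T, (a i ^ ρ + b i ^ σ) :=
          Finset.sum_le_sum fun i _ => young_t ρ σ t _ _ hρ hσ ht h (ha i) (hb i)
      _ ≤ A1 + A2 := by rw [Finset.sum_add_distrib]; linarith
      _ ≤ _ := by linarith
  · have k1 : ∑ k ∈ Finset.range M, ∑ i ∈ Finset.Ico (n k) (n (k+1)), a i * b i ≤ A1 + A2 := by
      refine (sum_blocks_le _ hab n hn T M hT).trans ?_
      have : ∑ i ∈ Finset.range T, a i * b i ≤ ∑ i ∈ Finset.range T, (a i ^ 2 + b i ^ 2) :=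
        Finset.sum_le_sum fun i _ => by nlinarith [sq_nonneg (a i - b i), sq_nonneg (a i), sq_nonneg (b i)]
      rw [Finset.sum_add_distrib] at this
      linarith
    have k0 : ∀ k, 0 ≤ ∑ i ∈ Finset.Ico (n k) (n (k+1)), a i * b i :=
      fun k => Finset.sum_nonneg fun i _ => hab i
    calc _ ≤ (∑ k ∈ Finset.range M, ∑ i ∈ Finset.Ico (n k) (n (k+1)), a i * b i) ^ t :=
          sum_rpow_le_rpow_sum _ _ k0 t ht1
      _ ≤ (A1 + A2) ^ t := Real.rpow_le_rpow (Finset.sum_nonneg fun k _ => k0 k) k1 ht.le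
      _ ≤ _ := by linarith

def VarD (ρ A : ℝ) (T : ℕ) (F : ℕ → ℂ) : Prop :=
  ∀ a b : ℕ → ℕ, (∀ k, a k ≤ b k) → (∀ k, b k ≤ a (k+1)) → (∀ k, b k ≤ T) → ∀ M,
    ∑ k ∈ Finset.range M, ‖DD F (a k) (b k)‖ ^ ρ ≤ A

lemma VarD_of_mono (ρ A : ℝ) (T : ℕ) (F : ℕ → ℂ)
    (h : ∀ n : ℕ → ℕ, Monotone n → (∀ k, n k ≤ T) → ∀ M,
      ∑ k ∈ Finset.range M, ‖DD F (n k) (n (k+1))‖ ^ ρ ≤ A) : VarD ρ A T F := by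
  intro a b h1 h2 h3 M
  set n : ℕ → ℕ := fun j => if j % 2 = 0 then a (j/2) else b (j/2) with hn
  have e0 : ∀ k, n (2*k) = a k := fun k => by simp [hn]
  have e1 : ∀ k, n (2*k+1) = b k := fun k => by
    simp only [hn]; rw [if_neg (by omega)]; congr 1; omega
  have hm : Monotone n := by
    refine monotone_nat_of_le_succ fun j => ?_
    rcases Nat.even_or_odd' j with ⟨k, rfl | rfl⟩
    · rw [e0, e1]; exact h1 k
    · rw [e1, show 2*k+1+1 = 2*(k+1) by ring, e0]; exact h2 k
  have hT : ∀ j, n j ≤ T := fun j => by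
    rcases Nat.even_or_odd' j with ⟨k, rfl | rfl⟩
    · rw [e0]; exact (h1 k).trans (h3 k)
    · rw [e1]; exact h3 k
  refine le_trans ?_ (h n hm hT (2*M))
  have : ∀ M, ∑ k ∈ Finset.range M, ‖DD F (a k) (b k)‖ ^ ρ ≤
      ∑ k ∈ Finset.range (2*M), ‖DD F (n k) (n (k+1))‖ ^ ρ := by
    intro M
    induction M with
    | zero => simp
    | succ M ih =>
      rw [Finset.sum_range_succ, show 2*(M+1) = 2*M+1+1 by ring, Finset.sum_range_succ,
        Finset.sum_range_succ, e0, e1]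
      have : 0 ≤ ‖DD F (b M) (n (2*M+1+1))‖ ^ ρ := by positivity
      linarith
  exact this M

/-- sums over interval endpoints -/
lemma endpoints (c : ℕ → ℝ) (hc : ∀ i, 0 ≤ c i) (T M : ℕ) (a b : ℕ → ℕ) (h1 : ∀ k, a k ≤ b k)
    (h2 : ∀ k, b k ≤ a (k+1)) (h3 : ∀ k, b k ≤ T) :
    (∑ k ∈ Finset.range M, if a k < b k then c (a k) else 0) ≤ ∑ i ∈ Finset.range (T+1), c i ∧
    (∑ k ∈ Finset.range M, if a k < b k then c (b k) else 0) ≤ ∑ i ∈ Finset.range (T+1), c i := by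
  have ham : Monotone a := monotone_nat_of_le_succ fun k => (h1 k).trans (h2 k)
  have hlt : ∀ k k', k < k' → b k ≤ a k' := fun k k' h => (h2 k).trans (ham h)
  rw [← Finset.sum_filter, ← Finset.sum_filter]
  constructor
  · rw [← Finset.sum_image (f := c) (g := a)]
    · refine Finset.sum_le_sum_of_subset_of_nonneg ?_ fun i _ _ => hc i
      intro i hi
      obtain ⟨k, _, rfl⟩ := Finset.mem_image.1 hi
      have := (h1 k).trans (h3 k)
      exact Finset.mem_range.2 (by omega)
    · intro k hk k' hk' he
      simp only [Finset.coe_filter, Set.mem_ofPred_eq] at hk hk'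
      rcases lt_trichotomy k k' with h | h | h
      · have := hlt _ _ h; omega
      · exact h
      · have := hlt _ _ h; omega
  · rw [← Finset.sum_image (f := c) (g := b)]
    · refine Finset.sum_le_sum_of_subset_of_nonneg ?_ fun i _ _ => hc i
      intro i hi
      obtain ⟨k, _, rfl⟩ := Finset.mem_image.1 hi
      have := (h3 k)
      exact Finset.mem_range.2 (by omega)
    · intro k hk k' hk' he
      simp only [Finset.coe_filter, Set.mem_ofPred_eq] at hk hk'
      rcases lt_trichotomy k k' with h | h | h
      · have := hlt _ _ h; omega
      · exact h
      · have := hlt _ _ h; omega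

lemma DD_delta (U : ℕ → ℂ) {a b : ℕ} (h : a ≤ b) : DD (fun j => U (j+1) - U j) a b = U b - U a := by
  induction b, h using Nat.le_induction with
  | base => simp [DD_self]
  | succ b hab ih => rw [DD_succ _ hab, ih]; ring

lemma VarD_delta (ρ A : ℝ) (hρ : 0 < ρ) (T : ℕ) (U : ℕ → ℂ)
    (h : ∑ j ∈ Finset.range (T+1), ‖U j‖ ^ ρ ≤ A) :
    VarD ρ (2 ^ ρ * (A + A)) T (fun j => U (j+1) - U j) := by
  intro a b h1 h2 h3 M
  obtain ⟨k1, k2⟩ := endpoints (fun j => ‖U j‖ ^ ρ) (fun j => by positivity) T M a b h1 h2 h3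
  have : ∀ k ∈ Finset.range M, ‖DD (fun j => U (j+1) - U j) (a k) (b k)‖ ^ ρ ≤
      2 ^ ρ * ((if a k < b k then ‖U (a k)‖ ^ ρ else 0) + (if a k < b k then ‖U (b k)‖ ^ ρ else 0)) := by
    intro k _
    rw [DD_delta U (h1 k)]
    split_ifs with hh
    · refine le_trans ?_ (add_rpow_le2 _ _ ρ (norm_nonneg _) (norm_nonneg _) hρ.le)
      gcongr
      rw [add_comm]
      exact norm_sub_le _ _
    · have : a k = b k := le_antisymm (h1 k) (not_lt.1 hh)
      rw [this, sub_self, norm_zero, Real.zero_rpow hρ.ne']; simp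
  refine (Finset.sum_le_sum this).trans ?_
  rw [← Finset.mul_sum, Finset.sum_add_distrib]
  gcongr <;> linarith

lemma sum_blocks_ab (c : ℕ → ℝ) (hc : ∀ i, 0 ≤ c i) (T M : ℕ) (a b : ℕ → ℕ) (h1 : ∀ k, a k ≤ b k)
    (h2 : ∀ k, b k ≤ a (k+1)) (h3 : ∀ k, b k ≤ T) :
    ∑ k ∈ Finset.range M, ∑ i ∈ Finset.Ico (a k) (b k), c i ≤ ∑ i ∈ Finset.range T, c i := by
  refine le_trans ?_ (sum_blocks_le c hc a (monotone_nat_of_le_succ fun k => (h1 k).trans (h2 k)) T M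
    (fun k => (h1 k).trans (h3 k)))
  refine Finset.sum_le_sum fun k _ => Finset.sum_le_sum_of_subset_of_nonneg ?_ fun i _ _ => hc i
  exact Finset.Ico_subset_Ico le_rfl (h2 k)

lemma VarD_l1 (ρ : ℝ) (hρ : 1 ≤ ρ) (T : ℕ) (R : ℕ → ℂ)
    (h : ∑ j ∈ Finset.range T, ‖R j‖ ≤ 1) : VarD ρ 1 T R := by
  intro a b h1 h2 h3 M
  have k := (sum_blocks_ab (fun j => ‖R j‖) (fun j => norm_nonneg _) T M a b h1 h2 h3).trans h
  calc _ ≤ ∑ k ∈ Finset.range M, (∑ i ∈ Finset.Ico (a k) (b k), ‖R i‖) ^ ρ := by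
        gcongr with k _
        exact norm_sum_le _ _
    _ ≤ (∑ k ∈ Finset.range M, ∑ i ∈ Finset.Ico (a k) (b k), ‖R i‖) ^ ρ :=
        sum_rpow_le_rpow_sum _ (fun k => ∑ i ∈ Finset.Ico (a k) (b k), ‖R i‖)
          (fun k => Finset.sum_nonneg fun i _ => norm_nonneg _) ρ hρ
    _ ≤ 1 := Real.rpow_le_one (Finset.sum_nonneg fun k _ => Finset.sum_nonneg fun i _ => norm_nonneg _)
          k (by linarith)

lemma DD_add (F G : ℕ → ℂ) (a b : ℕ) : DD (fun j => F j + G j) a b = DD F a b + DD G a b := by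
  simp [DD, Finset.sum_add_distrib]

lemma VarD_add (ρ A B : ℝ) (hρ : 0 < ρ) (T : ℕ) (F G : ℕ → ℂ) (hF : VarD ρ A T F) (hG : VarD ρ B T G) :
    VarD ρ (2 ^ ρ * (A + B)) T (fun j => F j + G j) := by
  intro a b h1 h2 h3 M
  have k1 := hF a b h1 h2 h3 M
  have k2 := hG a b h1 h2 h3 M
  calc _ ≤ ∑ k ∈ Finset.range M, 2 ^ ρ * (‖DD F (a k) (b k)‖ ^ ρ + ‖DD G (a k) (b k)‖ ^ ρ) := by
        refine Finset.sum_le_sum fun k _ => ?_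
        rw [DD_add]
        refine le_trans ?_ (add_rpow_le2 _ _ ρ (norm_nonneg _) (norm_nonneg _) hρ.le)
        gcongr
        exact norm_add_le _ _
    _ ≤ _ := by
        rw [← Finset.mul_sum, Finset.sum_add_distrib]
        gcongr

lemma BB_decomp (d e U W R R' F G : ℕ → ℂ) (a b : ℕ) (hab : a ≤ b)
    (hF : ∀ j, j < b → F j = d j + (U (j+1) - U j) + R j)
    (hG : ∀ j, j < b → G j = e j + (W (j+1) - W j) + R' j) :
    BB F G a b = BB d e a b + (∑ j ∈ Finset.Ico a b, U j * e j) - U a * DD e a b + BB R e a b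
      + DD F a b * W b - (∑ i ∈ Finset.Ico a b, F i * W (i+1)) + BB F R' a b ∧
    DD F a b = DD d a b + (U b - U a) + DD R a b := by
  induction b, hab using Nat.le_induction with
  | base => simp [DD_self, BB_self]
  | succ b hab ih =>
    obtain ⟨i1, i2⟩ := ih (fun j hj => hF j (by omega)) (fun j hj => hG j (by omega))
    have hFb := hF b (by omega)
    constructor
    · rw [BB_succ _ _ hab, BB_succ _ _ hab, BB_succ _ _ hab, BB_succ _ _ hab, DD_succ _ hab,
        DD_succ _ hab, Finset.sum_Ico_succ_top hab, Finset.sum_Ico_succ_top hab, i1,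
        hG b (by omega)]
      linear_combination (e b) * i2
    · rw [DD_succ _ hab, DD_succ _ hab, DD_succ _ hab, i2, hFb]; ring

lemma BB_left (R e : ℕ → ℂ) (a b : ℕ) (hab : a ≤ b) :
    BB R e a b = ∑ i ∈ Finset.Ico a b, R i * DD e (i+1) b := by
  induction b, hab using Nat.le_induction with
  | base => simp [BB_self]
  | succ b hab ih =>
    rw [BB_succ _ _ hab, ih, Finset.sum_Ico_succ_top hab, DD_self, mul_zero, add_zero]
    have : ∀ i ∈ Finset.Ico a b, R i * DD e (i+1) (b+1) = R i * DD e (i+1) b + R i * e b := by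
      intro i hi
      rw [DD_succ _ (Finset.mem_Ico.1 hi).2]; ring
    rw [Finset.sum_congr rfl this, Finset.sum_add_distrib, ← Finset.sum_mul, DD]

lemma BB_right (F R : ℕ → ℂ) (a b : ℕ) :
    BB F R a b = ∑ j ∈ Finset.Ico a b, DD F a j * R j := by
  simp [BB, DD, Finset.sum_mul]

lemma claim_right (ρ σ t : ℝ) (hρ : 0 < ρ) (hσ : 1 ≤ σ) (ht : 0 < t) (h : 1 / t = 1 / ρ + 1 / σ)
    (T M : ℕ) (A : ℝ) (F R : ℕ → ℂ) (hF : VarD ρ A T F) (hR : ∑ j ∈ Finset.range T, ‖R j‖ ≤ 1)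
    (n : ℕ → ℕ) (hn : Monotone n) (hT : ∀ k, n k ≤ T) :
    ∑ k ∈ Finset.range M, ‖BB F R (n k) (n (k+1))‖ ^ t ≤ A + 1 := by
  have hn' : ∀ k, n k ≤ n (k+1) := fun k => hn (Nat.le_succ k)
  have : ∀ k, ∃ j, n k ≤ j ∧ j ≤ n (k+1) ∧ ∀ i, n k ≤ i → i ≤ n (k+1) →
      ‖DD F (n k) i‖ ≤ ‖DD F (n k) j‖ := by
    intro k
    obtain ⟨j, hj, hmax⟩ := Finset.exists_max_image (Finset.Icc (n k) (n (k+1)))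
      (fun i => ‖DD F (n k) i‖) ⟨n k, by simp [hn' k]⟩
    rw [Finset.mem_Icc] at hj
    exact ⟨j, hj.1, hj.2, fun i h1 h2 => hmax i (Finset.mem_Icc.2 ⟨h1, h2⟩)⟩
  choose j hj1 hj2 hj3 using this
  have v1 := hF n j hj1 hj2 (fun k => (hj2 k).trans (hT _)) M
  have v2 := VarD_l1 σ hσ T (fun j => (‖R j‖ : ℂ)) (by simpa using hR) n (fun k => n (k+1)) hn'
    (fun k => le_rfl) (fun k => hT _) M
  calc _ ≤ ∑ k ∈ Finset.range M, (‖DD F (n k) (j k)‖ ^ ρ +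
        ‖DD (fun j => (‖R j‖ : ℂ)) (n k) (n (k+1))‖ ^ σ) := by
        refine Finset.sum_le_sum fun k _ => ?_
        refine le_trans ?_ (young_t ρ σ t _ _ hρ (by linarith) ht h (norm_nonneg _) (norm_nonneg _))
        gcongr
        have : DD (fun j => (‖R j‖ : ℂ)) (n k) (n (k+1)) =
            ((∑ i ∈ Finset.Ico (n k) (n (k+1)), ‖R i‖ : ℝ) : ℂ) := by simp [DD]
        rw [this, Complex.norm_real, Real.norm_of_nonneg (Finset.sum_nonneg fun i _ => norm_nonneg _),
          BB_right, Finset.mul_sum]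
        refine (norm_sum_le _ _).trans (Finset.sum_le_sum fun i hi => ?_)
        rw [norm_mul]
        gcongr
        rw [Finset.mem_Ico] at hi
        exact hj3 k i hi.1 hi.2.le
    _ ≤ A + 1 := by rw [Finset.sum_add_distrib]; linarith

lemma claim_left (ρ σ t : ℝ) (hρ : 1 ≤ ρ) (hσ : 0 < σ) (ht : 0 < t) (h : 1 / t = 1 / ρ + 1 / σ)
    (T M : ℕ) (A : ℝ) (e R : ℕ → ℂ) (hF : VarD σ A T e) (hR : ∑ j ∈ Finset.range T, ‖R j‖ ≤ 1)
    (n : ℕ → ℕ) (hn : Monotone n) (hT : ∀ k, n k ≤ T) :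
    ∑ k ∈ Finset.range M, ‖BB R e (n k) (n (k+1))‖ ^ t ≤ 1 + A := by
  have hn' : ∀ k, n k ≤ n (k+1) := fun k => hn (Nat.le_succ k)
  have : ∀ k, ∃ j, n k ≤ j ∧ j ≤ n (k+1) ∧ ∀ i, n k ≤ i → i ≤ n (k+1) →
      ‖DD e i (n (k+1))‖ ≤ ‖DD e j (n (k+1))‖ := by
    intro k
    obtain ⟨j, hj, hmax⟩ := Finset.exists_max_image (Finset.Icc (n k) (n (k+1)))
      (fun i => ‖DD e i (n (k+1))‖) ⟨n k, by simp [hn' k]⟩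
    rw [Finset.mem_Icc] at hj
    exact ⟨j, hj.1, hj.2, fun i h1 h2 => hmax i (Finset.mem_Icc.2 ⟨h1, h2⟩)⟩
  choose j hj1 hj2 hj3 using this
  have v1 := hF j (fun k => n (k+1)) hj2 (fun k => hj1 (k+1)) (fun k => hT _) M
  have v2 := VarD_l1 ρ hρ T (fun j => (‖R j‖ : ℂ)) (by simpa using hR) n (fun k => n (k+1)) hn'
    (fun k => le_rfl) (fun k => hT _) M
  calc _ ≤ ∑ k ∈ Finset.range M, (‖DD (fun j => (‖R j‖ : ℂ)) (n k) (n (k+1))‖ ^ ρ +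
        ‖DD e (j k) (n (k+1))‖ ^ σ) := by
        refine Finset.sum_le_sum fun k _ => ?_
        refine le_trans ?_ (young_t ρ σ t _ _ (by linarith) hσ ht h (norm_nonneg _) (norm_nonneg _))
        gcongr
        have : DD (fun j => (‖R j‖ : ℂ)) (n k) (n (k+1)) =
            ((∑ i ∈ Finset.Ico (n k) (n (k+1)), ‖R i‖ : ℝ) : ℂ) := by simp [DD]
        rw [this, Complex.norm_real, Real.norm_of_nonneg (Finset.sum_nonneg fun i _ => norm_nonneg _),
          BB_left _ _ _ _ (hn' k), Finset.sum_mul]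
        refine (norm_sum_le _ _).trans (Finset.sum_le_sum fun i hi => ?_)
        rw [norm_mul]
        gcongr
        rw [Finset.mem_Ico] at hi
        exact hj3 k (i+1) (by omega) hi.2
    _ ≤ 1 + A := by rw [Finset.sum_add_distrib]; linarith

lemma sum_up (s : Finset ℕ) (x : ℕ → ℝ) (hx : ∀ i, 0 ≤ x i) (r κ : ℝ) (hr : 0 < r) (h : r ≤ κ)
    (h1 : ∑ i ∈ s, x i ^ r ≤ 1) : ∑ i ∈ s, x i ^ κ ≤ 1 := by
  refine le_trans (Finset.sum_le_sum fun i hi => ?_) h1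
  have : x i ^ r ≤ 1 := (Finset.single_le_sum (f := fun i => x i ^ r)
    (fun i _ => Real.rpow_nonneg (hx i) _) hi).trans h1
  have h2 : x i ≤ 1 := by
    by_contra hc
    push Not at hc
    exact absurd (Real.one_lt_rpow hc hr) (not_lt.2 this)
  exact Real.rpow_le_rpow_of_exponent_ge' (hx i) h2 hr.le h

lemma sum_shift_le (T : ℕ) (c : ℕ → ℝ) (hc : ∀ i, 0 ≤ c i) :
    ∑ j ∈ Finset.range T, c (j+1) ≤ ∑ j ∈ Finset.range (T+1), c j := by
  rw [Finset.sum_range_succ']; have := hc 0; linarith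

lemma sumF (κ : ℝ) (hκ : 0 < κ) (T : ℕ) (d U R : ℕ → ℂ)
    (h1 : ∑ j ∈ Finset.range T, ‖d j‖ ^ κ ≤ 1) (h2 : ∑ j ∈ Finset.range (T+1), ‖U j‖ ^ κ ≤ 1)
    (h3 : ∑ j ∈ Finset.range T, ‖R j‖ ^ κ ≤ 1) :
    ∑ j ∈ Finset.range T, ‖d j + (U (j+1) - U j) + R j‖ ^ κ ≤ 4 ^ κ * 4 := by
  have h4 := (sum_shift_le T (fun j => ‖U j‖ ^ κ) (fun j => by positivity)).trans h2
  have h5 : ∑ j ∈ Finset.range T, ‖U j‖ ^ κ ≤ 1 := by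
    refine le_trans ?_ h2
    rw [Finset.sum_range_succ]
    have : 0 ≤ ‖U T‖ ^ κ := by positivity
    linarith
  calc _ ≤ ∑ j ∈ Finset.range T, (4:ℝ) ^ κ * (‖d j‖ ^ κ + ‖U (j+1)‖ ^ κ + ‖U j‖ ^ κ + ‖R j‖ ^ κ) := by
        refine Finset.sum_le_sum fun j _ => ?_
        have := sum_rpow_le_card ![‖d j‖, ‖U (j+1)‖, ‖U j‖, ‖R j‖]
          (by intro i; fin_cases i <;> simp) κ hκ
        simp only [Fin.sum_univ_four, Matrix.cons_val] at this
        push_cast at this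
        refine le_trans ?_ this
        gcongr
        have a1 := norm_add_le (d j + (U (j+1) - U j)) (R j)
        have a2 := norm_add_le (d j) (U (j+1) - U j)
        have a3 := norm_sub_le (U (j+1)) (U j)
        linarith
    _ ≤ _ := by
        rw [← Finset.mul_sum]
        simp only [Finset.sum_add_distrib]
        gcongr
        linarith

lemma assembleE (r s ρ σ t A : ℝ) (hr : 1 ≤ r) (hr2 : r ≤ 2) (hs : 1 ≤ s) (hs2 : s ≤ 2)
    (hρ : r ≤ ρ) (hσ : s ≤ σ) (ht : 0 < t) (h : 1 / t = 1 / ρ + 1 / σ) :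
    ∃ C : ℝ, 0 ≤ C ∧ ∀ (T : ℕ) (F G d e U W R R' : ℕ → ℂ),
      (∀ j, j < T → F j = d j + (U (j+1) - U j) + R j) →
      (∀ j, j < T → G j = e j + (W (j+1) - W j) + R' j) →
      ∑ j ∈ Finset.range T, ‖d j‖ ^ r ≤ 1 → ∑ j ∈ Finset.range T, ‖e j‖ ^ s ≤ 1 →
      ∑ j ∈ Finset.range (T+1), ‖U j‖ ^ r ≤ 1 → ∑ j ∈ Finset.range (T+1), ‖W j‖ ^ s ≤ 1 →
      ∑ j ∈ Finset.range T, ‖R j‖ ≤ 1 → ∑ j ∈ Finset.range T, ‖R' j‖ ≤ 1 →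
      VarB A t ρ σ T d e → ∀ (n : ℕ → ℕ), Monotone n → (∀ k, n k ≤ T) → ∀ M : ℕ,
      ∑ k ∈ Finset.range M, ‖BB F G (n k) (n (k+1))‖ ^ t ≤ C := by
  have hρ0 : 0 < ρ := by linarith
  have hσ0 : 0 < σ := by linarith
  set AF : ℝ := 2 ^ ρ * (2 ^ ρ * (A + 2 ^ ρ * (1 + 1)) + 1) with hAF
  set A4 : ℝ := 4 ^ ρ * 4 + 4 ^ (2:ℝ) * 4 with hA4
  have hA4' : 0 ≤ A4 := by positivity
  refine ⟨max (7 ^ t * (A + ((1 + 1) + (1 + 1) ^ t) + (1 + A) + (1 + A) + (AF + 1) +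
    ((A4 + 1) + (A4 + 1) ^ t) + (AF + 1))) 0, le_max_right _ _, ?_⟩
  intro T F G d e U W R R' hF hG hd he hU hW hR hR' hV n hn hT M
  refine le_trans ?_ (le_max_left _ _)
  have hn' : ∀ k, n k ≤ n (k+1) := fun k => hn (Nat.le_succ k)
  -- norms at exponents
  have up := fun (s : Finset ℕ) (x : ℕ → ℂ) => sum_up s (fun i => ‖x i‖) (fun i => norm_nonneg _)
  have hR1 : ∑ j ∈ Finset.range T, ‖R j‖ ^ (1:ℝ) ≤ 1 := by simpa using hR
  have dρ := up _ d r ρ (by linarith) hρ hd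
  have d2 := up _ d r 2 (by linarith) hr2 hd
  have Uρ := up _ U r ρ (by linarith) hρ hU
  have U2 := up _ U r 2 (by linarith) hr2 hU
  have Rρ := up _ R 1 ρ (by linarith) (by linarith) hR1
  have R2 := up _ R 1 2 (by linarith) (by linarith) hR1
  have eσ := up _ e s σ (by linarith) hσ he
  have e2 := up _ e s 2 (by linarith) hs2 he
  have Wσ := up _ W s σ (by linarith) hσ hW
  have W2 := up _ W s 2 (by linarith) hs2 hW
  have cut : ∀ (x : ℕ → ℂ) (κ : ℝ), ∑ j ∈ Finset.range (T+1), ‖x j‖ ^ κ ≤ 1 →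
      ∑ j ∈ Finset.range T, ‖x j‖ ^ κ ≤ 1 := by
    intro x κ hx
    rw [Finset.sum_range_succ] at hx
    have : 0 ≤ ‖x T‖ ^ κ := by positivity
    linarith
  have sh : ∀ (x : ℕ → ℂ) (κ : ℝ), ∑ j ∈ Finset.range (T+1), ‖x j‖ ^ κ ≤ 1 →
      ∑ j ∈ Finset.range T, ‖x (j+1)‖ ^ κ ≤ 1 := fun x κ hx =>
    (sum_shift_le T (fun j => ‖x j‖ ^ κ) (fun j => by positivity)).trans hx
  -- sums of F
  have congF : ∀ κ : ℝ, ∑ j ∈ Finset.range T, ‖F j‖ ^ κ =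
      ∑ j ∈ Finset.range T, ‖d j + (U (j+1) - U j) + R j‖ ^ κ := fun κ =>
    Finset.sum_congr rfl fun j hj => by rw [hF j (Finset.mem_range.1 hj)]
  have Fρ : ∑ j ∈ Finset.range T, ‖F j‖ ^ ρ ≤ A4 := by
    rw [congF]; refine (sumF ρ hρ0 T d U R dρ Uρ Rρ).trans ?_
    rw [hA4]; have : (0:ℝ) ≤ 4 ^ (2:ℝ) * 4 := by positivity
    linarith
  have F2 : ∑ j ∈ Finset.range T, ‖F j‖ ^ (2:ℝ) ≤ A4 := by
    rw [congF]; refine (sumF 2 (by norm_num) T d U R d2 U2 R2).trans ?_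
    rw [hA4]; have : (0:ℝ) ≤ 4 ^ ρ * 4 := by positivity
    linarith
  -- variations
  have Vd : VarD ρ A T d := VarD_of_mono ρ A T d fun n hn hT M => (hV n hn hT M).2.1
  have Ve : VarD σ A T e := VarD_of_mono σ A T e fun n hn hT M => (hV n hn hT M).2.2
  have VF : VarD ρ AF T F := by
    have := VarD_add ρ _ _ hρ0 T _ _ (VarD_add ρ _ _ hρ0 T _ _ Vd (VarD_delta ρ 1 hρ0 T U Uρ))
      (VarD_l1 ρ (by linarith) T R hR)
    intro a b h1 h2 h3 M
    refine le_trans (le_of_eq ?_) (this a b h1 h2 h3 M)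
    refine Finset.sum_congr rfl fun k _ => ?_
    congr 2
    exact Finset.sum_congr rfl fun j hj => hF j ((Finset.mem_Ico.1 hj).2.trans_le (h3 k))
  -- the seven terms
  have t1 := (hV n hn hT M).1
  have t2 := block_prod ρ σ t hρ0 hσ0 ht h T M (fun j => ‖U j‖) (fun j => ‖e j‖)
    (fun _ => norm_nonneg _) (fun _ => norm_nonneg _) 1 1 (cut U ρ Uρ)
    (by simpa using cut U 2 U2) eσ (by simpa using e2) n hn hT
  have t6 := block_prod ρ σ t hρ0 hσ0 ht h T M (fun j => ‖F j‖) (fun j => ‖W (j+1)‖)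
    (fun _ => norm_nonneg _) (fun _ => norm_nonneg _) A4 1 Fρ
    (by simpa using F2) (sh W σ Wσ) (by simpa using sh W 2 W2) n hn hT
  have t4 := claim_left ρ σ t (by linarith) hσ0 ht h T M A e R Ve hR n hn hT
  have t7 := claim_right ρ σ t hρ0 (by linarith) ht h T M AF F R' VF hR' n hn hT
  have ep1 := (endpoints (fun j => ‖U j‖ ^ ρ) (fun j => by positivity) T M n (fun k => n (k+1)) hn'
    (fun k => le_rfl) (fun k => hT _)).1.trans Uρ
  have ep2 := (endpoints (fun j => ‖W j‖ ^ σ) (fun j => by positivity) T M n (fun k => n (k+1)) hn'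
    (fun k => le_rfl) (fun k => hT _)).2.trans Wσ
  have t3 : ∑ k ∈ Finset.range M, (‖U (n k)‖ * ‖DD e (n k) (n (k+1))‖) ^ t ≤ 1 + A := by
    calc _ ≤ ∑ k ∈ Finset.range M, ((if n k < n (k+1) then ‖U (n k)‖ ^ ρ else 0) +
          ‖DD e (n k) (n (k+1))‖ ^ σ) := by
          refine Finset.sum_le_sum fun k _ => ?_
          split_ifs with hh
          · exact young_t ρ σ t _ _ hρ0 hσ0 ht h (norm_nonneg _) (norm_nonneg _)
          · rw [← le_antisymm (hn' k) (not_lt.1 hh), DD_self, norm_zero, mul_zero,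
              Real.zero_rpow ht.ne', Real.zero_rpow hσ0.ne']; simp
      _ ≤ _ := by rw [Finset.sum_add_distrib]; exact add_le_add ep1 (hV n hn hT M).2.2
  have t5 : ∑ k ∈ Finset.range M, (‖DD F (n k) (n (k+1))‖ * ‖W (n (k+1))‖) ^ t ≤ AF + 1 := by
    calc _ ≤ ∑ k ∈ Finset.range M, (‖DD F (n k) (n (k+1))‖ ^ ρ +
          (if n k < n (k+1) then ‖W (n (k+1))‖ ^ σ else 0)) := by
          refine Finset.sum_le_sum fun k _ => ?_
          split_ifs with hh
          · exact young_t ρ σ t _ _ hρ0 hσ0 ht h (norm_nonneg _) (norm_nonneg _)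
          · rw [← le_antisymm (hn' k) (not_lt.1 hh), DD_self, norm_zero, zero_mul,
              Real.zero_rpow ht.ne', Real.zero_rpow hρ0.ne']; simp
      _ ≤ _ := by
        rw [Finset.sum_add_distrib]
        exact add_le_add (VF n (fun k => n (k+1)) hn' (fun k => le_rfl) (fun k => hT _) M) ep2
  calc _ ≤ ∑ k ∈ Finset.range M, (7:ℝ) ^ t * (‖BB d e (n k) (n (k+1))‖ ^ t +
        (∑ j ∈ Finset.Ico (n k) (n (k+1)), ‖U j‖ * ‖e j‖) ^ t +
        (‖U (n k)‖ * ‖DD e (n k) (n (k+1))‖) ^ t + ‖BB R e (n k) (n (k+1))‖ ^ t +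
        (‖DD F (n k) (n (k+1))‖ * ‖W (n (k+1))‖) ^ t +
        (∑ j ∈ Finset.Ico (n k) (n (k+1)), ‖F j‖ * ‖W (j+1)‖) ^ t +
        ‖BB F R' (n k) (n (k+1))‖ ^ t) := by
        refine Finset.sum_le_sum fun k _ => ?_
        have p1 : 0 ≤ ∑ j ∈ Finset.Ico (n k) (n (k+1)), ‖U j‖ * ‖e j‖ :=
          Finset.sum_nonneg fun i _ => by positivity
        have p2 : 0 ≤ ∑ j ∈ Finset.Ico (n k) (n (k+1)), ‖F j‖ * ‖W (j+1)‖ :=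
          Finset.sum_nonneg fun i _ => by positivity
        have := sum_rpow_le_card ![‖BB d e (n k) (n (k+1))‖,
          ∑ j ∈ Finset.Ico (n k) (n (k+1)), ‖U j‖ * ‖e j‖,
          ‖U (n k)‖ * ‖DD e (n k) (n (k+1))‖, ‖BB R e (n k) (n (k+1))‖,
          ‖DD F (n k) (n (k+1))‖ * ‖W (n (k+1))‖,
          ∑ j ∈ Finset.Ico (n k) (n (k+1)), ‖F j‖ * ‖W (j+1)‖,
          ‖BB F R' (n k) (n (k+1))‖]
          (by intro i; fin_cases i <;> simp <;> positivity) t ht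
        simp only [Fin.sum_univ_seven, Matrix.cons_val] at this
        push_cast at this
        refine le_trans ?_ this
        gcongr
        rw [(BB_decomp d e U W R R' F G (n k) (n (k+1)) (hn' k)
          (fun j hj => hF j (hj.trans_le (hT _))) (fun j hj => hG j (hj.trans_le (hT _)))).1]
        have q1 : ‖∑ j ∈ Finset.Ico (n k) (n (k+1)), U j * e j‖ ≤
            ∑ j ∈ Finset.Ico (n k) (n (k+1)), ‖U j‖ * ‖e j‖ :=
          (norm_sum_le _ _).trans (by simp)
        have q2 : ‖∑ j ∈ Finset.Ico (n k) (n (k+1)), F j * W (j+1)‖ ≤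
            ∑ j ∈ Finset.Ico (n k) (n (k+1)), ‖F j‖ * ‖W (j+1)‖ :=
          (norm_sum_le _ _).trans (by simp)
        rw [← norm_mul, ← norm_mul]
        refine (norm_add_le _ _).trans (add_le_add_left ?_ _)
        refine (norm_sub_le _ _).trans (add_le_add ?_ q2)
        refine (norm_add_le _ _).trans (add_le_add_left ?_ _)
        refine (norm_add_le _ _).trans (add_le_add_left ?_ _)
        refine (norm_sub_le _ _).trans (add_le_add_left ?_ _)
        exact (norm_add_le _ _).trans (add_le_add_right q1 _)
    _ ≤ _ := by
        rw [← Finset.mul_sum]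
        simp only [Finset.sum_add_distrib]
        gcongr

def kP (n : ℤ) (x : ℝ) : ℝ := (2:ℝ) ^ n / (1 + (2:ℝ) ^ n * |x|) ^ 2

lemma kP_nonneg (n : ℤ) (x : ℝ) : 0 ≤ kP n x := by unfold kP; positivity
lemma kP_neg (n : ℤ) (x : ℝ) : kP n (-x) = kP n x := by simp [kP]
lemma kP_le (n : ℤ) (x : ℝ) : kP n x ≤ (2:ℝ) ^ n := by
  unfold kP
  apply div_le_self (by positivity)
  apply one_le_pow₀
  have : 0 ≤ (2:ℝ) ^ n * |x| := by positivity
  linarith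
lemma measurable_kP (n : ℤ) : Measurable (kP n) := by
  unfold kP; fun_prop

def ck : ℝ := ∫ x : ℝ, (1 + |x|) ^ (-2 : ℝ)

lemma integrable_P : Integrable fun x : ℝ => (1 + |x|) ^ (-2 : ℝ) := by
  have := integrable_one_add_norm (E := ℝ) (μ := volume) (r := 2) (by simp)
  simpa using this

lemma ck_nonneg : 0 ≤ ck := integral_nonneg fun x => by positivity

lemma kP_eq (n : ℤ) (x : ℝ) : kP n x = (2:ℝ) ^ n * (1 + |(2:ℝ) ^ n * x|) ^ (-2 : ℝ) := by
  rw [kP, abs_mul, abs_of_pos (by positivity : (0:ℝ) < 2 ^ n), Real.rpow_neg (by positivity),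
    div_eq_mul_inv]
  simp

lemma lintegral_kP (n : ℤ) : ∫⁻ y, ENNReal.ofReal (kP n y) = ENNReal.ofReal ck := by
  have hp : (0:ℝ) < 2 ^ n := by positivity
  have hi : Integrable (kP n) := by
    have := (integrable_P.comp_mul_left' hp.ne').const_mul ((2:ℝ) ^ n)
    refine this.congr (Filter.Eventually.of_forall fun x => (kP_eq n x).symm)
  rw [← ofReal_integral_eq_lintegral_ofReal hi (Filter.Eventually.of_forall (kP_nonneg n))]
  congr 1
  simp_rw [kP_eq]
  rw [integral_const_mul, Measure.integral_comp_mul_left (fun x : ℝ => (1 + |x|) ^ (-2 : ℝ))]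
  rw [abs_of_pos (by positivity), smul_eq_mul, ← mul_assoc, mul_inv_cancel₀ hp.ne', one_mul, ck]

def Pn (n : ℤ) (h : ℝ → ℝ≥0∞) (x : ℝ) : ℝ≥0∞ := ∫⁻ y, ENNReal.ofReal (kP n (x - y)) * h y

lemma measurable_Pn (n : ℤ) {h : ℝ → ℝ≥0∞} (hh : Measurable h) : Measurable (Pn n h) := by
  unfold Pn
  have : Measurable fun p : ℝ × ℝ => ENNReal.ofReal (kP n (p.1 - p.2)) * h p.2 :=
    (ENNReal.measurable_ofReal.comp ((measurable_kP n).comp (measurable_fst.sub measurable_snd))).mul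
      (hh.comp measurable_snd)
  exact this.lintegral_prod_right'

lemma lintegral_kP_sub (n : ℤ) (x : ℝ) :
    ∫⁻ y, ENNReal.ofReal (kP n (x - y)) = ENNReal.ofReal ck := by
  rw [← lintegral_kP n]
  exact lintegral_sub_left_eq_self (fun y => ENNReal.ofReal (kP n y)) x

lemma lintegral_kP_sub' (n : ℤ) (y : ℝ) :
    ∫⁻ x, ENNReal.ofReal (kP n (x - y)) = ENNReal.ofReal ck := by
  rw [← lintegral_kP n]
  exact lintegral_sub_right_eq_self (fun y => ENNReal.ofReal (kP n y)) y

lemma Pn_mono (n : ℤ) {h h' : ℝ → ℝ≥0∞} (H : ∀ y, h y ≤ h' y) (x : ℝ) : Pn n h x ≤ Pn n h' x :=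
  lintegral_mono fun y => by gcongr; exact H y

lemma Pn_mono_ae (n : ℤ) {h h' : ℝ → ℝ≥0∞} (H : ∀ᵐ y, h y ≤ h' y) (x : ℝ) :
    Pn n h x ≤ Pn n h' x :=
  lintegral_mono_ae (H.mono fun y hy => by gcongr)

/-- self-adjointness -/
lemma Pn_adj (n : ℤ) {g h : ℝ → ℝ≥0∞} (hg : Measurable g) (hh : Measurable h) :
    ∫⁻ x, Pn n g x * h x = ∫⁻ x, g x * Pn n h x := by
  have hk : Measurable fun p : ℝ × ℝ => ENNReal.ofReal (kP n (p.1 - p.2)) :=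
    (ENNReal.measurable_ofReal.comp ((measurable_kP n).comp (measurable_fst.sub measurable_snd)))
  have hs : ∀ x y, kP n (x - y) = kP n (y - x) := fun x y => by rw [← kP_neg, neg_sub]
  calc ∫⁻ x, Pn n g x * h x = ∫⁻ x, ∫⁻ y, ENNReal.ofReal (kP n (x - y)) * g y * h x := by
        refine lintegral_congr fun x => ?_
        rw [Pn, lintegral_mul_const]
        exact (hk.comp (measurable_const.prodMk measurable_id)).mul hg
    _ = ∫⁻ y, ∫⁻ x, ENNReal.ofReal (kP n (x - y)) * g y * h x := by
        refine lintegral_lintegral_swap ?_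
        exact ((hk.mul (hg.comp measurable_snd)).mul (hh.comp measurable_fst)).aemeasurable
    _ = _ := by
        refine lintegral_congr fun y => ?_
        rw [Pn, ← lintegral_const_mul]
        · refine lintegral_congr fun x => ?_
          rw [hs x y]; ring
        · exact (hk.comp (measurable_const.prodMk measurable_id)).mul hh

lemma lintegral_Pn (n : ℤ) {g : ℝ → ℝ≥0∞} (hg : Measurable g) :
    ∫⁻ x, Pn n g x = ENNReal.ofReal ck * ∫⁻ x, g x := by
  have := Pn_adj n hg (measurable_const (a := (1:ℝ≥0∞)))
  simp only [mul_one] at this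
  rw [this, mul_comm, ← lintegral_mul_const _ hg]
  refine lintegral_congr fun x => ?_
  simp only [Pn, mul_one]
  rw [lintegral_kP_sub]

/-- maximal operator -/
def MM (h : ℝ → ℝ≥0∞) (x : ℝ) : ℝ≥0∞ := ⨆ n : ℤ, Pn n h x

lemma measurable_MM {h : ℝ → ℝ≥0∞} (hh : Measurable h) : Measurable (MM h) :=
  Measurable.iSup fun n => measurable_Pn n hh

lemma Pn_le_MM (n : ℤ) (h : ℝ → ℝ≥0∞) (x : ℝ) : Pn n h x ≤ MM h x :=
  le_iSup (fun n => Pn n h x) n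

/-- the kernel is dominated by ball averages -/
lemma kP_le_sum (n : ℤ) (x y : ℝ) : ENNReal.ofReal (kP n (x - y)) ≤
    ∑' k : ℕ, ENNReal.ofReal (4 * (2:ℝ) ^ n * (1/4) ^ k) *
      (Metric.closedBall x ((2:ℝ) ^ (k - n : ℤ))).indicator 1 y := by
  -- choose k minimal
  have hp : (0:ℝ) < 2 ^ n := by positivity
  have hex : ∃ k : ℕ, |x - y| ≤ (2:ℝ) ^ (k - n : ℤ) := by
    obtain ⟨k, hk⟩ := pow_unbounded_of_one_lt (2 ^ n * |x - y|) (one_lt_two (α := ℝ))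
    refine ⟨k, ?_⟩
    rw [zpow_sub₀ (by norm_num), zpow_natCast, le_div_iff₀ hp]
    linarith
  classical
  set k := Nat.find hex with hk
  have hk1 : |x - y| ≤ (2:ℝ) ^ (k - n : ℤ) := Nat.find_spec hex
  refine le_trans ?_ (ENNReal.le_tsum k)
  rw [Set.indicator_of_mem (by rw [Metric.mem_closedBall, dist_comm, Real.dist_eq]; exact hk1)]
  simp only [Pi.one_apply, mul_one]
  refine ENNReal.ofReal_le_ofReal ?_
  rcases Nat.eq_zero_or_pos k with h0 | h0
  · rw [h0, pow_zero, mul_one]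
    have := kP_le n (x - y)
    linarith
  · have hlt : ¬ |x - y| ≤ (2:ℝ) ^ (((k - 1 : ℕ):ℤ) - n : ℤ) := Nat.find_min hex (by omega)
    push Not at hlt
    rw [zpow_sub₀ (by norm_num), zpow_natCast, div_lt_iff₀ hp] at hlt
    have h2 : (2:ℝ) ^ k = 2 * 2 ^ (k-1) := by rw [← pow_succ']; congr 1; omega
    have h3 : (2:ℝ) ^ k / 2 ≤ 1 + 2 ^ n * |x - y| := by rw [h2]; linarith
    have h4 : (1/4 : ℝ) ^ k = 1 / ((2:ℝ) ^ k) ^ 2 := by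
      rw [← pow_mul, mul_comm k 2, pow_mul, one_div_pow]; norm_num
    rw [kP, h4, div_le_iff₀ (by positivity)]
    have h5 : ((2:ℝ) ^ k / 2) ^ 2 ≤ (1 + 2 ^ n * |x - y|) ^ 2 := by gcongr
    have h6 : (0:ℝ) < 2 ^ k := by positivity
    calc (2:ℝ) ^ n = 4 * 2 ^ n * (1 / ((2:ℝ) ^ k) ^ 2) * ((2:ℝ) ^ k / 2) ^ 2 := by
          field_simp; norm_num
      _ ≤ _ := by gcongr

/-- If all dyadic ball integrals are small then `Pn` is small. -/
lemma Pn_le_of_balls (n : ℤ) (h : ℝ → ℝ≥0∞) (hh : Measurable h) (x : ℝ) (a : ℝ≥0∞)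
    (H : ∀ j : ℤ, ∫⁻ y in Metric.closedBall x ((2:ℝ) ^ j), h y ≤ a * ENNReal.ofReal ((2:ℝ) ^ j)) :
    Pn n h x ≤ 8 * a := by
  have hb : ∀ k : ℕ, MeasurableSet (Metric.closedBall x ((2:ℝ) ^ (k - n : ℤ))) :=
    fun k => Metric.isClosed_closedBall.measurableSet
  calc Pn n h x ≤ ∫⁻ y, ∑' k : ℕ, ENNReal.ofReal (4 * (2:ℝ) ^ n * (1/4) ^ k) *
        (Metric.closedBall x ((2:ℝ) ^ (k - n : ℤ))).indicator h y := by
        refine lintegral_mono fun y => ?_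
        refine (mul_le_mul_left (kP_le_sum n x y) _).trans (le_of_eq ?_)
        rw [← ENNReal.tsum_mul_right]
        refine tsum_congr fun k => ?_
        rw [mul_assoc]
        congr 1
        simp only [Set.indicator]
        split_ifs <;> simp
    _ = ∑' k : ℕ, ENNReal.ofReal (4 * (2:ℝ) ^ n * (1/4) ^ k) *
        ∫⁻ y in Metric.closedBall x ((2:ℝ) ^ (k - n : ℤ)), h y := by
        rw [lintegral_tsum fun k => ((hh.indicator (hb k)).const_mul _).aemeasurable]
        refine tsum_congr fun k => ?_
        rw [lintegral_const_mul _ (hh.indicator (hb k)), lintegral_indicator (hb k)]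
    _ ≤ ∑' k : ℕ, ENNReal.ofReal (4 * (2:ℝ) ^ n * (1/4) ^ k) *
        (a * ENNReal.ofReal ((2:ℝ) ^ (k - n : ℤ))) := by
        refine ENNReal.tsum_le_tsum fun k => ?_
        gcongr
        exact H _
    _ = ∑' k : ℕ, a * ENNReal.ofReal (4 * (1/2) ^ k) := by
        refine tsum_congr fun k => ?_
        rw [mul_left_comm, ← ENNReal.ofReal_mul (by positivity)]
        congr 2
        rw [zpow_sub₀ (by norm_num), zpow_natCast]
        have : (1/2:ℝ) ^ k = (1/4) ^ k * 2 ^ k := by rw [← mul_pow]; norm_num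
        rw [this]
        field_simp
    _ = 8 * a := by
        rw [ENNReal.tsum_mul_left, ← ENNReal.ofReal_tsum_of_nonneg (fun k => by positivity)
          ((summable_geometric_two).mul_left 4), tsum_mul_left, tsum_geometric_two, mul_comm]
        norm_num

/-- weak type (1,1) -/
lemma MM_weak (h : ℝ → ℝ≥0∞) (hh : Measurable h) (lam : ℝ) (hl : 0 < lam) :
    volume {x | ENNReal.ofReal lam < MM h x} ≤ ENNReal.ofReal (80 / lam) * ∫⁻ x, h x := by
  by_cases hI : ∫⁻ x, h x = ⊤
  · rw [hI, ENNReal.mul_top]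
    · exact le_top
    · simpa using hl
  set E := {x | ENNReal.ofReal lam < MM h x} with hE
  have key : ∀ x, ∃ j : ℤ, x ∈ E → ENNReal.ofReal (lam / 8) * ENNReal.ofReal ((2:ℝ) ^ j) <
      ∫⁻ y in Metric.closedBall x ((2:ℝ) ^ j), h y := by
    intro x
    by_contra hcon
    push Not at hcon
    have hxE := (hcon 0).1
    have : MM h x ≤ ENNReal.ofReal lam := by
      refine iSup_le fun n => ?_
      refine (Pn_le_of_balls n h hh x (ENNReal.ofReal (lam/8)) fun j => (hcon j).2).trans ?_
      rw [show (8:ℝ≥0∞) = ENNReal.ofReal 8 by simp, ← ENNReal.ofReal_mul (by norm_num)]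
      apply ENNReal.ofReal_le_ofReal
      linarith
    exact absurd hxE (not_lt.mpr this)
  choose j hj using key
  have hR : ∀ a ∈ E, (2:ℝ) ^ (j a) ≤ (∫⁻ x, h x).toReal / (lam / 8) := by
    intro a ha
    have h1 := (hj a ha).le.trans (setLIntegral_le_lintegral _ _)
    rw [← ENNReal.ofReal_mul (by positivity)] at h1
    have h2 := (ENNReal.ofReal_le_iff_le_toReal hI).1 h1
    rw [le_div_iff₀ (by positivity)]
    linarith
  obtain ⟨u, huE, hud, huc⟩ := Vitali.exists_disjoint_subfamily_covering_enlargement_closedBall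
    E (fun x : ℝ => x) (fun x => (2:ℝ) ^ (j x)) _ hR 5 (by norm_num)
  have hcount : u.Countable := by
    refine hud.countable_of_nonempty_interior fun a _ => ?_
    rw [interior_closedBall _ (by positivity)]
    exact Metric.nonempty_ball.2 (by positivity)
  have hcov : E ⊆ ⋃ b ∈ u, Metric.closedBall b (5 * (2:ℝ) ^ (j b)) := by
    intro a ha
    obtain ⟨b, hb, hs⟩ := huc a ha
    exact Set.mem_biUnion hb (hs (Metric.mem_closedBall_self (by positivity)))
  calc volume E ≤ volume (⋃ b ∈ u, Metric.closedBall b (5 * (2:ℝ) ^ (j b))) := measure_mono hcov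
    _ ≤ ∑' b : u, volume (Metric.closedBall (b:ℝ) (5 * (2:ℝ) ^ (j b))) :=
        measure_biUnion_le _ hcount _
    _ ≤ ∑' b : u, ENNReal.ofReal (80 / lam) * ∫⁻ y in Metric.closedBall (b:ℝ) ((2:ℝ) ^ (j b)), h y := by
        refine ENNReal.tsum_le_tsum fun b => ?_
        rw [Real.volume_closedBall]
        have h1 := (hj b (huE b.2)).le
        refine le_trans (le_of_eq ?_) (mul_le_mul_right h1 _)
        rw [← ENNReal.ofReal_mul (by positivity), ← ENNReal.ofReal_mul (by positivity)]
        congr 1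
        field_simp
        norm_num
    _ = ENNReal.ofReal (80 / lam) * ∫⁻ y in ⋃ b ∈ u, Metric.closedBall b ((2:ℝ) ^ (j b)), h y := by
        rw [ENNReal.tsum_mul_left, lintegral_biUnion hcount
          (fun _ _ => Metric.isClosed_closedBall.measurableSet) hud]
    _ ≤ _ := mul_le_mul_right (setLIntegral_le_lintegral _ _) _

open Classical in
lemma layer_up (v : ℝ) (hv : 0 < v) (a : ℝ≥0∞) :
    a ^ v ≤ ∑' l : ℤ, (if ENNReal.ofReal ((2:ℝ) ^ (l:ℝ)) < a then
      ENNReal.ofReal ((2 * (2:ℝ) ^ (l:ℝ)) ^ v) else 0) := by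
  have fin : ∀ a : ℝ≥0∞, a ≠ ⊤ → a ^ v ≤ ∑' l : ℤ, (if ENNReal.ofReal ((2:ℝ) ^ (l:ℝ)) < a then
      ENNReal.ofReal ((2 * (2:ℝ) ^ (l:ℝ)) ^ v) else 0) := by
    intro a ha
    rcases eq_or_ne a 0 with rfl | h0
    · rw [ENNReal.zero_rpow_of_pos hv]; exact zero_le
    have hpos : 0 < a.toReal := ENNReal.toReal_pos h0 ha
    obtain ⟨l, hl1, hl2⟩ := exists_mem_Ioc_zpow hpos (by norm_num : (1:ℝ) < 2)
    refine le_trans ?_ (ENNReal.le_tsum l)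
    rw [← ENNReal.ofReal_toReal ha, Real.rpow_intCast, if_pos
      ((ENNReal.ofReal_lt_ofReal_iff hpos).2 hl1), ENNReal.ofReal_rpow_of_pos hpos]
    apply ENNReal.ofReal_le_ofReal
    apply Real.rpow_le_rpow hpos.le _ hv.le
    refine hl2.trans (le_of_eq ?_)
    rw [zpow_add₀ (by norm_num)]; ring
  by_cases ha : a = ⊤
  · subst ha
    apply ENNReal.le_of_forall_nnreal_lt
    intro w _
    have h1 := fin ((w:ℝ≥0∞) ^ (1/v)) (ENNReal.rpow_ne_top_of_nonneg (by positivity) (by simp))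
    rw [← ENNReal.rpow_mul, one_div_mul_cancel hv.ne', ENNReal.rpow_one] at h1
    refine h1.trans (ENNReal.tsum_le_tsum fun l => ?_)
    rw [if_pos ENNReal.ofReal_lt_top]
    split_ifs <;> simp
  · exact fin a ha

open Classical in
lemma layer_down (c : ℝ) (hc : 0 < c) : ∃ C : ℝ, 0 < C ∧ ∀ b : ℝ≥0∞,
    ∑' l : ℤ, (if ENNReal.ofReal ((2:ℝ) ^ (l:ℝ)) < b then
      ENNReal.ofReal (((2:ℝ) ^ (l:ℝ)) ^ c) else 0) ≤ ENNReal.ofReal C * b ^ c := by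
  obtain ⟨C, hC, H⟩ := geom_sum_min 2 c (c+1) (by norm_num) hc (by linarith)
  refine ⟨C+1, by linarith, fun b => ?_⟩
  by_cases hb : b = ⊤
  · rw [hb, ENNReal.top_rpow_of_pos hc, ENNReal.mul_top]
    · exact le_top
    · simp; linarith
  rw [ENNReal.tsum_eq_iSup_sum]
  refine iSup_le fun s => ?_
  have h1 : ∀ l ∈ s, (if ENNReal.ofReal ((2:ℝ) ^ (l:ℝ)) < b then
      ENNReal.ofReal (((2:ℝ) ^ (l:ℝ)) ^ c) else 0) ≤
      ENNReal.ofReal (((2:ℝ) ^ (l:ℝ)) ^ c * (min (b.toReal / (2:ℝ) ^ (l:ℝ)) 1) ^ (c+1)) := by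
    intro l _
    split_ifs with h
    · apply ENNReal.ofReal_le_ofReal
      have : (2:ℝ) ^ (l:ℝ) ≤ b.toReal := (ENNReal.ofReal_le_iff_le_toReal hb).1 h.le
      rw [min_eq_right, Real.one_rpow, mul_one]
      rwa [one_le_div (by positivity)]
    · exact zero_le
  refine (Finset.sum_le_sum h1).trans ?_
  rw [← ENNReal.ofReal_sum_of_nonneg (fun l _ => by positivity)]
  refine (ENNReal.ofReal_le_ofReal (H s b.toReal toReal_nonneg)).trans ?_
  conv_rhs => rw [← ENNReal.ofReal_toReal hb]
  rw [ENNReal.ofReal_rpow_of_nonneg toReal_nonneg hc.le, ← ENNReal.ofReal_mul (by linarith)]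
  apply ENNReal.ofReal_le_ofReal
  have : 0 ≤ b.toReal ^ c := by positivity
  linarith

lemma MM_add_const (h : ℝ → ℝ≥0∞) (hh : Measurable h) (a : ℝ≥0∞) (x : ℝ) :
    MM (fun y => h y + a) x ≤ MM h x + ENNReal.ofReal ck * a := by
  refine iSup_le fun n => ?_
  refine le_trans (le_of_eq ?_) (add_le_add_left (Pn_le_MM n h x) _)
  unfold Pn
  have hk : Measurable fun y : ℝ => ENNReal.ofReal (kP n (x - y)) :=
    ENNReal.measurable_ofReal.comp ((measurable_kP n).comp (measurable_const.sub measurable_id))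
  simp only [mul_add]
  rw [lintegral_add_left (f := fun y => ENNReal.ofReal (kP n (x - y)) * h y) (hk.mul hh), lintegral_mul_const _ hk, lintegral_kP_sub]

lemma MM_mono {h h' : ℝ → ℝ≥0∞} (H : ∀ y, h y ≤ h' y) (x : ℝ) : MM h x ≤ MM h' x :=
  iSup_mono fun n => Pn_mono n H x

open Classical in
/-- maximal theorem -/
theorem MM_strong (v : ℝ) (hv : 1 < v) : ∃ C : ℝ≥0, ∀ h : ℝ → ℝ≥0∞, Measurable h →
    ∫⁻ x, MM h x ^ v ≤ C * ∫⁻ x, h x ^ v := by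
  obtain ⟨C1, hC1, H1⟩ := layer_down (v-1) (by linarith)
  set c : ℝ := 2 * (ck + 1) with hc
  have hck := ck_nonneg
  have hc0 : 0 < c := by positivity
  refine ⟨Real.toNNReal (160 * 2 ^ v * C1 * c ^ (v-1)), fun h hh => ?_⟩
  set a : ℤ → ℝ := fun l => (2:ℝ) ^ (l:ℝ) with ha
  have ha0 : ∀ l, 0 < a l := fun l => by simp only [ha]; positivity
  set h1 : ℤ → ℝ → ℝ≥0∞ := fun l x => if ENNReal.ofReal (a l) < ENNReal.ofReal c * h x then h x else 0
    with hh1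
  have hh1m : ∀ l, Measurable (h1 l) := fun l =>
    Measurable.ite (measurableSet_lt measurable_const (hh.const_mul _)) hh measurable_const
  have hle : ∀ l y, h y ≤ h1 l y + ENNReal.ofReal (a l / c) := by
    intro l y
    simp only [hh1]
    split_ifs with hlt
    · exact le_self_add
    · rw [zero_add]
      push Not at hlt
      rw [ENNReal.ofReal_div_of_pos hc0]
      rw [ENNReal.le_div_iff_mul_le (by simp [hc0]) (by simp), mul_comm]
      exact hlt
  have hmeas : ∀ l, volume {x | ENNReal.ofReal (a l) < MM h x} ≤
      ENNReal.ofReal (160 / a l) * ∫⁻ x, h1 l x := by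
    intro l
    have := MM_weak (h1 l) (hh1m l) (a l / 2) (by have := ha0 l; positivity)
    rw [show 80 / (a l / 2) = 160 / a l by field_simp; norm_num] at this
    refine le_trans (measure_mono ?_) this
    intro x hx
    have h2 : MM h x ≤ MM (h1 l) x + ENNReal.ofReal (a l / 2) := by
      refine (MM_mono (hle l) x).trans ((MM_add_const _ (hh1m l) _ x).trans ?_)
      gcongr
      rw [← ENNReal.ofReal_mul hck]
      apply ENNReal.ofReal_le_ofReal
      rw [hc, ← mul_div_assoc, div_le_div_iff₀ (by positivity) (by positivity)]
      have := ha0 l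
      nlinarith
    have h3 : ENNReal.ofReal (a l) < MM (h1 l) x + ENNReal.ofReal (a l / 2) := lt_of_lt_of_le hx h2
    have h4 : ENNReal.ofReal (a l) = ENNReal.ofReal (a l / 2) + ENNReal.ofReal (a l / 2) := by
      rw [← ENNReal.ofReal_add (by have := ha0 l; positivity) (by have := ha0 l; positivity)]
      congr 1; ring
    rw [h4] at h3
    exact lt_of_add_lt_add_right h3
  have hMm := measurable_MM hh
  calc ∫⁻ x, MM h x ^ v ≤ ∫⁻ x, ∑' l : ℤ, (if ENNReal.ofReal (a l) < MM h x then
      ENNReal.ofReal ((2 * a l) ^ v) else 0) := lintegral_mono fun x => layer_up v (by linarith) _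
    _ = ∑' l : ℤ, ENNReal.ofReal ((2 * a l) ^ v) * volume {x | ENNReal.ofReal (a l) < MM h x} := by
        rw [lintegral_tsum fun l => (Measurable.ite (measurableSet_lt measurable_const hMm)
          measurable_const measurable_const).aemeasurable]
        refine tsum_congr fun l => ?_
        rw [← lintegral_indicator_const (measurableSet_lt measurable_const hMm)]
        refine lintegral_congr fun x => ?_
        simp only [Set.indicator, Set.mem_ofPred_eq]
    _ ≤ ∑' l : ℤ, ENNReal.ofReal ((2 * a l) ^ v) * (ENNReal.ofReal (160 / a l) * ∫⁻ x, h1 l x) := by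
        refine ENNReal.tsum_le_tsum fun l => ?_
        gcongr
        exact hmeas l
    _ = ∑' l : ℤ, ∫⁻ x, ENNReal.ofReal (160 * 2 ^ v) * (ENNReal.ofReal (a l ^ (v-1)) * h1 l x) := by
        refine tsum_congr fun l => ?_
        rw [lintegral_const_mul _ ((hh1m l).const_mul _), lintegral_const_mul _ (hh1m l),
          ← mul_assoc, ← mul_assoc, ← ENNReal.ofReal_mul (by have := ha0 l; positivity),
          ← ENNReal.ofReal_mul (by positivity)]
        congr 2
        rw [Real.mul_rpow (by norm_num) (ha0 l).le, Real.rpow_sub_one (ha0 l).ne']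
        ring
    _ = ∫⁻ x, ENNReal.ofReal (160 * 2 ^ v) * ((∑' l : ℤ, if ENNReal.ofReal (a l) < ENNReal.ofReal c * h x then
          ENNReal.ofReal (a l ^ (v-1)) else 0) * h x) := by
        rw [← lintegral_tsum fun l => (((hh1m l).const_mul _).const_mul _).aemeasurable]
        refine lintegral_congr fun x => ?_
        rw [ENNReal.tsum_mul_left, ← ENNReal.tsum_mul_right]
        congr 1
        refine tsum_congr fun l => ?_
        simp only [hh1]
        split_ifs <;> simp
    _ ≤ ∫⁻ x, ENNReal.ofReal (160 * 2 ^ v) * ((ENNReal.ofReal C1 * (ENNReal.ofReal c * h x) ^ (v-1)) * h x) := by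
        refine lintegral_mono fun x => ?_
        gcongr
        exact H1 _
    _ = ∫⁻ x, ENNReal.ofReal (160 * 2 ^ v * C1 * c ^ (v-1)) * h x ^ v := by
        refine lintegral_congr fun x => ?_
        rw [ENNReal.mul_rpow_of_nonneg _ _ (by linarith), ENNReal.ofReal_rpow_of_pos hc0,
          ENNReal.ofReal_mul (p := 160 * 2 ^ v * C1) (by positivity),
          ENNReal.ofReal_mul (p := 160 * 2 ^ v) (by positivity)]
        have : h x ^ v = h x ^ (v-1) * h x := by
          conv_rhs => rw [← ENNReal.rpow_one (h x), ← ENNReal.rpow_mul, one_mul]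
          rw [← ENNReal.rpow_add_of_nonneg _ _ (by linarith) (by norm_num)]
          congr 1; ring
        rw [this]; ring
    _ = _ := by
        rw [lintegral_const_mul _ (hh.pow_const v)]
        rfl

lemma measurable_kPsub (n : ℤ) (x : ℝ) : Measurable fun y : ℝ => ENNReal.ofReal (kP n (x - y)) :=
  ENNReal.measurable_ofReal.comp ((measurable_kP n).comp (measurable_const.sub measurable_id))

lemma Pn_holder (n : ℤ) {F G : ℝ → ℝ≥0∞} (hF : Measurable F) (hG : Measurable G) (a b : ℝ)
    (ha : 0 ≤ a) (hb : 0 ≤ b) (hab : a + b = 1) (x : ℝ) :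
    Pn n (fun y => F y ^ a * G y ^ b) x ≤ Pn n F x ^ a * Pn n G x ^ b := by
  unfold Pn
  have := ENNReal.lintegral_mul_norm_pow_le (μ := volume)
    (f := fun y => ENNReal.ofReal (kP n (x - y)) * F y)
    (g := fun y => ENNReal.ofReal (kP n (x - y)) * G y)
    ((measurable_kPsub n x).mul hF).aemeasurable ((measurable_kPsub n x).mul hG).aemeasurable ha hb hab
  refine le_trans (le_of_eq (lintegral_congr fun y => ?_)) this
  rw [ENNReal.mul_rpow_of_nonneg _ _ ha, ENNReal.mul_rpow_of_nonneg _ _ hb]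
  have h1 : ENNReal.ofReal (kP n (x - y)) = ENNReal.ofReal (kP n (x - y)) ^ a *
      ENNReal.ofReal (kP n (x - y)) ^ b := by
    rw [← ENNReal.rpow_add_of_nonneg _ _ ha hb, hab, ENNReal.rpow_one]
  conv_lhs => rw [h1]
  ring

lemma Pn_one (n : ℤ) (x : ℝ) : Pn n (fun _ => 1) x = ENNReal.ofReal ck := by
  unfold Pn
  simp only [mul_one]
  exact lintegral_kP_sub n x

lemma Pn_rpow (n : ℤ) {f : ℝ → ℝ≥0∞} (hf : Measurable f) (r : ℝ) (hr : 1 ≤ r) (x : ℝ) :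
    Pn n f x ^ r ≤ ENNReal.ofReal ck ^ (r-1) * Pn n (fun y => f y ^ r) x := by
  have hr0 : 0 < r := by linarith
  have h := Pn_holder n (hf.pow_const r) (measurable_const (a := (1:ℝ≥0∞))) (1/r) (1-1/r)
    (by positivity) (by rw [sub_nonneg, div_le_one hr0]; exact hr) (by ring) x
  have e : (fun y => (f y ^ r) ^ (1/r) * (1:ℝ≥0∞) ^ (1 - 1/r)) = f := by
    funext y
    rw [← ENNReal.rpow_mul, mul_one_div_cancel hr0.ne', ENNReal.rpow_one, ENNReal.one_rpow, mul_one]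
  rw [e, Pn_one] at h
  calc Pn n f x ^ r ≤ (Pn n (fun y => f y ^ r) x ^ (1/r) * ENNReal.ofReal ck ^ (1 - 1/r)) ^ r := by
        gcongr
    _ = _ := by
        rw [ENNReal.mul_rpow_of_nonneg _ _ hr0.le, ← ENNReal.rpow_mul, ← ENNReal.rpow_mul,
          one_div_mul_cancel hr0.ne', ENNReal.rpow_one, mul_comm]
        congr 2
        field_simp

lemma VV1 (v : ℝ) (hv : 1 ≤ v) : ∃ C : ℝ≥0, ∀ h : ℤ → ℝ → ℝ≥0∞, (∀ n, Measurable (h n)) →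
    ∫⁻ x, (∑' n, Pn n (h n) x) ^ v ≤ C * ∫⁻ x, (∑' n, h n x) ^ v := by
  rcases hv.eq_or_lt with rfl | hv
  · refine ⟨Real.toNNReal ck, fun h hh => ?_⟩
    simp only [ENNReal.rpow_one]
    rw [lintegral_tsum fun n => (measurable_Pn n (hh n)).aemeasurable,
      lintegral_tsum fun n => (hh n).aemeasurable, ← ENNReal.tsum_mul_left]
    refine ENNReal.tsum_le_tsum fun n => ?_
    rw [lintegral_Pn n (hh n)]; rfl
  have hv1 : 0 < v - 1 := by linarith
  set v' := v / (v-1) with hv'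
  have hv'1 : 1 < v' := by rw [hv', one_lt_div hv1]; linarith
  obtain ⟨C, HC⟩ := MM_strong v' hv'1
  refine ⟨C ^ (v-1), fun h hh => ?_⟩
  set H : ℝ → ℝ≥0∞ := fun x => ∑' n, Pn n (h n) x with hH
  set g : ℝ → ℝ≥0∞ := fun x => ∑' n, h n x with hg
  have hHm : Measurable H := Measurable.tsum fun n => measurable_Pn n (hh n)
  have hgm : Measurable g := Measurable.tsum fun n => hh n
  set HN : ℕ → ℝ → ℝ≥0∞ := fun N => (Metric.closedBall (0:ℝ) N).indicator fun x => min (H x) N with hHN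
  have hHNm : ∀ N, Measurable (HN N) := fun N =>
    (hHm.min measurable_const).indicator Metric.isClosed_closedBall.measurableSet
  have hHNle : ∀ N x, HN N x ≤ H x := fun N x =>
    (Set.indicator_le_self _ _ x).trans (min_le_left _ _)
  have hfin : ∀ N, ∫⁻ x, HN N x ^ v ≠ ⊤ := by
    intro N
    refine ne_top_of_le_ne_top ?_ (lintegral_mono (g := (Metric.closedBall (0:ℝ) N).indicator
      fun x => (N:ℝ≥0∞) ^ v) fun x => ?_)
    · rw [lintegral_indicator_const Metric.isClosed_closedBall.measurableSet]
      refine ENNReal.mul_ne_top (ENNReal.rpow_ne_top_of_nonneg (by linarith) (by simp)) ?_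
      rw [Real.volume_closedBall]; exact ENNReal.ofReal_ne_top
    · simp only [hHN, Set.indicator]
      split_ifs
      · exact ENNReal.rpow_le_rpow (min_le_right _ _) (by linarith)
      · rw [ENNReal.zero_rpow_of_pos (by linarith)]
  have main : ∀ N, ∫⁻ x, HN N x ^ v ≤ (C ^ (v-1) : ℝ≥0) * ∫⁻ x, g x ^ v := by
    intro N
    set X := ∫⁻ x, HN N x ^ v with hX
    have hw : Measurable fun x => HN N x ^ (v-1) := (hHNm N).pow_const _
    have h1 : X ≤ ∫⁻ x, g x * MM (fun y => HN N y ^ (v-1)) x := by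
      calc X ≤ ∫⁻ x, H x * HN N x ^ (v-1) := by
            refine lintegral_mono fun x => ?_
            have : HN N x ^ v = HN N x * HN N x ^ (v-1) := by
              nth_rewrite 2 [← ENNReal.rpow_one (HN N x)]
              rw [← ENNReal.rpow_add_of_nonneg _ _ (by norm_num) hv1.le]
              congr 1; ring
            show HN N x ^ v ≤ _
            rw [this]
            gcongr
            exact hHNle N x
        _ = ∑' n, ∫⁻ x, Pn n (h n) x * HN N x ^ (v-1) := by
            rw [← lintegral_tsum (f := fun n x => Pn n (h n) x * HN N x ^ (v-1)) fun n => ((measurable_Pn n (hh n)).mul hw).aemeasurable]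
            refine lintegral_congr fun x => ?_
            rw [ENNReal.tsum_mul_right]
        _ = ∑' n, ∫⁻ x, h n x * Pn n (fun y => HN N y ^ (v-1)) x :=
            tsum_congr fun n => Pn_adj n (hh n) hw
        _ ≤ ∑' n, ∫⁻ x, h n x * MM (fun y => HN N y ^ (v-1)) x := by
            refine ENNReal.tsum_le_tsum fun n => lintegral_mono fun x => ?_
            gcongr
            exact Pn_le_MM n _ x
        _ = _ := by
            rw [← lintegral_tsum (f := fun n x => h n x * MM (fun y => HN N y ^ (v-1)) x) fun n => ((hh n).mul (measurable_MM hw)).aemeasurable]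
            refine lintegral_congr fun x => ?_
            rw [ENNReal.tsum_mul_right]
    have hconj : v.HolderConjugate v' := Real.HolderConjugate.conjExponent hv
    have h2 := ENNReal.lintegral_mul_le_Lp_mul_Lq volume hconj hgm.aemeasurable
      (measurable_MM hw).aemeasurable
    have h3 : ∫⁻ x, MM (fun y => HN N y ^ (v-1)) x ^ v' ≤ C * X := by
      refine (HC _ hw).trans (le_of_eq ?_)
      congr 1
      refine lintegral_congr fun x => ?_
      rw [← ENNReal.rpow_mul, hv', mul_div_cancel₀ _ hv1.ne']
    have h4 : X ≤ (∫⁻ x, g x ^ v) ^ (1/v) * (C * X) ^ (1/v') := by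
      refine h1.trans (h2.trans ?_)
      gcongr
    rcases eq_or_ne X 0 with h0 | h0
    · rw [h0]; exact zero_le
    have hXt := hfin N
    -- raise to power v
    have h5 : X ^ v ≤ (∫⁻ x, g x ^ v) * (C * X) ^ (v - 1) := by
      calc X ^ v ≤ ((∫⁻ x, g x ^ v) ^ (1/v) * (C * X) ^ (1/v')) ^ v := by gcongr
        _ = _ := by
          rw [ENNReal.mul_rpow_of_nonneg _ _ (by linarith), ← ENNReal.rpow_mul, ← ENNReal.rpow_mul,
            one_div_mul_cancel (by linarith), ENNReal.rpow_one]
          congr 2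
          rw [hv']; field_simp
    have h6 : X ^ v = X * X ^ (v-1) := by
      nth_rewrite 2 [← ENNReal.rpow_one X]
      rw [← ENNReal.rpow_add_of_nonneg _ _ (by norm_num) hv1.le]
      congr 1; ring
    rw [h6, ENNReal.mul_rpow_of_nonneg _ _ hv1.le, ← mul_assoc] at h5
    have h7 := (ENNReal.mul_le_mul_iff_left (by rw [Ne, ENNReal.rpow_eq_zero_iff_of_pos hv1]; exact h0) (ENNReal.rpow_ne_top_of_nonneg hv1.le hXt)).1 h5
    refine h7.trans (le_of_eq ?_)
    rw [mul_comm, ENNReal.coe_rpow_of_nonneg _ hv1.le]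
  -- monotone convergence
  have hsup : ∀ x, H x ^ v = ⨆ N, HN N x ^ v := by
    intro x
    have hmono : Monotone fun N : ℕ => HN N x ^ v := by
      intro N M hNM
      refine ENNReal.rpow_le_rpow ?_ (by linarith)
      simp only [hHN, Set.indicator]
      have : (N:ℝ) ≤ M := by exact_mod_cast hNM
      split_ifs with h1 h2
      · exact min_le_min_left _ (by exact_mod_cast hNM)
      · exact absurd (Metric.closedBall_subset_closedBall this h1) h2
      · exact zero_le
      · exact le_refl _
    have ht : Filter.Tendsto (fun N : ℕ => HN N x ^ v) Filter.atTop (nhds (H x ^ v)) := by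
      refine (ENNReal.continuous_rpow_const.tendsto _).comp ?_
      have h1 : Filter.Tendsto (fun N : ℕ => min (H x) (N:ℝ≥0∞)) Filter.atTop (nhds (min (H x) ⊤)) :=
        tendsto_const_nhds.min ENNReal.tendsto_nat_nhds_top
      rw [min_top_right] at h1
      refine h1.congr' ?_
      filter_upwards [Filter.eventually_ge_atTop ⌈|x|⌉₊] with N hN
      simp only [hHN]
      rw [Set.indicator_of_mem]
      rw [mem_closedBall_zero_iff, Real.norm_eq_abs]
      exact Nat.ceil_le.1 hN
    exact tendsto_nhds_unique ht (tendsto_atTop_iSup hmono)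
  have hmono2 : Monotone fun N : ℕ => fun x => HN N x ^ v := by
    intro N M hNM x
    refine ENNReal.rpow_le_rpow ?_ (by linarith)
    simp only [hHN, Set.indicator]
    have : (N:ℝ) ≤ M := by exact_mod_cast hNM
    split_ifs with h1 h2
    · exact min_le_min_left _ (by exact_mod_cast hNM)
    · exact absurd (Metric.closedBall_subset_closedBall this h1) h2
    · exact zero_le
    · exact le_refl _
  calc ∫⁻ x, H x ^ v = ∫⁻ x, ⨆ N, HN N x ^ v := lintegral_congr hsup
    _ = ⨆ N, ∫⁻ x, HN N x ^ v := lintegral_iSup (fun N => (hHNm N).pow_const v) hmono2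
    _ ≤ _ := iSup_le main

theorem VV (p r : ℝ) (hp : 1 < p) (hr : 1 ≤ r) : ∃ C : ℝ≥0, ∀ f : ℤ → ℝ → ℝ≥0∞,
    (∀ n, Measurable (f n)) →
    ∫⁻ x, (∑' n, Pn n (f n) x ^ r) ^ (p/r) ≤ C * ∫⁻ x, (∑' n, f n x ^ r) ^ (p/r) := by
  have hr0 : 0 < r := by linarith
  have hp0 : 0 < p := by linarith
  have hpr : 0 < p / r := by positivity
  rcases le_or_gt r p with h | h
  · obtain ⟨C, HC⟩ := VV1 (p/r) (by rw [one_le_div hr0]; exact h)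
    refine ⟨((Real.toNNReal ck) ^ (r-1)) ^ (p/r) * C, fun f hf => ?_⟩
    have hc : (((Real.toNNReal ck) ^ (r-1)) ^ (p/r) : ℝ≥0) =
        (ENNReal.ofReal ck ^ (r-1)) ^ (p/r) := by
      rw [ENNReal.coe_rpow_of_nonneg _ hpr.le, ENNReal.coe_rpow_of_nonneg _ (by linarith)]; rfl
    have hH := HC (fun n x => f n x ^ r) (fun n => (hf n).pow_const r)
    calc ∫⁻ x, (∑' n, Pn n (f n) x ^ r) ^ (p/r)
        ≤ ∫⁻ x, (ENNReal.ofReal ck ^ (r-1)) ^ (p/r) * (∑' n, Pn n (fun y => f n y ^ r) x) ^ (p/r) := by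
          refine lintegral_mono fun x => ?_
          rw [← ENNReal.mul_rpow_of_nonneg _ _ hpr.le, ← ENNReal.tsum_mul_left]
          refine ENNReal.rpow_le_rpow (ENNReal.tsum_le_tsum fun n => ?_) hpr.le
          exact Pn_rpow n (hf n) r hr x
      _ = (ENNReal.ofReal ck ^ (r-1)) ^ (p/r) * ∫⁻ x, (∑' n, Pn n (fun y => f n y ^ r) x) ^ (p/r) :=
          lintegral_const_mul _ ((Measurable.tsum fun n =>
            measurable_Pn n ((hf n).pow_const r)).pow_const _)
      _ ≤ _ := by
          rw [ENNReal.coe_mul, hc, mul_assoc]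
          gcongr
  · have hr1 : 0 < r - 1 := by linarith
    have hrp : 0 < r - p := by linarith
    set w := p * (r-1) / (r-p) with hw
    have hw1 : 1 < w := by
      rw [hw, one_lt_div hrp]; nlinarith
    obtain ⟨C, HC⟩ := MM_strong w hw1
    refine ⟨(Real.toNNReal ck) ^ (p/r) * C ^ (1-p/r) + 1, fun f hf => ?_⟩
    have hpr1 : 0 < 1 - p / r := by rw [sub_pos, div_lt_one hr0]; exact h
    set S : ℝ → ℝ≥0∞ := fun x => ∑' n, f n x ^ r with hS
    have hSm : Measurable S := Measurable.tsum fun n => (hf n).pow_const r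
    by_cases hI : ∫⁻ x, S x ^ (p/r) = ⊤
    · rw [hI, ENNReal.mul_top (by simp)]; exact le_top
    have hSae : ∀ᵐ x, S x ≠ ⊤ := by
      filter_upwards [ae_lt_top (hSm.pow_const _) hI] with x hx hx2
      rw [hx2, ENNReal.top_rpow_of_pos hpr] at hx
      exact lt_irrefl _ hx
    set e := (r-p) / (r*(r-1)) with he
    set M := MM (fun y => S y ^ e) with hM
    set A : ℤ → ℝ → ℝ≥0∞ := fun n y => f n y ^ r * S y ^ (-((r-p)/r)) with hA
    have hAm : ∀ n, Measurable (A n) := fun n => ((hf n).pow_const r).mul (hSm.pow_const _)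
    have hSe : Measurable fun y => S y ^ e := hSm.pow_const _
    have hinv : 1 / r + (1 - 1/r) = 1 := by ring
    have h1r : 0 ≤ 1 - 1 / r := by rw [sub_nonneg, div_le_one hr0]; exact hr
    have h1 : ∀ n x, Pn n (f n) x ≤ Pn n (A n) x ^ (1/r) * M x ^ (1 - 1/r) := by
      intro n x
      calc Pn n (f n) x ≤ Pn n (fun y => A n y ^ (1/r) * (S y ^ e) ^ (1-1/r)) x := by
            apply Pn_mono_ae
            filter_upwards [hSae] with y hy
            rcases eq_or_ne (S y) 0 with h0 | h0
            · have : f n y ^ r = 0 := le_antisymm ((ENNReal.le_tsum n).trans h0.le) zero_le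
              rw [ENNReal.rpow_eq_zero_iff_of_pos hr0] at this
              rw [this]; exact zero_le
            · simp only [hA]
              rw [ENNReal.mul_rpow_of_nonneg _ _ (by positivity), ← ENNReal.rpow_mul,
                ← ENNReal.rpow_mul, ← ENNReal.rpow_mul, mul_assoc,
                ← ENNReal.rpow_add _ _ h0 hy, mul_one_div_cancel hr0.ne', ENNReal.rpow_one]
              have : -((r-p)/r) * (1/r) + e * (1-1/r) = 0 := by rw [he]; field_simp; ring
              rw [this, ENNReal.rpow_zero, mul_one]
        _ ≤ Pn n (A n) x ^ (1/r) * Pn n (fun y => S y ^ e) x ^ (1-1/r) :=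
            Pn_holder n (hAm n) hSe _ _ (by positivity) h1r hinv x
        _ ≤ _ := by
            gcongr
            exact Pn_le_MM n _ x
    set K : ℝ → ℝ≥0∞ := fun x => ∑' n, Pn n (A n) x with hK
    have hKm : Measurable K := Measurable.tsum fun n => measurable_Pn n (hAm n)
    have hMm : Measurable M := measurable_MM hSe
    have h2 : ∀ x, (∑' n, Pn n (f n) x ^ r) ^ (p/r) ≤ K x ^ (p/r) * (M x ^ w) ^ (1 - p/r) := by
      intro x
      have h3 : ∑' n, Pn n (f n) x ^ r ≤ K x * M x ^ (r-1) := by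
        rw [hK, ← ENNReal.tsum_mul_right]
        refine ENNReal.tsum_le_tsum fun n => ?_
        calc Pn n (f n) x ^ r ≤ (Pn n (A n) x ^ (1/r) * M x ^ (1 - 1/r)) ^ r := by
              gcongr; exact h1 n x
          _ = _ := by
              rw [ENNReal.mul_rpow_of_nonneg _ _ hr0.le, ← ENNReal.rpow_mul, ← ENNReal.rpow_mul,
                one_div_mul_cancel hr0.ne', ENNReal.rpow_one]
              congr 2; field_simp
      calc (∑' n, Pn n (f n) x ^ r) ^ (p/r) ≤ (K x * M x ^ (r-1)) ^ (p/r) := by gcongr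
        _ = _ := by
          rw [ENNReal.mul_rpow_of_nonneg _ _ hpr.le, ← ENNReal.rpow_mul, ← ENNReal.rpow_mul]
          congr 2; rw [hw]; field_simp
    have hKint : ∫⁻ x, K x ≤ ENNReal.ofReal ck * ∫⁻ x, S x ^ (p/r) := by
      rw [hK, lintegral_tsum fun n => (measurable_Pn n (hAm n)).aemeasurable]
      simp only [lintegral_Pn _ (hAm _)]
      rw [ENNReal.tsum_mul_left, ← lintegral_tsum fun n => (hAm n).aemeasurable]
      gcongr with x
      simp only [hA]
      rw [ENNReal.tsum_mul_right]
      show S x * _ ≤ _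
      rcases eq_or_ne (S x) 0 with h0 | h0
      · rw [h0, zero_mul]; exact zero_le
      rcases eq_or_ne (S x) ⊤ with ht | ht
      · rw [ht, ENNReal.top_rpow_of_pos hpr]; exact le_top
      nth_rewrite 1 [← ENNReal.rpow_one (S x)]
      rw [← ENNReal.rpow_add _ _ h0 ht]
      apply le_of_eq; congr 1; field_simp; ring
    have hMint : ∫⁻ x, M x ^ w ≤ C * ∫⁻ x, S x ^ (p/r) := by
      refine (HC _ hSe).trans (le_of_eq ?_)
      congr 1
      refine lintegral_congr fun x => ?_
      rw [← ENNReal.rpow_mul]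
      congr 1; rw [he, hw]; field_simp
    calc _ ≤ ∫⁻ x, K x ^ (p/r) * (M x ^ w) ^ (1 - p/r) := lintegral_mono h2
      _ ≤ (∫⁻ x, K x) ^ (p/r) * (∫⁻ x, M x ^ w) ^ (1-p/r) :=
          ENNReal.lintegral_mul_norm_pow_le hKm.aemeasurable (hMm.pow_const w).aemeasurable
            hpr.le hpr1.le (by ring)
      _ ≤ (ENNReal.ofReal ck * ∫⁻ x, S x ^ (p/r)) ^ (p/r) * (C * ∫⁻ x, S x ^ (p/r)) ^ (1-p/r) := by
          gcongr
      _ = (ENNReal.ofReal ck ^ (p/r) * (C:ℝ≥0∞) ^ (1-p/r)) * ∫⁻ x, S x ^ (p/r) := by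
          rw [ENNReal.mul_rpow_of_nonneg _ _ hpr.le, ENNReal.mul_rpow_of_nonneg _ _ hpr1.le,
            mul_mul_mul_comm, ← ENNReal.rpow_add_of_nonneg _ _ hpr.le hpr1.le]
          rw [add_sub_cancel, ENNReal.rpow_one]
      _ ≤ _ := by
          gcongr
          rw [ENNReal.coe_add, ENNReal.coe_mul, ENNReal.coe_rpow_of_nonneg _ hpr.le,
            ENNReal.coe_rpow_of_nonneg _ hpr1.le]
          exact le_self_add

lemma schwartz_decay (φ : SchwartzMap ℝ ℂ) (k : ℕ) : ∃ C : ℝ, 0 ≤ C ∧ ∀ x, ‖φ x‖ ≤ C / (1 + |x|) ^ k := by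
  have := φ.one_add_le_sup_seminorm_apply (𝕜 := ℂ) (m := (k, 0)) (k := k) (n := 0) le_rfl le_rfl
  generalize 2 ^ (k, 0).1 * ((Finset.Iic (k, 0)).sup fun m => SchwartzMap.seminorm ℂ m.1 m.2) φ = K at this
  refine ⟨K, ?_, fun x => ?_⟩
  rotate_left
  · have h := this x
    rw [norm_iteratedFDeriv_zero, Real.norm_eq_abs] at h
    rw [le_div_iff₀ (by positivity), mul_comm]
    exact h
  · have h := this 0
    exact le_trans (by positivity) h

lemma integral_eq_zero_of_fourier (Nb : ℝ) (φ : SchwartzMap ℝ ℂ)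
    (hφ : ∀ ξ : ℝ, 𝓕 (⇑φ) ξ ≠ 0 → (2 : ℝ) ^ (-Nb) < |ξ| ∧ |ξ| < (2 : ℝ) ^ Nb) :
    ∫ x, φ x = 0 := by
  by_contra h
  have h1 : 𝓕 (⇑φ) (0:ℝ) = ∫ x, φ x := by
    rw [Real.fourier_real_eq]
    simp
  have := (hφ 0 (by rw [h1]; exact h)).1
  rw [abs_zero] at this
  have h2 : (0:ℝ) < 2 ^ (-Nb) := by positivity
  linarith

def psi (φ : ℝ → ℂ) (x : ℝ) : ℂ := ∫ y in Set.Iic x, φ y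

lemma hasDerivAt_psi (φ : SchwartzMap ℝ ℂ) (x : ℝ) : HasDerivAt (psi φ) (φ x) x := by
  have h1 : psi φ = fun x => (∫ y in Set.Iic (0:ℝ), φ y) + ∫ y in (0:ℝ)..x, φ y := by
    funext z
    rw [← intervalIntegral.integral_Iic_sub_Iic φ.integrable.integrableOn φ.integrable.integrableOn]
    simp [psi]
  rw [h1]
  refine HasDerivAt.const_add _ ?_
  exact intervalIntegral.integral_hasDerivAt_right φ.integrable.intervalIntegrable
    (φ.continuous.stronglyMeasurableAtFilter _ _) φ.continuous.continuousAt

lemma continuous_psi (φ : SchwartzMap ℝ ℂ) : Continuous (psi φ) :=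
  continuous_iff_continuousAt.2 fun x => (hasDerivAt_psi φ x).continuousAt

lemma integrable_P2 : Integrable fun x : ℝ => 1 / (1 + |x|) ^ 2 := by
  refine integrable_P.congr (Filter.Eventually.of_forall fun x => ?_)
  simp only
  rw [Real.rpow_neg (by positivity), one_div]
  norm_num

lemma psi_decay (φ : SchwartzMap ℝ ℂ) (h0 : ∫ x, φ x = 0) :
    ∃ C : ℝ, 0 ≤ C ∧ ∀ x, ‖psi φ x‖ ≤ C / (1 + |x|) ^ 2 := by
  obtain ⟨C, hC, H⟩ := schwartz_decay φ 4
  have hIntP := integrable_P2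
  set I := ∫ x : ℝ, 1 / (1 + |x|) ^ 2 with hI
  have hI0 : 0 ≤ I := integral_nonneg fun x => by positivity
  refine ⟨C * I, by positivity, fun x => ?_⟩
  have gen : ∀ s : Set ℝ, MeasurableSet s → (∀ y ∈ s, |x| ≤ |y|) →
      ‖∫ y in s, φ y‖ ≤ C * I / (1 + |x|) ^ 2 := by
    intro s hs hsx
    calc ‖∫ y in s, φ y‖ ≤ ∫ y in s, C / (1 + |x|) ^ 2 * (1 / (1 + |y|) ^ 2) := by
          refine norm_integral_le_of_norm_le (hIntP.const_mul _).integrableOn ?_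
          filter_upwards [ae_restrict_mem hs] with y hy
          refine (H y).trans ?_
          rw [div_mul_div_comm, mul_one]
          have := hsx y hy
          gcongr
          calc (1 + |x|) ^ 2 * (1 + |y|) ^ 2 ≤ (1 + |y|) ^ 2 * (1 + |y|) ^ 2 := by gcongr
            _ = _ := by ring
      _ = C / (1 + |x|) ^ 2 * ∫ y in s, (1 / (1 + |y|) ^ 2) := by rw [integral_const_mul]
      _ ≤ C / (1 + |x|) ^ 2 * I := by
          gcongr
          exact setIntegral_le_integral hIntP (Filter.Eventually.of_forall fun y => by positivity)
      _ = _ := by ring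
  rcases le_total x 0 with hx | hx
  · refine gen _ measurableSet_Iic fun y hy => ?_
    rw [abs_of_nonpos hx, abs_of_nonpos (le_trans hy hx)]
    exact neg_le_neg hy
  · have h1 : psi φ x = -∫ y in Set.Ioi x, φ y := by
      have := intervalIntegral.integral_Iic_add_Ioi (b := x) (μ := volume) (f := φ) φ.integrable.integrableOn
        φ.integrable.integrableOn
      rw [h0] at this
      exact eq_neg_of_add_eq_zero_left this
    rw [h1, norm_neg]
    refine gen _ measurableSet_Ioi fun y hy => ?_
    rw [abs_of_nonneg hx, abs_of_nonneg (le_trans hx (le_of_lt hy))]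
    exact le_of_lt hy

/-- mean value estimate -/
lemma taylor_bound (φ : SchwartzMap ℝ ℂ) : ∃ C : ℝ, 0 ≤ C ∧ ∀ α β ξ : ℝ, α < β → β - α ≤ 1 →
    α ≤ ξ → ξ ≤ β → ‖((β - α : ℝ):ℂ) * φ ξ - (psi φ β - psi φ α)‖ ≤ C * (β-α)^2 / (1 + |ξ|) ^ 2 := by
  obtain ⟨C, hC, H⟩ := schwartz_decay (SchwartzMap.derivCLM ℂ ℂ φ) 2
  refine ⟨4 * C, by positivity, fun α β ξ hab h1 hα hβ => ?_⟩
  have hB : ∀ η ∈ Set.Icc α β, ‖deriv φ η‖ ≤ 4 * C / (1 + |ξ|) ^ 2 := by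
    intro η hη
    have h2 := H η
    rw [SchwartzMap.derivCLM_apply] at h2
    refine h2.trans ?_
    rw [div_le_div_iff₀ (by positivity) (by positivity)]
    have h3 : |ξ| ≤ |η| + 1 := by
      have : |ξ - η| ≤ 1 := by rw [abs_le]; constructor <;> linarith [hη.1, hη.2]
      have h4 := abs_add_le (ξ - η) η
      rw [sub_add_cancel] at h4
      linarith
    have h5 : (1 + |ξ|) ^ 2 ≤ (2 * (1 + |η|)) ^ 2 := by
      gcongr
      linarith [abs_nonneg η]
    nlinarith
  set B := 4 * C / (1 + |ξ|) ^ 2 with hBdef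
  have hlip : ∀ η ∈ Set.Icc α β, ‖φ ξ - φ η‖ ≤ B * (β - α) := by
    intro η hη
    have := (convex_Icc α β).norm_image_sub_le_of_norm_deriv_le (f := φ) (C := B)
      (fun z _ => φ.differentiableAt) hB hη ⟨hα, hβ⟩
    refine this.trans ?_
    have hB0 : 0 ≤ B := by positivity
    gcongr
    rw [Real.norm_eq_abs, abs_le]
    constructor <;> linarith [hη.1, hη.2]
  -- apply mean value to g(η) = η φ ξ - psi η
  have hd : ∀ η ∈ Set.Icc α β, HasDerivWithinAt (fun z : ℝ => (z:ℂ) * φ ξ - psi φ z) (φ ξ - φ η) (Set.Icc α β) η := by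
    intro η _
    refine HasDerivAt.hasDerivWithinAt ?_
    have := ((Complex.ofRealCLM.hasDerivAt (x := η)).mul_const (φ ξ)).sub (hasDerivAt_psi φ η)
    simp only [Complex.ofRealCLM_apply, Complex.ofReal_one, one_mul] at this
    exact this
  have := (convex_Icc α β).norm_image_sub_le_of_norm_hasDerivWithin_le hd hlip
    (Set.left_mem_Icc.2 hab.le) (Set.right_mem_Icc.2 hab.le)
  calc _ = ‖(β:ℂ) * φ ξ - psi φ β - ((α:ℂ) * φ ξ - psi φ α)‖ := by
        congr 1; push_cast; ring
    _ ≤ _ := this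
    _ = _ := by
      rw [Real.norm_eq_abs, abs_of_pos (by linarith), hBdef]; ring

def Psi (φ : SchwartzMap ℝ ℂ) (i : ℤ) (f : ℝ → ℂ) (a : ℝ) : ℂ :=
  ∫ y, psi φ ((2:ℝ) ^ i * (a - y)) * f y

def EK (φ : SchwartzMap ℝ ℂ) (i : ℤ) (f : ℝ → ℂ) (n k : ℤ) : ℂ :=
  (((2:ℝ) ^ n : ℝ) : ℂ) * (Psi φ i f ((k+1) / (2:ℝ) ^ n) - Psi φ i f (k / (2:ℝ) ^ n))

lemma EK_add (φ : SchwartzMap ℝ ℂ) (i : ℤ) (f : ℝ → ℂ) (n k : ℤ) :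
    EK φ i f n (2*k) + EK φ i f n (2*k+1) = 2 * EK φ i f (n-1) k := by
  unfold EK
  have hp : (0:ℝ) < 2 ^ n := by positivity
  have e : (2:ℝ) ^ (n-1) = 2 ^ n / 2 := by rw [zpow_sub_one₀ (by norm_num)]; rfl
  have e1 : (((2*k:ℤ):ℝ)) / 2 ^ n = k / (2:ℝ) ^ (n-1) := by
    rw [e]; push_cast; field_simp
  have e2 : (((2*k+1:ℤ):ℝ)) / 2 ^ n = (((2*k:ℤ):ℝ) + 1) / 2 ^ n := by push_cast; ring
  have e3 : ((((2*k+1:ℤ):ℝ)) + 1) / 2 ^ n = (k + 1) / (2:ℝ) ^ (n-1) := by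
    rw [e]; push_cast; field_simp; ring
  rw [e1, e2, e3, e]
  push_cast
  ring

lemma lint_aux (K f : ℝ → ℂ) (n : ℤ) (a C : ℝ) (hC : 0 ≤ C)
    (H : ∀ y, ‖K y‖ ≤ C * kP n (a - y)) :
    ∫⁻ y, ‖K y * f y‖ₑ ≤ ENNReal.ofReal C * Pn n (fun y => ‖f y‖ₑ) a := by
  unfold Pn
  rw [← lintegral_const_mul' _ _ (by simp)]
  refine lintegral_mono fun y => ?_
  simp only
  rw [enorm_mul, ← mul_assoc, ← ENNReal.ofReal_mul hC]
  gcongr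
  rw [← ofReal_norm]
  exact ENNReal.ofReal_le_ofReal (H y)

lemma int_aux (K f : ℝ → ℂ) (hK : Measurable K) (hf : Measurable f) (n : ℤ) (a C : ℝ) (hC : 0 ≤ C)
    (H : ∀ y, ‖K y‖ ≤ C * kP n (a - y)) (hP : Pn n (fun y => ‖f y‖ₑ) a < ⊤) :
    Integrable fun y => K y * f y := by
  refine ⟨(hK.mul hf).aestronglyMeasurable, ?_⟩
  exact (lint_aux K f n a C hC H).trans_lt (ENNReal.mul_lt_top (by simp) hP)

lemma dil_bound (φ : SchwartzMap ℝ ℂ) (C : ℝ) (H : ∀ x, ‖φ x‖ ≤ C / (1 + |x|) ^ 2) (i : ℤ) (u : ℝ) :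
    ‖dilate φ i u‖ ≤ C * kP i u := by
  have hp : (0:ℝ) < 2 ^ i := by positivity
  unfold dilate kP
  rw [norm_smul, Real.norm_eq_abs, abs_of_pos hp]
  have := H (2 ^ i * u)
  rw [abs_mul, abs_of_pos hp] at this
  calc _ ≤ (2:ℝ) ^ i * (C / (1 + 2 ^ i * |u|) ^ 2) := by gcongr
    _ = _ := by ring

lemma measurable_dil (φ : SchwartzMap ℝ ℂ) (i : ℤ) : Measurable (dilate φ i) := by
  unfold dilate
  have := φ.continuous.measurable
  fun_prop

lemma psi_bound (φ : SchwartzMap ℝ ℂ) (C : ℝ) (H : ∀ x, ‖psi φ x‖ ≤ C / (1 + |x|) ^ 2) (i : ℤ) (u : ℝ) :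
    ‖psi φ ((2:ℝ) ^ i * u)‖ ≤ (C / 2 ^ i) * kP i u := by
  have hp : (0:ℝ) < 2 ^ i := by positivity
  unfold kP
  have := H (2 ^ i * u)
  rw [abs_mul, abs_of_pos hp] at this
  refine this.trans (le_of_eq ?_)
  field_simp

lemma measurable_psisub (φ : SchwartzMap ℝ ℂ) (i : ℤ) (a : ℝ) :
    Measurable fun y : ℝ => psi φ ((2:ℝ) ^ i * (a - y)) := by
  have := (continuous_psi φ).measurable
  fun_prop

lemma F_le (φ : SchwartzMap ℝ ℂ) : ∃ C : ℝ≥0, ∀ (i : ℤ) (f : ℝ → ℂ) (x : ℝ),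
    ‖conv (dilate φ i) f x‖ₑ ≤ C * Pn i (fun y => ‖f y‖ₑ) x := by
  obtain ⟨C, hC, H⟩ := schwartz_decay φ 2
  refine ⟨C.toNNReal, fun i f x => ?_⟩
  exact (enorm_integral_le_lintegral_enorm _).trans
    (lint_aux (fun y => dilate φ i (x - y)) f i x C hC fun y => dil_bound φ C H i (x - y))

lemma FE_le (φ : SchwartzMap ℝ ℂ) (h0 : ∫ x, φ x = 0) : ∃ C : ℝ≥0, ∀ (i n : ℤ) (f : ℝ → ℂ) (x : ℝ),
    i ≤ n → Measurable f → (∀ m x, Pn m (fun y => ‖f y‖ₑ) x < ⊤) →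
    ‖conv (dilate φ i) f x - EK φ i f n ⌊(2:ℝ) ^ n * x⌋‖ₑ ≤
      C * ENNReal.ofReal ((2:ℝ) ^ (i - n)) * Pn i (fun y => ‖f y‖ₑ) x := by
  obtain ⟨C0, hC0, H0⟩ := schwartz_decay φ 2
  obtain ⟨C1, hC1, H1⟩ := psi_decay φ h0
  obtain ⟨C, hC, H⟩ := taylor_bound φ
  refine ⟨C.toNNReal, fun i n f x hin hf hP => ?_⟩
  set k := ⌊(2:ℝ) ^ n * x⌋ with hk
  have hpn : (0:ℝ) < 2 ^ n := by positivity
  have hpi : (0:ℝ) < 2 ^ i := by positivity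
  set a : ℝ := k / (2:ℝ) ^ n with ha
  set b : ℝ := (k+1) / (2:ℝ) ^ n with hb
  have hax : a ≤ x := by rw [ha, div_le_iff₀ hpn, mul_comm]; exact Int.floor_le _
  have hxb : x ≤ b := by rw [hb, le_div_iff₀ hpn, mul_comm]; exact (Int.lt_floor_add_one _).le
  have hba : b - a = 1 / 2 ^ n := by rw [ha, hb]; ring
  have i1 := int_aux (fun y => dilate φ i (x - y)) f ((measurable_dil φ i).comp (by fun_prop)) hf i x C0 hC0
    (fun y => dil_bound φ C0 H0 i (x - y)) (hP i x)
  have i2 : ∀ a, Integrable fun y => psi φ ((2:ℝ) ^ i * (a - y)) * f y := fun a =>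
    int_aux (fun y => psi φ ((2:ℝ) ^ i * (a - y))) f (measurable_psisub φ i a) hf i a (C1 / 2 ^ i)
      (by positivity) (fun y => psi_bound φ C1 H1 i (a - y)) (hP i a)
  have e1 : conv (dilate φ i) f x - EK φ i f n k = ∫ y, (dilate φ i (x - y) - (((2:ℝ) ^ n : ℝ) : ℂ) *
      (psi φ ((2:ℝ) ^ i * (b - y)) - psi φ ((2:ℝ) ^ i * (a - y)))) * f y := by
    unfold conv EK Psi
    rw [← integral_sub (i2 b) (i2 a), ← integral_const_mul, ← integral_sub i1 (show Integrable fun y => (((2:ℝ) ^ n : ℝ) : ℂ) *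
      (psi φ ((2:ℝ) ^ i * (b - y)) * f y - psi φ ((2:ℝ) ^ i * (a - y)) * f y) from
      ((i2 b).sub (i2 a)).const_mul _)]
    refine integral_congr_ae (Filter.Eventually.of_forall fun y => ?_)
    simp only
    ring
  rw [e1]
  refine (enorm_integral_le_lintegral_enorm _).trans ?_
  have := lint_aux (fun y => dilate φ i (x - y) - (((2:ℝ) ^ n : ℝ) : ℂ) *
      (psi φ ((2:ℝ) ^ i * (b - y)) - psi φ ((2:ℝ) ^ i * (a - y)))) f i x (C * 2 ^ (i-n)) (by positivity) ?_
  · rw [ENNReal.ofReal_mul hC] at this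
    exact this
  intro y
  have hδ : (2:ℝ) ^ i * (b - y) - 2 ^ i * (a - y) = 2 ^ (i - n) := by
    rw [← mul_sub, show b - y - (a - y) = b - a by ring, hba, zpow_sub₀ (by norm_num)]; ring
  have hδpos : (0:ℝ) < 2 ^ (i-n) := by positivity
  have hδ1 : (2:ℝ) ^ (i-n) ≤ 1 := zpow_le_one_of_nonpos₀ (by norm_num) (by omega)
  have h2 := H (2 ^ i * (a - y)) (2 ^ i * (b - y)) (2 ^ i * (x - y)) (by linarith) (by rw [hδ]; exact hδ1)
    (by gcongr) (by gcongr)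
  rw [hδ] at h2
  have e2 : dilate φ i (x - y) - (((2:ℝ) ^ n : ℝ) : ℂ) *
      (psi φ ((2:ℝ) ^ i * (b - y)) - psi φ ((2:ℝ) ^ i * (a - y))) =
      (((2:ℝ) ^ n : ℝ) : ℂ) * ((((2:ℝ) ^ (i-n) : ℝ) : ℂ) * φ (2 ^ i * (x - y)) -
        (psi φ ((2:ℝ) ^ i * (b - y)) - psi φ ((2:ℝ) ^ i * (a - y)))) := by
    have : (2:ℝ) ^ i = 2 ^ n * 2 ^ (i - n) := by rw [← zpow_add₀ (by norm_num)]; congr 1; ring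
    unfold dilate
    rw [Complex.real_smul]
    nth_rewrite 1 [this]
    push_cast
    ring
  rw [e2, norm_mul, Complex.norm_real, Real.norm_eq_abs, abs_of_pos hpn]
  rw [abs_mul, abs_of_pos hpi] at h2
  calc _ ≤ (2:ℝ) ^ n * (C * (2 ^ (i - n)) ^ 2 / (1 + 2 ^ i * |x - y|) ^ 2) := by gcongr
    _ = _ := by
      unfold kP
      have : (2:ℝ) ^ i = 2 ^ n * 2 ^ (i - n) := by rw [← zpow_add₀ (by norm_num)]; congr 1; ring
      calc _ = C * 2 ^ (i-n) * ((2 ^ n * 2 ^ (i - n)) / (1 + 2 ^ i * |x - y|) ^ 2) := by ring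
        _ = _ := by rw [← this]

lemma tail_le (φ : SchwartzMap ℝ ℂ) (h0 : ∫ x, φ x = 0) (v : ℝ) (hv : 1 ≤ v) :
    ∃ C : ℝ≥0, ∀ (i n : ℤ) (f : ℝ → ℂ) (x a : ℝ),
    n ≤ i → Measurable f → |(2:ℝ) ^ n * (a - x)| ≤ 1 →
    ‖(((2:ℝ) ^ n : ℝ) : ℂ) * Psi φ i f a‖ₑ ≤
      C * ENNReal.ofReal ((2:ℝ) ^ (n - i)) ^ (1 - 1/v) * Pn n (fun y => ‖f y‖ₑ ^ v) x ^ (1/v) := by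
  obtain ⟨C1, hC1, H1⟩ := psi_decay φ h0
  have hv0 : 0 < v := by linarith
  have h1v : 0 ≤ 1 - 1/v := by rw [sub_nonneg, div_le_one hv0]; exact hv
  have h1v' : 0 ≤ 1/v := by positivity
  refine ⟨C1.toNNReal * ck.toNNReal ^ (1-1/v) * 4 ^ (1/v), fun i n f x a hin hf hax => ?_⟩
  have hpn : (0:ℝ) < 2 ^ n := by positivity
  have hpi : (0:ℝ) < 2 ^ i := by positivity
  have hpni : (0:ℝ) < 2 ^ (n-i) := by positivity
  have hni : (2:ℝ) ^ n ≤ 2 ^ i := zpow_le_zpow_right₀ (by norm_num) hin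
  set kk : ℝ → ℝ≥0∞ := fun y => ENNReal.ofReal (2 ^ (n-i) * kP i (a - y)) with hkk
  have hkkm : Measurable kk := ENNReal.measurable_ofReal.comp
    (((measurable_kP i).comp (measurable_const.sub measurable_id)).const_mul _)
  have hh : Measurable fun y => ‖f y‖ₑ ^ v := hf.enorm.pow_const v
  have hk1 : ∫⁻ y, kk y = ENNReal.ofReal (2 ^ (n-i)) * ENNReal.ofReal ck := by
    simp only [hkk]
    simp_rw [ENNReal.ofReal_mul hpni.le]
    rw [lintegral_const_mul' _ _ (by simp), lintegral_kP_sub]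
  have hk2 : ∀ y, kk y ≤ 4 * ENNReal.ofReal (kP n (x - y)) := by
    intro y
    rw [show (4:ℝ≥0∞) = ENNReal.ofReal 4 by simp, ← ENNReal.ofReal_mul (by norm_num)]
    refine ENNReal.ofReal_le_ofReal ?_
    unfold kP
    rw [← mul_div_assoc, ← zpow_add₀ (by norm_num), sub_add_cancel, ← mul_div_assoc,
      div_le_div_iff₀ (by positivity) (by positivity)]
    have h3 : (1 + 2 ^ n * |x - y|) ≤ 2 * (1 + 2 ^ i * |a - y|) := by
      rw [abs_mul, abs_of_pos hpn] at hax
      have h4 : |x - y| ≤ |a - x| + |a - y| := by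
        have := abs_sub_le x a y
        rw [abs_sub_comm x a] at this
        exact this
      have h5 : (2:ℝ) ^ n * |x - y| ≤ 2 ^ n * |a - x| + 2 ^ n * |a - y| := by
        rw [← mul_add]; gcongr
      have h6 : (2:ℝ) ^ n * |a - y| ≤ 2 ^ i * |a - y| := by gcongr
      have h7 : 0 ≤ (2:ℝ) ^ i * |a - y| := by positivity
      linarith
    calc (2:ℝ) ^ n * (1 + 2 ^ n * |x - y|) ^ 2 ≤ 2 ^ n * (2 * (1 + 2 ^ i * |a - y|)) ^ 2 := by gcongr
      _ = _ := by ring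
  calc ‖(((2:ℝ) ^ n : ℝ) : ℂ) * Psi φ i f a‖ₑ
      ≤ ∫⁻ y, ‖(((2:ℝ) ^ n : ℝ) : ℂ) * (psi φ ((2:ℝ) ^ i * (a - y)) * f y)‖ₑ := by
        unfold Psi
        rw [← integral_const_mul]
        exact enorm_integral_le_lintegral_enorm _
    _ ≤ ∫⁻ y, ENNReal.ofReal C1 * (kk y ^ (1-1/v) * (kk y * ‖f y‖ₑ ^ v) ^ (1/v)) := by
        refine lintegral_mono fun y => ?_
        have e : kk y ^ (1-1/v) * (kk y * ‖f y‖ₑ ^ v) ^ (1/v) = kk y * ‖f y‖ₑ := by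
          rw [ENNReal.mul_rpow_of_nonneg _ _ h1v', ← mul_assoc, ← ENNReal.rpow_add_of_nonneg _ _ h1v h1v',
            ← ENNReal.rpow_mul, mul_one_div_cancel hv0.ne']
          simp
        rw [e]
        simp only
        rw [← mul_assoc, enorm_mul, ← mul_assoc]
        gcongr
        simp only [hkk]
        rw [← ENNReal.ofReal_mul hC1, ← ofReal_norm]
        refine ENNReal.ofReal_le_ofReal ?_
        rw [norm_mul, Complex.norm_real, Real.norm_eq_abs, abs_of_pos hpn]
        calc _ ≤ (2:ℝ) ^ n * ((C1 / 2 ^ i) * kP i (a - y)) := by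
              gcongr; exact psi_bound φ C1 H1 i (a - y)
          _ = _ := by rw [zpow_sub₀ (by norm_num)]; ring
    _ ≤ ENNReal.ofReal C1 * ((∫⁻ y, kk y) ^ (1-1/v) * (∫⁻ y, kk y * ‖f y‖ₑ ^ v) ^ (1/v)) := by
        rw [lintegral_const_mul' _ _ (by simp)]
        gcongr
        exact ENNReal.lintegral_mul_norm_pow_le hkkm.aemeasurable (hkkm.mul hh).aemeasurable h1v h1v' (by ring)
    _ ≤ ENNReal.ofReal C1 * ((ENNReal.ofReal (2 ^ (n-i)) * ENNReal.ofReal ck) ^ (1-1/v) *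
        (4 * Pn n (fun y => ‖f y‖ₑ ^ v) x) ^ (1/v)) := by
        rw [hk1]
        gcongr
        unfold Pn
        rw [← lintegral_const_mul' _ _ (by simp)]
        refine lintegral_mono fun y => ?_
        simp only
        rw [← mul_assoc]
        gcongr
        exact hk2 y
    _ = _ := by
        rw [ENNReal.mul_rpow_of_nonneg _ _ h1v, ENNReal.mul_rpow_of_nonneg _ _ h1v', ENNReal.coe_mul,
          ENNReal.coe_mul, ENNReal.coe_rpow_of_nonneg _ h1v, ENNReal.coe_rpow_of_nonneg _ h1v']
        simp only [ENNReal.ofReal]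
        push_cast
        ring

theorem u_le (φ : SchwartzMap ℝ ℂ) (h0 : ∫ x, φ x = 0) (v : ℝ) (hv : 1 < v) :
    ∃ C γ : ℝ≥0, γ < 1 ∧ ∀ (i n : ℤ) (f : ℝ → ℂ) (x : ℝ),
    Measurable f → (∀ m x, Pn m (fun y => ‖f y‖ₑ) x < ⊤) →
    ‖(if i ≤ n then conv (dilate φ i) f x else 0) - EK φ i f n ⌊(2:ℝ) ^ n * x⌋‖ₑ ≤
      C * γ ^ (i - n).natAbs * (Pn i (fun y => ‖f y‖ₑ) x + Pn n (fun y => ‖f y‖ₑ ^ v) x ^ (1/v)) := by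
  obtain ⟨C1, H1⟩ := FE_le φ h0
  obtain ⟨C2, H2⟩ := tail_le φ h0 v hv.le
  have hv0 : 0 < v := by linarith
  have h1v : 0 < 1 - 1/v := by rw [sub_pos, div_lt_one hv0]; exact hv
  have h1v1 : 1 - 1/v ≤ 1 := by have : 0 < 1/v := by positivity
                                linarith
  set γ : ℝ≥0 := (1/2) ^ (1 - 1/v) with hγ
  have hγ1 : γ < 1 := NNReal.rpow_lt_one (by norm_num) h1v
  have hγ2 : (1/2 : ℝ≥0) ≤ γ := by
    have := NNReal.rpow_le_rpow_of_exponent_ge (x := (1/2:ℝ≥0)) (by norm_num) (by norm_num) h1v1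
    rwa [NNReal.rpow_one] at this
  have hpow : ∀ m : ℕ, ENNReal.ofReal ((2:ℝ) ^ (-(m:ℤ))) = ((1/2 : ℝ≥0) : ℝ≥0∞) ^ m := by
    intro m
    rw [← ENNReal.ofReal_coe_nnreal, ← ENNReal.ofReal_pow (by positivity)]
    congr 1
    rw [zpow_neg, zpow_natCast]
    simp
  refine ⟨C1 + 2 * C2, γ, hγ1, fun i n f x hf hP => ?_⟩
  split_ifs with hin
  · refine (H1 i n f x hin hf hP).trans ?_
    obtain ⟨m, hm⟩ : ∃ m : ℕ, i - n = -m := ⟨(n - i).toNat, by omega⟩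
    rw [hm, hpow, show (-(m:ℤ)).natAbs = m by omega, ENNReal.coe_add]
    gcongr
    · exact le_self_add
    · exact le_self_add
  · push Not at hin
    obtain ⟨m, hm⟩ : ∃ m : ℕ, i - n = m := ⟨(i - n).toNat, by omega⟩
    have hm' : n - i = -m := by omega
    rw [hm, show ((m:ℤ)).natAbs = m by omega, zero_sub, enorm_neg]
    have hpn : (0:ℝ) < 2 ^ n := by positivity
    set k := ⌊(2:ℝ) ^ n * x⌋ with hk
    have hk1 := Int.floor_le ((2:ℝ) ^ n * x)
    have hk2 := (Int.lt_floor_add_one ((2:ℝ) ^ n * x)).le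
    have ha : |(2:ℝ) ^ n * (k / 2 ^ n - x)| ≤ 1 := by
      rw [mul_sub, mul_div_cancel₀ _ hpn.ne', abs_le]; constructor <;> linarith
    have hb : |(2:ℝ) ^ n * ((k+1) / 2 ^ n - x)| ≤ 1 := by
      rw [mul_sub, mul_div_cancel₀ _ hpn.ne', abs_le]; constructor <;> linarith
    have t1 := H2 i n f x _ hin.le hf ha
    have t2 := H2 i n f x _ hin.le hf hb
    have e : ENNReal.ofReal ((2:ℝ) ^ (n - i)) ^ (1 - 1/v) = (γ:ℝ≥0∞) ^ m := by
      rw [hm', hpow, hγ, ENNReal.coe_rpow_of_nonneg _ h1v.le, ← ENNReal.rpow_natCast, ← ENNReal.rpow_natCast,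
        ← ENNReal.rpow_mul, ← ENNReal.rpow_mul, mul_comm]
    rw [e] at t1 t2
    unfold EK
    rw [mul_sub]
    refine (enorm_sub_le).trans ((add_le_add t2 t1).trans ?_)
    rw [← two_mul, ← mul_assoc, ← mul_assoc]
    push_cast
    gcongr
    · exact le_add_self
    · exact le_add_self

lemma tsum_geom_lt_top (η : ℝ≥0) (h : η < 1) : ∑' m : ℤ, (η:ℝ≥0∞) ^ m.natAbs ≠ ⊤ := by
  have h1 : Summable fun m : ℤ => η ^ m.natAbs := by
    rw [← NNReal.summable_coe]
    have := summable_geom_int η η.2 (by exact_mod_cast h)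
    simpa using this
  have := ENNReal.tsum_coe_ne_top_iff_summable.2 h1
  simpa using this

lemma geo_rpow (κ : ℝ) (hκ : 0 < κ) (γ : ℝ≥0) (hγ : γ < 1) : ∃ C γ' : ℝ≥0, γ' < 1 ∧
    ∀ y : ℤ → ℝ≥0∞, (∑' m, (γ:ℝ≥0∞) ^ m.natAbs * y m) ^ κ ≤
      C * ∑' m, (γ':ℝ≥0∞) ^ m.natAbs * y m ^ κ := by
  set η : ℝ≥0 := NNReal.sqrt γ with hη
  have hη1 : η < 1 := by
    rw [hη, ← NNReal.sqrt_one]; exact NNReal.sqrt_lt_sqrt.2 hγ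
  have hηη : γ = η * η := (NNReal.mul_self_sqrt γ).symm
  set S := ∑' m : ℤ, (η:ℝ≥0∞) ^ m.natAbs with hS
  have hSt := tsum_geom_lt_top η hη1
  refine ⟨S.toNNReal ^ κ, η ^ κ, NNReal.rpow_lt_one hη1 hκ, fun y => ?_⟩
  set Y := ∑' m : ℤ, ((η ^ κ : ℝ≥0) : ℝ≥0∞) ^ m.natAbs * y m ^ κ with hY
  have h1 : ∀ m, (η:ℝ≥0∞) ^ m.natAbs * y m ≤ Y ^ (1/κ) := by
    intro m
    rw [← ENNReal.rpow_le_rpow_iff hκ, ← ENNReal.rpow_mul, one_div_mul_cancel hκ.ne', ENNReal.rpow_one,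
      ENNReal.mul_rpow_of_nonneg _ _ hκ.le]
    refine le_trans (le_of_eq ?_) (ENNReal.le_tsum m)
    congr 1
    rw [ENNReal.coe_rpow_of_nonneg _ hκ.le, ← ENNReal.rpow_natCast, ← ENNReal.rpow_natCast,
      ← ENNReal.rpow_mul, ← ENNReal.rpow_mul, mul_comm]
  have h2 : ∑' m, (γ:ℝ≥0∞) ^ m.natAbs * y m ≤ S * Y ^ (1/κ) := by
    rw [hS, ← ENNReal.tsum_mul_right]
    refine ENNReal.tsum_le_tsum fun m => ?_
    rw [hηη, ENNReal.coe_mul, mul_pow, mul_assoc]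
    gcongr
    exact h1 m
  calc _ ≤ (S * Y ^ (1/κ)) ^ κ := by gcongr
    _ = _ := by
      rw [ENNReal.mul_rpow_of_nonneg _ _ hκ.le, ← ENNReal.rpow_mul, one_div_mul_cancel hκ.ne',
        ENNReal.rpow_one, ENNReal.coe_rpow_of_nonneg _ hκ.le, ENNReal.coe_toNNReal hSt]

lemma add_rpow_two (a b : ℝ≥0∞) (r : ℝ) (hr : 0 ≤ r) : (a + b) ^ r ≤ 2 ^ r * (a ^ r + b ^ r) := by
  have h1 : a + b ≤ 2 * max a b := by
    rw [two_mul]; exact add_le_add (le_max_left _ _) (le_max_right _ _)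
  calc (a+b) ^ r ≤ (2 * max a b) ^ r := by gcongr
    _ = 2 ^ r * max a b ^ r := ENNReal.mul_rpow_of_nonneg _ _ hr
    _ ≤ _ := by
      gcongr
      rcases le_total a b with h | h
      · rw [max_eq_right h]; exact le_add_self
      · rw [max_eq_left h]; exact le_self_add

theorem Y_int (p r v : ℝ) (hp : 1 < p) (hr : 1 ≤ r) (hv : 1 ≤ v) (hvp : v < p) (hvr : v ≤ r) :
    ∃ C : ℝ≥0, ∀ h : ℤ → ℝ → ℝ≥0∞, (∀ i, Measurable (h i)) → ∀ m : ℤ,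
    ∫⁻ x, (∑' n, (Pn (n+m) (h (n+m)) x + Pn n (fun y => h (n+m) y ^ v) x ^ (1/v)) ^ r) ^ (p/r) ≤
      C * ∫⁻ x, (∑' i, h i x ^ r) ^ (p/r) := by
  have hr0 : 0 < r := by linarith
  have hv0 : 0 < v := by linarith
  have hpr : 0 < p / r := by positivity
  obtain ⟨C1, H1⟩ := VV p r hp hr
  obtain ⟨C2, H2⟩ := VV (p/v) (r/v) (by rwa [one_lt_div hv0]) (by rwa [one_le_div hv0])
  have hpv : (p/v) / (r/v) = p / r := by field_simp
  rw [hpv] at H2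
  refine ⟨(2 ^ r) ^ (p/r) * 2 ^ (p/r) * (C1 + C2), fun h hh m => ?_⟩
  set I := ∫⁻ x, (∑' i, h i x ^ r) ^ (p/r) with hI
  set A : ℝ → ℝ≥0∞ := fun x => ∑' n, Pn n (h n) x ^ r with hA
  set B : ℝ → ℝ≥0∞ := fun x => ∑' n, Pn n (fun y => h (n+m) y ^ v) x ^ (r/v) with hB
  have hAm : Measurable A := Measurable.tsum fun n => (measurable_Pn n (hh n)).pow_const r
  have hBm : Measurable B := Measurable.tsum fun n =>
    (measurable_Pn n ((hh (n+m)).pow_const v)).pow_const _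
  have hAI : ∫⁻ x, A x ^ (p/r) ≤ C1 * I := H1 h hh
  have hBI : ∫⁻ x, B x ^ (p/r) ≤ C2 * I := by
    refine (H2 (fun n y => h (n+m) y ^ v) fun n => (hh (n+m)).pow_const v).trans (le_of_eq ?_)
    congr 1
    refine lintegral_congr fun x => ?_
    congr 1
    rw [← (Equiv.addRight m).tsum_eq (fun i => h i x ^ r)]
    refine tsum_congr fun n => ?_
    rw [← ENNReal.rpow_mul, mul_div_cancel₀ _ hv0.ne']
    rfl
  have hpt : ∀ x, (∑' n, (Pn (n+m) (h (n+m)) x + Pn n (fun y => h (n+m) y ^ v) x ^ (1/v)) ^ r) ^ (p/r) ≤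
      (2 ^ r) ^ (p/r) * 2 ^ (p/r) * (A x ^ (p/r) + B x ^ (p/r)) := by
    intro x
    have h1 : ∑' n, (Pn (n+m) (h (n+m)) x + Pn n (fun y => h (n+m) y ^ v) x ^ (1/v)) ^ r ≤
        2 ^ r * (A x + B x) := by
      have hA' : A x = ∑' n, Pn (n+m) (h (n+m)) x ^ r :=
        ((Equiv.addRight m).tsum_eq (fun i => Pn i (h i) x ^ r)).symm
      rw [hA', hB, ← ENNReal.tsum_add, ← ENNReal.tsum_mul_left]
      refine ENNReal.tsum_le_tsum fun n => ?_
      refine (add_rpow_two _ _ r hr0.le).trans (le_of_eq ?_)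
      rw [← ENNReal.rpow_mul, one_div_mul_eq_div]
    calc _ ≤ (2 ^ r * (A x + B x)) ^ (p/r) := by gcongr
      _ = (2 ^ r) ^ (p/r) * (A x + B x) ^ (p/r) := ENNReal.mul_rpow_of_nonneg _ _ hpr.le
      _ ≤ (2 ^ r) ^ (p/r) * (2 ^ (p/r) * (A x ^ (p/r) + B x ^ (p/r))) := by
          gcongr; exact add_rpow_two _ _ _ hpr.le
      _ = _ := by ring
  calc _ ≤ ∫⁻ x, (2 ^ r) ^ (p/r) * 2 ^ (p/r) * (A x ^ (p/r) + B x ^ (p/r)) := lintegral_mono hpt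
    _ = (2 ^ r) ^ (p/r) * 2 ^ (p/r) * ((∫⁻ x, A x ^ (p/r)) + ∫⁻ x, B x ^ (p/r)) := by
        rw [lintegral_const_mul (f := fun x => A x ^ (p/r) + B x ^ (p/r)) _ ((hAm.pow_const _).add (hBm.pow_const _)),
          lintegral_add_left (hAm.pow_const _)]
    _ ≤ (2 ^ r) ^ (p/r) * 2 ^ (p/r) * (C1 * I + C2 * I) := by gcongr
    _ = _ := by
        push_cast
        rw [ENNReal.coe_rpow_of_nonneg _ hpr.le, ENNReal.coe_rpow_of_nonneg _ hpr.le,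
          ENNReal.coe_rpow_of_nonneg _ hr0.le]
        push_cast
        ring

/-- the pieces of `U` -/
def upc (φ : SchwartzMap ℝ ℂ) (i n : ℤ) (f : ℝ → ℂ) (x : ℝ) : ℂ :=
  (if i ≤ n then conv (dilate φ i) f x else 0) - EK φ i f n ⌊(2:ℝ) ^ n * x⌋

theorem U_int (φ : SchwartzMap ℝ ℂ) (h0 : ∫ x, φ x = 0) (p r : ℝ) (hp : 1 < p) (hr : 1 < r) :
    ∃ C : ℝ≥0, ∀ f : ℤ → ℝ → ℂ, (∀ i, Measurable (f i)) →
    (∀ i m x, Pn m (fun y => ‖f i y‖ₑ) x < ⊤) → ∀ S : Finset ℤ,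
    ∫⁻ x, (∑' n, ‖∑ i ∈ S, upc φ i n (f i) x‖ₑ ^ r) ^ (p/r) ≤
      C * ∫⁻ x, (∑' i, ‖f i x‖ₑ ^ r) ^ (p/r) := by
  have hr0 : 0 < r := by linarith
  have hpr : 0 < p / r := by positivity
  obtain ⟨v, hv1, hvpr⟩ := exists_between (lt_min hp hr)
  have hvp := hvpr.trans_le (min_le_left _ _)
  have hvr := hvpr.trans_le (min_le_right _ _)
  obtain ⟨C0, γ, hγ, H0⟩ := u_le φ h0 v hv1
  obtain ⟨C1, γ1, hγ1, H1⟩ := geo_rpow r hr0 γ hγ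
  obtain ⟨C2, γ2, hγ2, H2⟩ := geo_rpow (p/r) hpr γ1 hγ1
  obtain ⟨C3, H3⟩ := Y_int p r v hp hr.le hv1.le hvp hvr.le
  have hSt := tsum_geom_lt_top γ2 hγ2
  set G := ∑' m : ℤ, (γ2:ℝ≥0∞) ^ m.natAbs with hG
  refine ⟨(C0 ^ r * C1) ^ (p/r) * C2 * (G.toNNReal * C3), fun f hf hP S => ?_⟩
  set Y : ℤ → ℤ → ℝ → ℝ≥0∞ := fun m n x => Pn (n+m) (fun y => ‖f (n+m) y‖ₑ) x +
    Pn n (fun y => ‖f (n+m) y‖ₑ ^ v) x ^ (1/v) with hY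
  have hYm : ∀ m n, Measurable (Y m n) := fun m n => (measurable_Pn _ (hf (n+m)).enorm).add
    ((measurable_Pn _ ((hf (n+m)).enorm.pow_const v)).pow_const _)
  have h1 : ∀ n x, ‖∑ i ∈ S, upc φ i n (f i) x‖ₑ ≤ C0 * ∑' m : ℤ, (γ:ℝ≥0∞) ^ m.natAbs * Y m n x := by
    intro n x
    calc _ ≤ ∑ i ∈ S, ‖upc φ i n (f i) x‖ₑ := enorm_sum_le _ _
      _ ≤ ∑' i, ‖upc φ i n (f i) x‖ₑ := ENNReal.sum_le_tsum S
      _ = ∑' m : ℤ, ‖upc φ (n+m) n (f (n+m)) x‖ₑ :=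
          ((Equiv.addLeft n).tsum_eq (fun i => ‖upc φ i n (f i) x‖ₑ)).symm
      _ ≤ _ := by
          rw [← ENNReal.tsum_mul_left]
          refine ENNReal.tsum_le_tsum fun m => ?_
          have := H0 (n+m) n (f (n+m)) x (hf _) (hP _)
          rw [add_sub_cancel_left] at this
          rw [← mul_assoc]
          exact this
  have h2 : ∀ x, ∑' n, ‖∑ i ∈ S, upc φ i n (f i) x‖ₑ ^ r ≤
      (C0 ^ r * C1 : ℝ≥0) * ∑' m : ℤ, (γ1:ℝ≥0∞) ^ m.natAbs * ∑' n, Y m n x ^ r := by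
    intro x
    calc _ ≤ ∑' n, (C0 * ∑' m : ℤ, (γ:ℝ≥0∞) ^ m.natAbs * Y m n x) ^ r := by
          refine ENNReal.tsum_le_tsum fun n => ?_
          gcongr
          exact h1 n x
      _ ≤ ∑' n, (C0 ^ r * C1 : ℝ≥0) * ∑' m : ℤ, (γ1:ℝ≥0∞) ^ m.natAbs * Y m n x ^ r := by
          refine ENNReal.tsum_le_tsum fun n => ?_
          rw [ENNReal.mul_rpow_of_nonneg _ _ hr0.le, ENNReal.coe_mul, ENNReal.coe_rpow_of_nonneg _ hr0.le,
            mul_assoc]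
          gcongr
          exact H1 _
      _ = _ := by
          rw [ENNReal.tsum_mul_left, ENNReal.tsum_comm]
          simp_rw [ENNReal.tsum_mul_left]
  have hm2 : ∀ m, Measurable fun x => (∑' n, Y m n x ^ r) ^ (p/r) := fun m =>
    (Measurable.tsum fun n => (hYm m n).pow_const r).pow_const _
  calc _ ≤ ∫⁻ x, ((C0 ^ r * C1) ^ (p/r) * C2 : ℝ≥0) * ∑' m : ℤ, (γ2:ℝ≥0∞) ^ m.natAbs * (∑' n, Y m n x ^ r) ^ (p/r) := by
        refine lintegral_mono fun x => ?_
        calc _ ≤ ((C0 ^ r * C1 : ℝ≥0) * ∑' m : ℤ, (γ1:ℝ≥0∞) ^ m.natAbs * ∑' n, Y m n x ^ r) ^ (p/r) := by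
              gcongr; exact h2 x
          _ ≤ _ := by
              rw [ENNReal.mul_rpow_of_nonneg _ _ hpr.le, ENNReal.coe_mul ((C0 ^ r * C1) ^ (p/r)) C2,
                ENNReal.coe_rpow_of_nonneg _ hpr.le, mul_assoc]
              gcongr
              exact H2 _
    _ = ((C0 ^ r * C1) ^ (p/r) * C2 : ℝ≥0) * ∑' m : ℤ, (γ2:ℝ≥0∞) ^ m.natAbs * ∫⁻ x, (∑' n, Y m n x ^ r) ^ (p/r) := by
        rw [lintegral_const_mul' _ _ ENNReal.coe_ne_top, lintegral_tsum fun m => ((hm2 m).const_mul _).aemeasurable]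
        congr 1
        refine tsum_congr fun m => ?_
        rw [lintegral_const_mul _ (hm2 m)]
    _ ≤ ((C0 ^ r * C1) ^ (p/r) * C2 : ℝ≥0) * ∑' m : ℤ, (γ2:ℝ≥0∞) ^ m.natAbs * (C3 * ∫⁻ x, (∑' i, ‖f i x‖ₑ ^ r) ^ (p/r)) := by
        gcongr with m
        exact H3 (fun i y => ‖f i y‖ₑ) (fun i => (hf i).enorm) m
    _ = _ := by
        rw [ENNReal.tsum_mul_right, ENNReal.coe_mul _ (G.toNNReal * C3), ENNReal.coe_mul G.toNNReal,
          ENNReal.coe_toNNReal hSt]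
        ring

theorem F_int (φ : SchwartzMap ℝ ℂ) (p r : ℝ) (hp : 1 < p) (hr : 1 ≤ r) :
    ∃ C : ℝ≥0, ∀ f : ℤ → ℝ → ℂ, (∀ i, Measurable (f i)) →
    ∫⁻ x, (∑' n, ‖conv (dilate φ n) (f n) x‖ₑ ^ r) ^ (p/r) ≤
      C * ∫⁻ x, (∑' i, ‖f i x‖ₑ ^ r) ^ (p/r) := by
  have hr0 : 0 < r := by linarith
  have hpr : 0 < p / r := by positivity
  obtain ⟨C, H⟩ := F_le φ
  obtain ⟨C1, H1⟩ := VV p r hp hr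
  refine ⟨(C ^ r) ^ (p/r) * C1, fun f hf => ?_⟩
  calc _ ≤ ∫⁻ x, ((C ^ r) ^ (p/r) : ℝ≥0) * (∑' n, Pn n (fun y => ‖f n y‖ₑ) x ^ r) ^ (p/r) := by
        refine lintegral_mono fun x => ?_
        rw [ENNReal.coe_rpow_of_nonneg _ hpr.le, ENNReal.coe_rpow_of_nonneg _ hr0.le,
          ← ENNReal.mul_rpow_of_nonneg _ _ hpr.le, ← ENNReal.tsum_mul_left]
        gcongr with n
        rw [← ENNReal.mul_rpow_of_nonneg _ _ hr0.le]
        gcongr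
        exact H n (f n) x
    _ ≤ _ := by
        rw [lintegral_const_mul' _ _ (by simp), ENNReal.coe_mul, mul_assoc]
        gcongr
        exact H1 _ fun i => (hf i).enorm

/-- finiteness -/
lemma Pn_finite (m : ℤ) (p : ℝ) (hp : 1 ≤ p) (h : ℝ → ℝ≥0∞) (hI : ∫⁻ y, h y ^ p ≠ ⊤) (x : ℝ) :
    Pn m h x < ⊤ := by
  have h1 : Pn m h x ≤ ENNReal.ofReal ck + ENNReal.ofReal (2 ^ m) * ∫⁻ y, h y ^ p := by
    rw [← lintegral_kP_sub m x, ← lintegral_const_mul' _ _ (by simp),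
      ← lintegral_add_left (measurable_kPsub m x)]
    refine lintegral_mono fun y => ?_
    simp only
    rcases le_total (h y) 1 with h1 | h1
    · exact (mul_le_of_le_one_right zero_le h1).trans le_self_add
    · refine le_trans ?_ le_add_self
      gcongr
      · exact kP_le m _
      · nth_rewrite 1 [← ENNReal.rpow_one (h y)]
        exact ENNReal.rpow_le_rpow_of_exponent_le h1 hp
  exact h1.trans_lt (ENNReal.add_lt_top.2 ⟨by simp, ENNReal.mul_lt_top (by simp) hI.lt_top⟩)

def tau (n : ℤ) (x : ℝ) : ℝ :=
  if Even ⌊(2:ℝ) ^ n * x⌋ then x + 1 / 2 ^ n else x - 1 / 2 ^ n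

lemma floor_add_h (n : ℤ) (x : ℝ) : ⌊(2:ℝ) ^ n * (x + 1 / 2 ^ n)⌋ = ⌊(2:ℝ) ^ n * x⌋ + 1 := by
  have : (2:ℝ) ^ n * (x + 1 / 2 ^ n) = 2 ^ n * x + 1 := by field_simp
  rw [this, Int.floor_add_one]

lemma floor_sub_h (n : ℤ) (x : ℝ) : ⌊(2:ℝ) ^ n * (x - 1 / 2 ^ n)⌋ = ⌊(2:ℝ) ^ n * x⌋ - 1 := by
  have : (2:ℝ) ^ n * (x - 1 / 2 ^ n) = 2 ^ n * x - 1 := by field_simp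
  rw [this, Int.floor_sub_one]

lemma floor_tau (n : ℤ) (x : ℝ) : ⌊(2:ℝ) ^ n * tau n x⌋ =
    if Even ⌊(2:ℝ) ^ n * x⌋ then ⌊(2:ℝ) ^ n * x⌋ + 1 else ⌊(2:ℝ) ^ n * x⌋ - 1 := by
  unfold tau
  split_ifs
  · exact floor_add_h n x
  · exact floor_sub_h n x

lemma floor_pred (n : ℤ) (x : ℝ) : ⌊(2:ℝ) ^ (n-1) * x⌋ = ⌊(2:ℝ) ^ n * x⌋ / 2 := by
  have := Int.floor_div_natCast ((2:ℝ) ^ n * x) 2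
  push_cast at this
  rw [← this]
  congr 1
  rw [zpow_sub_one₀ (by norm_num)]
  ring

lemma floor_tau_lt (n : ℤ) (x : ℝ) (k : ℤ) (h : k < n) : ⌊(2:ℝ) ^ k * tau n x⌋ = ⌊(2:ℝ) ^ k * x⌋ := by
  have key : ∀ m : ℕ, ⌊(2:ℝ) ^ (n - 1 - m) * tau n x⌋ = ⌊(2:ℝ) ^ (n - 1 - m) * x⌋ := by
    intro m
    induction m with
    | zero =>
      simp only [Nat.cast_zero, sub_zero]
      rw [floor_pred, floor_pred, floor_tau]
      split_ifs with h
      · rw [Int.even_iff] at h; omega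
      · rw [Int.even_iff] at h; omega
    | succ m ih =>
      rw [show n - 1 - ((m+1:ℕ):ℤ) = (n - 1 - m) - 1 by push_cast; ring, floor_pred, floor_pred, ih]
  have := key (n - 1 - k).toNat
  rwa [show n - 1 - (((n-1-k).toNat : ℕ) : ℤ) = k by omega] at this

lemma measurable_fl (n : ℤ) : Measurable fun x : ℝ => ⌊(2:ℝ) ^ n * x⌋ :=
  Int.measurable_floor.comp (by fun_prop)

lemma measurableSet_ev (n : ℤ) : MeasurableSet {x : ℝ | Even ⌊(2:ℝ) ^ n * x⌋} :=
  measurable_fl n (MeasurableSet.of_discrete (s := {k : ℤ | Even k}))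

lemma tau_mp (n : ℤ) : MeasurePreserving (tau n) (volume : Measure ℝ) volume := by
  have hm : Measurable (tau n) := by
    unfold tau
    exact Measurable.ite (measurableSet_ev n) (by fun_prop) (by fun_prop)
  refine ⟨hm, Measure.ext fun s hs => ?_⟩
  rw [Measure.map_apply hm hs]
  set E := {x : ℝ | Even ⌊(2:ℝ) ^ n * x⌋} with hE
  have hEm : MeasurableSet E := measurableSet_ev n
  rw [← measure_inter_add_diff (tau n ⁻¹' s) hEm, ← measure_inter_add_diff s hEm, add_comm (volume (s ∩ E))]
  have e1 : tau n ⁻¹' s ∩ E = (fun x => x + 1 / 2 ^ n) ⁻¹' (s \ E) := by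
    ext x
    simp only [Set.mem_inter_iff, Set.mem_preimage, Set.mem_diff, hE, Set.mem_ofPred_eq, floor_add_h,
      Int.even_add_one, not_not, tau]
    constructor
    · rintro ⟨h1, h2⟩; rw [if_pos h2] at h1; exact ⟨h1, h2⟩
    · rintro ⟨h1, h2⟩; rw [if_pos h2]; exact ⟨h1, h2⟩
  have e2 : tau n ⁻¹' s \ E = (fun x => x + (-(1 / 2 ^ n))) ⁻¹' (s ∩ E) := by
    ext x
    simp only [Set.mem_inter_iff, Set.mem_preimage, Set.mem_diff, hE, Set.mem_ofPred_eq, ← sub_eq_add_neg,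
      floor_sub_h, Int.even_sub_one, tau]
    constructor
    · rintro ⟨h1, h2⟩; rw [if_neg h2] at h1; exact ⟨h1, h2⟩
    · rintro ⟨h1, h2⟩; rw [if_neg h2]; exact ⟨h1, h2⟩
  rw [e1, e2, measure_preimage_add_right, measure_preimage_add_right]

def EE (φ : SchwartzMap ℝ ℂ) (S : Finset ℤ) (f : ℤ → ℝ → ℂ) (n : ℤ) (x : ℝ) : ℂ :=
  ∑ i ∈ S, EK φ i (f i) n ⌊(2:ℝ) ^ n * x⌋

lemma EE_add (φ : SchwartzMap ℝ ℂ) (S : Finset ℤ) (f : ℤ → ℝ → ℂ) (n : ℤ) (x : ℝ) :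
    EE φ S f n x + EE φ S f n (tau n x) = 2 * EE φ S f (n-1) x := by
  unfold EE
  rw [← Finset.sum_add_distrib, Finset.mul_sum]
  refine Finset.sum_congr rfl fun i _ => ?_
  rw [floor_pred, floor_tau]
  set k := ⌊(2:ℝ) ^ n * x⌋
  rw [← EK_add]
  split_ifs with h
  · rw [Int.even_iff] at h
    rw [show 2 * (k/2) = k by omega]
  · rw [Int.even_iff] at h
    rw [show 2 * (k/2) = k - 1 by omega, show k - 1 + 1 = k by ring, add_comm]

lemma EE_tau_lt (φ : SchwartzMap ℝ ℂ) (S : Finset ℤ) (f : ℤ → ℝ → ℂ) (n k : ℤ) (x : ℝ) (h : k < n) :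
    EE φ S f k (tau n x) = EE φ S f k x := by
  unfold EE
  rw [floor_tau_lt n x k h]

lemma measurable_EE (φ : SchwartzMap ℝ ℂ) (S : Finset ℤ) (f : ℤ → ℝ → ℂ) (n : ℤ) :
    Measurable (EE φ S f n) := by
  have : Measurable fun k : ℤ => ∑ i ∈ S, EK φ i (f i) n k := Measurable.of_discrete
  exact this.comp (measurable_fl n)

lemma measurable_conv (φ : SchwartzMap ℝ ℂ) (i : ℤ) (f : ℝ → ℂ) (hf : Measurable f) :
    Measurable (conv (dilate φ i) f) := by
  have h : Measurable (Function.uncurry fun x y : ℝ => dilate φ i (x - y) * f y) :=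
    ((measurable_dil φ i).comp (by fun_prop)).mul (hf.comp measurable_snd)
  have := (h.stronglyMeasurable).integral_prod_right (ν := (volume : Measure ℝ))
  exact this.measurable

lemma measurable_upc (φ : SchwartzMap ℝ ℂ) (i n : ℤ) (f : ℝ → ℂ) (hf : Measurable f) :
    Measurable (upc φ i n f) := by
  unfold upc
  have h1 : Measurable fun x : ℝ => EK φ i f n ⌊(2:ℝ) ^ n * x⌋ :=
    (Measurable.of_discrete (f := fun k : ℤ => EK φ i f n k)).comp (measurable_fl n)
  have h2 := measurable_conv φ i f hf
  refine Measurable.sub ?_ h1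
  split_ifs
  · exact h2
  · exact measurable_const

lemma U_diff (φ : SchwartzMap ℝ ℂ) (S : Finset ℤ) (f : ℤ → ℝ → ℂ) (n : ℤ) (hn : n ∈ S) (x : ℝ) :
    conv (dilate φ n) (f n) x = (EE φ S f n x - EE φ S f (n-1) x) +
      (∑ i ∈ S, upc φ i n (f i) x - ∑ i ∈ S, upc φ i (n-1) (f i) x) := by
  unfold EE upc
  simp only [Finset.sum_sub_distrib]
  have : ∑ i ∈ S, (if i ≤ n then conv (dilate φ i) (f i) x else 0) -
      ∑ i ∈ S, (if i ≤ n - 1 then conv (dilate φ i) (f i) x else 0) = conv (dilate φ n) (f n) x := by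
    rw [← Finset.sum_sub_distrib, Finset.sum_eq_single n]
    · simp
    · intro b _ hb
      by_cases h : b ≤ n - 1
      · rw [if_pos h, if_pos (by omega), sub_self]
      · rw [if_neg h, if_neg (by omega), sub_self]
    · exact fun h => absurd hn h
  rw [← this]
  ring

lemma sum_shift_le_Z (T : ℕ) (L : ℤ) (h : ℤ → ℝ≥0∞) : ∑ j ∈ Finset.range T, h (j + L) ≤ ∑' n, h n :=
  (ENNReal.sum_le_tsum _).trans (ENNReal.tsum_comp_le_tsum_of_injective (f := fun j : ℕ => (j:ℤ) + L)
    (fun a b hab => by simpa using hab) h)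

/-- the quantity controlling the pieces -/
def Aq (r : ℝ) (T : ℕ) (d U R : ℕ → ℝ → ℂ) (x : ℝ) : ℝ :=
  ∑ j ∈ Finset.range T, ‖d j x‖ ^ r + ∑ j ∈ Finset.range (T+1), ‖U j x‖ ^ r +
    (∑ j ∈ Finset.range T, ‖R j x‖) ^ r

lemma measurable_Aq (r : ℝ) (T : ℕ) (d U R : ℕ → ℝ → ℂ) (hd : ∀ j, Measurable (d j))
    (hU : ∀ j, Measurable (U j)) (hR : ∀ j, Measurable (R j)) : Measurable (Aq r T d U R) := by
  unfold Aq
  refine ((Finset.measurable_fun_sum _ fun j _ => (hd j).norm.pow_const r).add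
    (Finset.measurable_fun_sum _ fun j _ => (hU j).norm.pow_const r)).add
    ((Finset.measurable_fun_sum _ fun j _ => (hR j).norm).pow_const r)

lemma ofReal_norm_rpow (z : ℂ) (r : ℝ) (hr : 0 ≤ r) : ENNReal.ofReal (‖z‖ ^ r) = ‖z‖ₑ ^ r := by
  rw [← ofReal_norm, ENNReal.ofReal_rpow_of_nonneg (norm_nonneg _) hr]

theorem decompF (φ : SchwartzMap ℝ ℂ) (h0 : ∫ x, φ x = 0) (p r : ℝ) (hp : 1 < p) (hr : 1 ≤ r) :
    ∃ C : ℝ≥0, ∀ (f : ℤ → ℝ → ℂ), (∀ i, Measurable (f i)) →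
    ∫⁻ x, (∑' i, ‖f i x‖ₑ ^ r) ^ (p/r) ≠ ⊤ → ∀ L : ℕ, ∃ d U R : ℕ → ℝ → ℂ,
      (∀ j, Measurable (d j)) ∧ (∀ j, Measurable (U j)) ∧ (∀ j, Measurable (R j)) ∧
      (∀ (n : ℕ) x, d n (tau (n - L + 1) x) = - d n x) ∧
      (∀ (j n : ℕ) x, j < n → d j (tau (n - L + 1) x) = d j x) ∧
      (∀ (j : ℕ) x, j < 2 * L → conv (dilate φ (j - L + 1)) (f (j - L + 1)) x =
        d j x + (U (j+1) x - U j x) + R j x) ∧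
      ∫⁻ x, ENNReal.ofReal (Aq r (2*L) d U R x ^ (p/r)) ≤ C * ∫⁻ x, (∑' i, ‖f i x‖ₑ ^ r) ^ (p/r) := by
  have hr0 : 0 < r := by linarith
  have hpr : 0 < p / r := by positivity
  obtain ⟨C1, H1⟩ := F_int φ p r hp hr
  rcases hr.eq_or_lt with rfl | hr1
  · refine ⟨C1, fun f hf hfin L => ⟨fun _ _ => 0, fun _ _ => 0,
      fun j x => conv (dilate φ (j - L + 1)) (f (j - L + 1)) x, fun _ => measurable_const,
      fun _ => measurable_const, fun j => measurable_conv _ _ _ (hf _), by simp, by simp, by simp, ?_⟩⟩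
    refine le_trans (lintegral_mono fun x => ?_) (H1 f hf)
    rw [← ENNReal.ofReal_rpow_of_nonneg (by unfold Aq; positivity) hpr.le]
    gcongr
    simp only [Aq, norm_zero, Real.rpow_one, Finset.sum_const_zero, zero_add, ENNReal.rpow_one]
    rw [ENNReal.ofReal_sum_of_nonneg fun _ _ => norm_nonneg _]
    simp only [ofReal_norm]
    refine le_trans (le_of_eq ?_) (sum_shift_le_Z (2*L) (-L+1) (fun n => ‖conv (dilate φ n) (f n) x‖ₑ))
    refine Finset.sum_congr rfl fun j _ => ?_
    rw [show (j:ℤ) - L + 1 = j + (-L + 1) by ring]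
  · obtain ⟨C2, H2⟩ := U_int φ h0 p r hp hr1
    set c : ℝ≥0 := ((2 ^ r) * (2 ^ r) * 2 + 1) with hc
    refine ⟨c ^ (p/r) * 2 ^ (p/r) * (C1 + C2), fun f hf hfin L => ?_⟩
    set S : Finset ℤ := Finset.Ioc (-L) L with hS
    set I := ∫⁻ x, (∑' i, ‖f i x‖ₑ ^ r) ^ (p/r) with hI
    have hPf : ∀ i m x, Pn m (fun y => ‖f i y‖ₑ) x < ⊤ := by
      intro i m x
      refine Pn_finite m p hp.le _ (ne_top_of_le_ne_top hfin (lintegral_mono fun y => ?_)) x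
      simp only
      have : ‖f i y‖ₑ ^ p = (‖f i y‖ₑ ^ r) ^ (p/r) := by
        rw [← ENNReal.rpow_mul, mul_div_cancel₀ _ hr0.ne']
      rw [this]
      gcongr
      exact ENNReal.le_tsum (f := fun i => ‖f i y‖ₑ ^ r) i
    have H2' := H2 f hf hPf S
    set Ut : ℤ → ℝ → ℂ := fun n x => ∑ i ∈ S, upc φ i n (f i) x with hUt
    have hUtm : ∀ n, Measurable (Ut n) := fun n =>
      Finset.measurable_fun_sum _ fun i _ => measurable_upc φ i n (f i) (hf i)
    have hdec : ∀ (j : ℕ) x, j < 2 * L → conv (dilate φ (j - L + 1)) (f (j - L + 1)) x =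
        (EE φ S f (j - L + 1) x - EE φ S f (j - L) x) + (Ut (j - L + 1) x - Ut (j-L) x) := by
      intro j x hj
      have := U_diff φ S f (j - L + 1) (by rw [hS, Finset.mem_Ioc]; omega) x
      rwa [show (j:ℤ) - L + 1 - 1 = j - L by ring] at this
    refine ⟨fun j x => EE φ S f (j - L + 1) x - EE φ S f (j - L) x, fun j x => Ut (j - L) x,
      fun _ _ => 0, fun j => (measurable_EE _ _ _ _).sub (measurable_EE _ _ _ _), fun j => hUtm _,
      fun _ => measurable_const, ?_, ?_, ?_, ?_⟩
    · intro n x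
      have h1 := EE_add φ S f (n - L + 1) x
      have h2 := EE_tau_lt φ S f (n - L + 1) (n - L) x (by omega)
      rw [show (n:ℤ) - L + 1 - 1 = n - L by ring] at h1
      simp only
      rw [h2]
      linear_combination h1
    · intro j n x hjn
      simp only
      rw [EE_tau_lt φ S f (n - L + 1) (j - L + 1) x (by omega), EE_tau_lt φ S f (n - L + 1) (j - L) x (by omega)]
    · intro j x hj
      simp only
      rw [hdec j x hj, add_zero, show (((j+1 : ℕ) : ℤ)) - L = (j:ℤ) - L + 1 by push_cast; ring]
    · set A : ℝ → ℝ≥0∞ := fun x => ∑' n, ‖conv (dilate φ n) (f n) x‖ₑ ^ r with hA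
      set B : ℝ → ℝ≥0∞ := fun x => ∑' n, ‖Ut n x‖ₑ ^ r with hB
      have hAm : Measurable A := Measurable.tsum fun n => (measurable_conv φ n _ (hf n)).enorm.pow_const r
      have hpt : ∀ x, ENNReal.ofReal (Aq r (2*L) (fun j x => EE φ S f (j - L + 1) x - EE φ S f (j - L) x)
          (fun j x => Ut (j - L) x) (fun _ _ => 0) x) ≤ c * (A x + B x) := by
        intro x
        unfold Aq
        simp only [norm_zero, Finset.sum_const_zero, Real.zero_rpow hr0.ne', add_zero]
        rw [ENNReal.ofReal_add (by positivity) (by positivity),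
          ENNReal.ofReal_sum_of_nonneg fun _ _ => by positivity,
          ENNReal.ofReal_sum_of_nonneg fun _ _ => by positivity]
        simp only [ofReal_norm_rpow _ r hr0.le]
        have hb0 : ∀ T : ℕ, ∑ j ∈ Finset.range T, ‖Ut (j - L) x‖ₑ ^ r ≤ B x := by
          intro T
          exact sum_shift_le_Z T (-L) (fun n => ‖Ut n x‖ₑ ^ r)
        have hb1 : ∀ T : ℕ, ∑ j ∈ Finset.range T, ‖Ut (j - L + 1) x‖ₑ ^ r ≤ B x := by
          intro T
          refine le_trans (le_of_eq ?_) (sum_shift_le_Z T (-L+1) (fun n => ‖Ut n x‖ₑ ^ r))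
          refine Finset.sum_congr rfl fun j _ => ?_
          rw [show (j:ℤ) - L + 1 = j + (-L + 1) by ring]
        have ha1 : ∀ T : ℕ, ∑ j ∈ Finset.range T, ‖conv (dilate φ (j - L + 1)) (f (j - L + 1)) x‖ₑ ^ r ≤ A x := by
          intro T
          refine le_trans (le_of_eq ?_) (sum_shift_le_Z T (-L+1) (fun n => ‖conv (dilate φ n) (f n) x‖ₑ ^ r))
          refine Finset.sum_congr rfl fun j _ => ?_
          rw [show (j:ℤ) - L + 1 = j + (-L + 1) by ring]
        have hd : ∑ j ∈ Finset.range (2*L), ‖EE φ S f (j - L + 1) x - EE φ S f (j - L) x‖ₑ ^ r ≤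
            2 ^ r * (A x + 2 ^ r * (B x + B x)) := by
          calc _ ≤ ∑ j ∈ Finset.range (2*L), 2 ^ r * (‖conv (dilate φ (j - L + 1)) (f (j - L + 1)) x‖ₑ ^ r +
                2 ^ r * (‖Ut (j - L + 1) x‖ₑ ^ r + ‖Ut (j - L) x‖ₑ ^ r)) := by
                refine Finset.sum_le_sum fun j hj => ?_
                have h1 : EE φ S f (j - L + 1) x - EE φ S f (j - L) x =
                    conv (dilate φ (j - L + 1)) (f (j - L + 1)) x - (Ut (j - L + 1) x - Ut (j-L) x) := by
                  rw [hdec j x (Finset.mem_range.1 hj)]; ring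
                calc _ ≤ (‖conv (dilate φ (j - L + 1)) (f (j - L + 1)) x‖ₑ +
                      (‖Ut (j - L + 1) x‖ₑ + ‖Ut (j - L) x‖ₑ)) ^ r := by
                      gcongr
                      rw [h1]
                      refine enorm_sub_le.trans ?_
                      gcongr
                      exact enorm_sub_le
                  _ ≤ 2 ^ r * (‖conv (dilate φ (j - L + 1)) (f (j - L + 1)) x‖ₑ ^ r +
                      (‖Ut (j - L + 1) x‖ₑ + ‖Ut (j - L) x‖ₑ) ^ r) := add_rpow_two _ _ r hr0.le
                  _ ≤ _ := by gcongr; exact add_rpow_two _ _ r hr0.le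
            _ = 2 ^ r * (∑ j ∈ Finset.range (2*L), ‖conv (dilate φ (j - L + 1)) (f (j - L + 1)) x‖ₑ ^ r +
                2 ^ r * (∑ j ∈ Finset.range (2*L), ‖Ut (j - L + 1) x‖ₑ ^ r +
                  ∑ j ∈ Finset.range (2*L), ‖Ut (j - L) x‖ₑ ^ r)) := by
                rw [← Finset.mul_sum, Finset.sum_add_distrib, ← Finset.mul_sum, Finset.sum_add_distrib]
            _ ≤ _ := by
                gcongr
                · exact ha1 _
                · exact hb1 _
                · exact hb0 _
        have h2r : (1:ℝ≥0∞) ≤ 2 ^ r := by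
          rw [← ENNReal.one_rpow r]; gcongr; norm_num
        calc _ ≤ 2 ^ r * (A x + 2 ^ r * (B x + B x)) + B x := by
              gcongr
              exact hb0 _
          _ ≤ 2 ^ r * (2 ^ r * (A x + A x) + 2 ^ r * (B x + B x)) + (A x + B x) := by
              gcongr
              · calc A x ≤ A x + A x := le_self_add
                  _ ≤ _ := le_mul_of_one_le_left zero_le h2r
              · exact le_add_self
          _ = _ := by
              rw [hc]; push_cast
              rw [ENNReal.coe_rpow_of_nonneg _ hr0.le]
              push_cast
              ring
      calc _ ≤ ∫⁻ x, (c ^ (p/r) * 2 ^ (p/r) : ℝ≥0) * (A x ^ (p/r) + B x ^ (p/r)) := by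
            refine lintegral_mono fun x => ?_
            simp only
            rw [← ENNReal.ofReal_rpow_of_nonneg (by unfold Aq; positivity) hpr.le]
            calc _ ≤ (c * (A x + B x)) ^ (p/r) := by gcongr; exact hpt x
              _ = c ^ (p/r) * (A x + B x) ^ (p/r) := ENNReal.mul_rpow_of_nonneg _ _ hpr.le
              _ ≤ c ^ (p/r) * (2 ^ (p/r) * (A x ^ (p/r) + B x ^ (p/r))) := by
                  gcongr; exact add_rpow_two _ _ _ hpr.le
              _ = _ := by
                  rw [ENNReal.coe_mul, ENNReal.coe_rpow_of_nonneg _ hpr.le, ENNReal.coe_rpow_of_nonneg _ hpr.le]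
                  push_cast; ring
        _ = (c ^ (p/r) * 2 ^ (p/r) : ℝ≥0) * ((∫⁻ x, A x ^ (p/r)) + ∫⁻ x, B x ^ (p/r)) := by
            rw [lintegral_const_mul' _ _ ENNReal.coe_ne_top, lintegral_add_left (hAm.pow_const _)]
        _ ≤ (c ^ (p/r) * 2 ^ (p/r) : ℝ≥0) * (C1 * I + C2 * I) := by
            gcongr
            exact H1 f hf
        _ = _ := by
            rw [ENNReal.coe_mul _ (C1 + C2), ENNReal.coe_add C1 C2]
            ring

lemma scale_le (r α : ℝ) (hr : 1 ≤ r) (hα : 0 < α) (T : ℕ) (d U R : ℕ → ℝ → ℂ) (x : ℝ)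
    (h : Aq r T d U R x ≤ α ^ r) : ∑ j ∈ Finset.range T, ‖d j x‖ ^ r ≤ α ^ r ∧
      ∑ j ∈ Finset.range T, ‖d j x / (α:ℂ)‖ ^ r ≤ 1 ∧
      ∑ j ∈ Finset.range (T+1), ‖U j x / (α:ℂ)‖ ^ r ≤ 1 ∧
      ∑ j ∈ Finset.range T, ‖R j x / (α:ℂ)‖ ≤ 1 := by
  unfold Aq at h
  have hr0 : 0 < r := by linarith
  have p1 : 0 ≤ ∑ j ∈ Finset.range T, ‖d j x‖ ^ r := by positivity
  have p2 : 0 ≤ ∑ j ∈ Finset.range (T+1), ‖U j x‖ ^ r := by positivity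
  have p3 : 0 ≤ (∑ j ∈ Finset.range T, ‖R j x‖) ^ r := by positivity
  have hn : ∀ z : ℂ, ‖z / (α:ℂ)‖ = ‖z‖ / α := by
    intro z; rw [norm_div, Complex.norm_real, Real.norm_eq_abs, abs_of_pos hα]
  have hnr : ∀ z : ℂ, ‖z / (α:ℂ)‖ ^ r = ‖z‖ ^ r / α ^ r := by
    intro z; rw [hn, Real.div_rpow (norm_nonneg _) hα.le]
  have hαr : 0 < α ^ r := by positivity
  simp only [hnr]
  simp only [hn, ← Finset.sum_div]
  refine ⟨by linarith, (div_le_one hαr).2 (by linarith), (div_le_one hαr).2 (by linarith),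
    (div_le_one hα).2 ?_⟩
  exact (Real.rpow_le_rpow_iff (by positivity) hα.le hr0).1 (by linarith)

lemma tsum_lev (u p r : ℝ) (K : ℕ) (hu : 0 < u) (hp : 0 < p) (hr : 0 < r) (hK : p / r < K + 1) :
    ∃ C : ℝ≥0, ∀ y : ℝ, 0 ≤ y → ∑' l : ℤ, ENNReal.ofReal ((2:ℝ) ^ (l * u)) *
      ENNReal.ofReal ((min (y / ((2:ℝ) ^ (l * u / p)) ^ r) 1) ^ (K+1)) ≤ C * ENNReal.ofReal (y ^ (p/r)) := by
  obtain ⟨C, hC, H⟩ := geom_sum_min (2 ^ (u * r / p)) (p/r) (K+1) (Real.one_lt_rpow (by norm_num) (by positivity))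
    (by positivity) hK
  refine ⟨C.toNNReal, fun y hy => ?_⟩
  have h2 : (0:ℝ) ≤ 2 := by norm_num
  have e1 : ∀ l : ℤ, ((2:ℝ) ^ (u * r / p)) ^ (l:ℝ) = ((2:ℝ) ^ (l * u / p)) ^ r := by
    intro l
    rw [← Real.rpow_mul h2, ← Real.rpow_mul h2]; congr 1; ring
  have e2 : ∀ l : ℤ, (((2:ℝ) ^ (u * r / p)) ^ (l:ℝ)) ^ (p/r) = (2:ℝ) ^ (l * u) := by
    intro l
    rw [← Real.rpow_mul h2, ← Real.rpow_mul h2]; congr 1; field_simp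
  rw [ENNReal.tsum_eq_iSup_sum]
  refine iSup_le fun s => ?_
  calc _ = ENNReal.ofReal (∑ l ∈ s, (2:ℝ) ^ (l * u) * (min (y / ((2:ℝ) ^ (l * u / p)) ^ r) 1) ^ (K+1)) := by
        rw [ENNReal.ofReal_sum_of_nonneg]
        · exact Finset.sum_congr rfl fun l _ => (ENNReal.ofReal_mul (by positivity)).symm
        · intro l _; positivity
    _ ≤ ENNReal.ofReal (C * y ^ (p/r)) := by
        refine ENNReal.ofReal_le_ofReal (le_trans (le_of_eq ?_) (H s y hy))
        refine Finset.sum_congr rfl fun l _ => ?_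
        rw [e2, e1, ← Real.rpow_natCast]
        push_cast
        rfl
    _ = _ := by rw [ENNReal.ofReal_mul hC]; rfl

theorem level_int (φ : SchwartzMap ℝ ℂ) (h0 : ∫ x, φ x = 0) (p q r s ρ σ t u : ℝ) (hp : 1 < p) (hq : 1 < q)
    (hr : 1 ≤ r) (hr2 : r ≤ 2) (hs : 1 ≤ s) (hs2 : s ≤ 2) (h : Adm r ρ) (h' : Adm s σ) (ht : 0 < t)
    (hts : 1 / t = 1 / ρ + 1 / σ) (hu : 0 < u) (hpq : 1 / u = 1 / p + 1 / q) :
    ∃ C : ℝ≥0, ∀ (f g : ℤ → ℝ → ℂ), (∀ i, Measurable (f i)) → (∀ i, Measurable (g i)) →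
    ∫⁻ x, (∑' i, ‖f i x‖ₑ ^ r) ^ (p/r) ≠ ⊤ → ∫⁻ x, (∑' i, ‖g i x‖ₑ ^ s) ^ (q/s) ≠ ⊤ →
    ∀ (L M : ℕ) (n : ℕ → ℝ → ℕ), (∀ x, Monotone fun k => n k x) → (∀ k x, n k x ≤ 2 * L) →
    ∫⁻ x, ENNReal.ofReal (∑ k ∈ Finset.range M,
      ‖BB (fun j => conv (dilate φ (j - L + 1)) (f (j - L + 1)) x)
        (fun j => conv (dilate φ (j - L + 1)) (g (j - L + 1)) x) (n k x) (n (k+1) x)‖ ^ t) ^ (u/t) ≤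
      C * ((∫⁻ x, (∑' i, ‖f i x‖ₑ ^ r) ^ (p/r)) + ∫⁻ x, (∑' i, ‖g i x‖ₑ ^ s) ^ (q/s)) := by
  have hr0 : 0 < r := by linarith
  have hs0 : 0 < s := by linarith
  have hp0 : 0 < p := by linarith
  have hq0 : 0 < q := by linarith
  obtain ⟨K, hK⟩ := exists_nat_gt (max (p/r) (q/s))
  have hK1 : p / r < K + 1 := by have := le_max_left (p/r) (q/s); linarith
  have hK2 : q / s < K + 1 := by have := le_max_right (p/r) (q/s); linarith
  have hrρ : r ≤ ρ := by rcases h with ⟨rfl, _⟩ | ⟨rfl, h⟩ <;> linarith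
  have hsσ : s ≤ σ := by rcases h' with ⟨rfl, _⟩ | ⟨rfl, h⟩ <;> linarith
  obtain ⟨CD, A, hA, HD⟩ := propD (volume : Measure ℝ) r s ρ σ t hr hs h h' ht hts K
  obtain ⟨CE', hCE', HE'⟩ := assembleE r s ρ σ t A hr hr2 hs hs2 hrρ hsσ ht hts
  obtain ⟨Cf, Hf⟩ := decompF φ h0 p r hp hr
  obtain ⟨Cg, Hg⟩ := decompF φ h0 q s hq hs
  obtain ⟨C1, H1⟩ := tsum_lev u p r K hu hp0 hr0 hK1
  obtain ⟨C2, H2⟩ := tsum_lev u q s K hu hq0 hs0 hK2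
  set CE := CE' + 1 with hCE
  have hCEp : 0 < CE := by linarith
  refine ⟨(CE.toNNReal) ^ (u/t) * ((2 ^ u * 2 ^ K * (1 + CD)) * (C1 * Cf + C2 * Cg)), ?_⟩
  intro f g hf hg hfin hgin L M n hn hnL
  obtain ⟨d, U, R, hdm, hUm, hRm, hd1, hd2, hdec, hAf⟩ := Hf f hf hfin L
  obtain ⟨e, W, R', hem, hWm, hRm', he1, he2, hdec', hAg⟩ := Hg g hg hgin L
  set If := ∫⁻ x, (∑' i, ‖f i x‖ₑ ^ r) ^ (p/r)
  set Ig := ∫⁻ x, (∑' i, ‖g i x‖ₑ ^ s) ^ (q/s)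
  set V : ℝ → ℝ := fun x => ∑ k ∈ Finset.range M,
      ‖BB (fun j => conv (dilate φ (j - L + 1)) (f (j - L + 1)) x)
        (fun j => conv (dilate φ (j - L + 1)) (g (j - L + 1)) x) (n k x) (n (k+1) x)‖ ^ t with hV
  have hV0 : ∀ x, 0 ≤ V x := fun x => by positivity
  set α : ℤ → ℝ := fun l => (2:ℝ) ^ (l * u / p) with hα
  set β : ℤ → ℝ := fun l => (2:ℝ) ^ (l * u / q) with hβ
  have hα0 : ∀ l, 0 < α l := fun l => by positivity
  have hβ0 : ∀ l, 0 < β l := fun l => by positivity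
  have hαβ : ∀ l, α l * β l = 2 ^ (l:ℝ) := by
    intro l
    rw [hα, hβ]
    simp only
    rw [← Real.rpow_add (by norm_num)]
    congr 1
    calc (l:ℝ) * u / p + l * u / q = l * u * (1 / p + 1 / q) := by ring
      _ = l := by rw [← hpq]; field_simp
  have HZ := fun l => HD (2*L) (fun n => tau (n - L + 1)) d e (fun n => tau_mp _) hdm hem hd1 he1 hd2 he2
    (α l) (β l) (hα0 l) (hβ0 l)
  choose Z hZm hZi hZ using HZ
  set AF := Aq r (2*L) d U R with hAF
  set AG := Aq s (2*L) e W R' with hAG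
  have hAFm : Measurable AF := measurable_Aq _ _ _ _ _ hdm hUm hRm
  have hAGm : Measurable AG := measurable_Aq _ _ _ _ _ hem hWm hRm'
  have hAF0 : ∀ x, 0 ≤ AF x := fun x => by rw [hAF]; unfold Aq; positivity
  have hAG0 : ∀ x, 0 ≤ AG x := fun x => by rw [hAG]; unfold Aq; positivity
  set H : ℤ → ℝ → ℝ≥0∞ := fun l x => ENNReal.ofReal ((min (AF x / α l ^ r) 1 + min (AG x / β l ^ s) 1) ^ (K+1)) with hH
  have hHm : ∀ l, Measurable (H l) := fun l => by
    have a1 := hAFm.div_const (α l ^ r)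
    have a2 := hAGm.div_const (β l ^ s)
    exact (((a1.min measurable_const).add (a2.min measurable_const)).pow_const _).ennreal_ofReal
  have hZH : ∀ l, ∫⁻ x, Z l x ≤ CD * ∫⁻ x, H l x := by
    intro l
    refine (hZi l).trans ?_
    gcongr with x
    refine ENNReal.ofReal_le_ofReal ?_
    have i1 : ∑ j ∈ Finset.range (2*L), ‖d j x‖ ^ r ≤ AF x := by
      rw [hAF]; unfold Aq; rw [add_assoc]
      exact le_add_of_nonneg_right (by positivity)
    have i2 : ∑ j ∈ Finset.range (2*L), ‖e j x‖ ^ s ≤ AG x := by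
      rw [hAG]; unfold Aq; rw [add_assoc]
      exact le_add_of_nonneg_right (by positivity)
    have := hα0 l
    have := hβ0 l
    gcongr
  -- pointwise bound
  have hpt : ∀ (l : ℤ) x, Z l x < 1 → AF x ≤ α l ^ r → AG x ≤ β l ^ s → V x ≤ CE * ((2:ℝ) ^ (l:ℝ)) ^ t := by
    intro l x hz ha hb
    obtain ⟨a1, a2, a3, a4⟩ := scale_le r (α l) hr (hα0 l) _ _ _ _ _ ha
    obtain ⟨b1, b2, b3, b4⟩ := scale_le s (β l) hs (hβ0 l) _ _ _ _ _ hb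
    have hVar := hZ l x hz a1 b1
    have := HE' (2*L) (fun j => conv (dilate φ (j - L + 1)) (f (j - L + 1)) x / (α l : ℂ))
      (fun j => conv (dilate φ (j - L + 1)) (g (j - L + 1)) x / (β l : ℂ)) _ _
      (fun j => U j x / (α l : ℂ)) (fun j => W j x / (β l : ℂ)) (fun j => R j x / (α l : ℂ))
      (fun j => R' j x / (β l : ℂ)) (fun j hj => by rw [hdec j x hj]; ring)
      (fun j hj => by rw [hdec' j x hj]; ring) a2 b2 a3 b3 a4 b4 hVar (fun k => n k x) (hn x)
      (fun k => hnL k x) M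
    simp only [BB_div] at this
    have hab : (α l : ℂ) * (β l : ℂ) = (((2:ℝ) ^ (l:ℝ) : ℝ) : ℂ) := by rw [← hαβ]; push_cast; rfl
    have hp2 : (0:ℝ) < (2:ℝ) ^ (l:ℝ) := by positivity
    have hsum : ∀ z : ℂ, ‖z / ((α l : ℂ) * (β l : ℂ))‖ ^ t = ‖z‖ ^ t / ((2:ℝ) ^ (l:ℝ)) ^ t := by
      intro z
      rw [hab, norm_div, Complex.norm_real, Real.norm_eq_abs, abs_of_pos hp2,
        Real.div_rpow (norm_nonneg _) hp2.le]
    simp only [hsum, ← Finset.sum_div] at this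
    rw [div_le_iff₀ (by positivity)] at this
    refine this.trans ?_
    gcongr
    linarith
  have hone : ∀ (l : ℤ) x, ENNReal.ofReal ((2:ℝ) ^ (l:ℝ)) < ENNReal.ofReal ((V x / CE) ^ (1/t)) → 1 ≤ Z l x + H l x := by
    intro l x hlt
    by_contra hcon
    push Not at hcon
    have hz : Z l x < 1 := lt_of_le_of_lt le_self_add hcon
    have hh : H l x < 1 := lt_of_le_of_lt le_add_self hcon
    have hh' : (min (AF x / α l ^ r) 1 + min (AG x / β l ^ s) 1) ^ (K+1) < 1 := by
      rwa [hH, ← ENNReal.ofReal_one, ENNReal.ofReal_lt_ofReal_iff (by norm_num)] at hh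
    have pa : 0 < α l ^ r := Real.rpow_pos_of_pos (hα0 l) _
    have pb : 0 < β l ^ s := Real.rpow_pos_of_pos (hβ0 l) _
    have m1 : 0 ≤ min (AF x / α l ^ r) 1 := le_min (div_nonneg (hAF0 x) pa.le) zero_le_one
    have m2 : 0 ≤ min (AG x / β l ^ s) 1 := le_min (div_nonneg (hAG0 x) pb.le) zero_le_one
    have hs1 : min (AF x / α l ^ r) 1 + min (AG x / β l ^ s) 1 < 1 := by
      by_contra hc
      push Not at hc
      exact absurd (one_le_pow₀ hc) (not_le.2 hh')
    have ha : AF x ≤ α l ^ r := by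
      by_contra hc
      push Not at hc
      rw [min_eq_right ((one_le_div pa).2 hc.le)] at hs1
      linarith
    have hb : AG x ≤ β l ^ s := by
      by_contra hc
      push Not at hc
      rw [min_eq_right ((one_le_div pb).2 hc.le)] at hs1
      linarith
    have hv := hpt l x hz ha hb
    have hlt' := (ENNReal.ofReal_lt_ofReal_iff_of_nonneg (by positivity)).1 hlt
    have : (V x / CE) ^ (1/t) ≤ (2:ℝ) ^ (l:ℝ) := by
      rw [one_div, Real.rpow_inv_le_iff_of_pos (div_nonneg (hV0 x) hCEp.le) (by positivity) ht,
        div_le_iff₀ hCEp, mul_comm]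
      exact hv
    linarith
  have hlay : ∀ x, ENNReal.ofReal ((V x / CE) ^ (1/t)) ^ u ≤
      ∑' l : ℤ, ENNReal.ofReal ((2 * (2:ℝ) ^ (l:ℝ)) ^ u) * (Z l x + H l x) := by
    intro x
    refine (layer_up u hu _).trans (ENNReal.tsum_le_tsum fun l => ?_)
    split_ifs with hlt
    · exact le_mul_of_one_le_right zero_le (hone l x hlt)
    · exact zero_le
  have hco : ∀ l : ℤ, ENNReal.ofReal ((2 * (2:ℝ) ^ (l:ℝ)) ^ u) = 2 ^ u * ENNReal.ofReal ((2:ℝ) ^ (l * u)) := by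
    intro l
    rw [Real.mul_rpow (by norm_num) (by positivity), ENNReal.ofReal_mul (by positivity),
      ← Real.rpow_mul (by norm_num), ← ENNReal.ofReal_rpow_of_nonneg (by norm_num) hu.le]
    norm_num
  have hsumH : ∀ x, ∑' l : ℤ, ENNReal.ofReal ((2:ℝ) ^ (l * u)) * H l x ≤
      2 ^ K * (C1 * ENNReal.ofReal (AF x ^ (p/r)) + C2 * ENNReal.ofReal (AG x ^ (q/s))) := by
    intro x
    calc _ ≤ ∑' l : ℤ, 2 ^ K * (ENNReal.ofReal ((2:ℝ) ^ (l * u)) *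
          ENNReal.ofReal ((min (AF x / α l ^ r) 1) ^ (K+1)) + ENNReal.ofReal ((2:ℝ) ^ (l * u)) *
          ENNReal.ofReal ((min (AG x / β l ^ s) 1) ^ (K+1))) := by
          refine ENNReal.tsum_le_tsum fun l => ?_
          have pa : 0 < α l ^ r := Real.rpow_pos_of_pos (hα0 l) _
          have pb : 0 < β l ^ s := Real.rpow_pos_of_pos (hβ0 l) _
          have m1 : 0 ≤ min (AF x / α l ^ r) 1 := le_min (div_nonneg (hAF0 x) pa.le) zero_le_one
          have m2 : 0 ≤ min (AG x / β l ^ s) 1 := le_min (div_nonneg (hAG0 x) pb.le) zero_le_one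
          have : H l x ≤ 2 ^ K * (ENNReal.ofReal ((min (AF x / α l ^ r) 1) ^ (K+1)) +
              ENNReal.ofReal ((min (AG x / β l ^ s) 1) ^ (K+1))) := by
            have h1 := add_pow_le m1 m2 (K+1)
            rw [Nat.add_sub_cancel] at h1
            refine (ENNReal.ofReal_le_ofReal h1).trans (le_of_eq ?_)
            rw [ENNReal.ofReal_mul (by positivity), ENNReal.ofReal_add (by positivity) (by positivity),
              ENNReal.ofReal_pow (by norm_num)]
            norm_num
          calc _ ≤ ENNReal.ofReal ((2:ℝ) ^ (l * u)) * (2 ^ K * (ENNReal.ofReal ((min (AF x / α l ^ r) 1) ^ (K+1)) +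
              ENNReal.ofReal ((min (AG x / β l ^ s) 1) ^ (K+1)))) := by gcongr
            _ = _ := by ring
      _ = 2 ^ K * (∑' l : ℤ, ENNReal.ofReal ((2:ℝ) ^ (l * u)) * ENNReal.ofReal ((min (AF x / α l ^ r) 1) ^ (K+1)) +
          ∑' l : ℤ, ENNReal.ofReal ((2:ℝ) ^ (l * u)) * ENNReal.ofReal ((min (AG x / β l ^ s) 1) ^ (K+1))) := by
          rw [ENNReal.tsum_mul_left, ENNReal.tsum_add]
      _ ≤ _ := by
          gcongr
          · exact H1 _ (hAF0 x)
          · exact H2 _ (hAG0 x)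
  have hAFm' : Measurable fun x => ENNReal.ofReal (AF x ^ (p/r)) := (hAFm.pow_const _).ennreal_ofReal
  have hmain : ∫⁻ x, ENNReal.ofReal ((V x / CE) ^ (1/t)) ^ u ≤
      (2 ^ u * 2 ^ K * (1 + CD)) * (C1 * Cf + C2 * Cg) * (If + Ig) := by
    calc _ ≤ ∫⁻ x, ∑' l : ℤ, ENNReal.ofReal ((2 * (2:ℝ) ^ (l:ℝ)) ^ u) * (Z l x + H l x) := lintegral_mono hlay
      _ = ∑' l : ℤ, ENNReal.ofReal ((2 * (2:ℝ) ^ (l:ℝ)) ^ u) * ((∫⁻ x, Z l x) + ∫⁻ x, H l x) := by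
          rw [lintegral_tsum (f := fun (l:ℤ) x => ENNReal.ofReal ((2 * (2:ℝ) ^ (l:ℝ)) ^ u) * (Z l x + H l x))
            fun l => (((hZm l).add (hHm l)).const_mul _).aemeasurable]
          refine tsum_congr fun l => ?_
          rw [lintegral_const_mul' _ _ ENNReal.ofReal_ne_top, lintegral_add_left (hZm l)]
      _ ≤ ∑' l : ℤ, ENNReal.ofReal ((2 * (2:ℝ) ^ (l:ℝ)) ^ u) * ((1 + CD) * ∫⁻ x, H l x) := by
          gcongr with l
          rw [one_add_mul, add_comm]
          gcongr
          exact hZH l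
      _ = 2 ^ u * (1 + CD) * ∑' l : ℤ, ENNReal.ofReal ((2:ℝ) ^ (l * u)) * ∫⁻ x, H l x := by
          rw [← ENNReal.tsum_mul_left]
          refine tsum_congr fun l => ?_
          rw [hco]; ring
      _ = 2 ^ u * (1 + CD) * ∫⁻ x, ∑' l : ℤ, ENNReal.ofReal ((2:ℝ) ^ (l * u)) * H l x := by
          rw [lintegral_tsum (f := fun (l:ℤ) x => ENNReal.ofReal ((2:ℝ) ^ (l * u)) * H l x)
            fun l => ((hHm l).const_mul _).aemeasurable]
          congr 1
          refine tsum_congr fun l => ?_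
          rw [lintegral_const_mul' _ _ ENNReal.ofReal_ne_top]
      _ ≤ 2 ^ u * (1 + CD) * ∫⁻ x, 2 ^ K * (C1 * ENNReal.ofReal (AF x ^ (p/r)) + C2 * ENNReal.ofReal (AG x ^ (q/s))) := by
          gcongr with x
          exact hsumH x
      _ = 2 ^ u * (1 + CD) * (2 ^ K * (C1 * (∫⁻ x, ENNReal.ofReal (AF x ^ (p/r))) +
            C2 * ∫⁻ x, ENNReal.ofReal (AG x ^ (q/s)))) := by
          rw [lintegral_const_mul' _ _ (by simp), lintegral_add_left (hAFm'.const_mul _),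
            lintegral_const_mul' _ _ ENNReal.coe_ne_top, lintegral_const_mul' _ _ ENNReal.coe_ne_top]
      _ ≤ 2 ^ u * (1 + CD) * (2 ^ K * (C1 * (Cf * If) + C2 * (Cg * Ig))) := by
          gcongr
      _ ≤ 2 ^ u * (1 + CD) * (2 ^ K * (C1 * (Cf * (If + Ig)) + C2 * (Cg * (If + Ig)))) := by
          gcongr
          · exact le_self_add
          · exact le_add_self
      _ = _ := by ring
  have hre : ∀ x, ENNReal.ofReal (V x) ^ (u/t) = (CE.toNNReal ^ (u/t) : ℝ≥0) * ENNReal.ofReal ((V x / CE) ^ (1/t)) ^ u := by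
    intro x
    have hut : 0 ≤ u / t := by positivity
    rw [← ENNReal.ofReal_rpow_of_nonneg (div_nonneg (hV0 x) hCEp.le) (by positivity), ← ENNReal.rpow_mul,
      one_div_mul_eq_div, ENNReal.coe_rpow_of_nonneg _ hut, ← ENNReal.mul_rpow_of_nonneg _ _ hut]
    congr 1
    rw [show ((CE.toNNReal : ℝ≥0) : ℝ≥0∞) = ENNReal.ofReal CE from rfl, ← ENNReal.ofReal_mul hCEp.le,
      mul_div_cancel₀ _ hCEp.ne']
  calc _ = ∫⁻ x, (CE.toNNReal ^ (u/t) : ℝ≥0) * ENNReal.ofReal ((V x / CE) ^ (1/t)) ^ u := lintegral_congr hre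
    _ = (CE.toNNReal ^ (u/t) : ℝ≥0) * ∫⁻ x, ENNReal.ofReal ((V x / CE) ^ (1/t)) ^ u :=
        lintegral_const_mul' _ _ ENNReal.coe_ne_top
    _ ≤ (CE.toNNReal ^ (u/t) : ℝ≥0) * ((2 ^ u * 2 ^ K * (1 + CD)) * (C1 * Cf + C2 * Cg) * (If + Ig)) := by
        gcongr
    _ = _ := by
        rw [ENNReal.coe_mul (CE.toNNReal ^ (u/t))]
        push_cast
        rw [ENNReal.coe_rpow_of_nonneg (2:ℝ≥0) hu.le]
        push_cast
        ring

/-- one jump of the paraproduct -/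
def Qab (φ : SchwartzMap ℝ ℂ) (f g : ℤ → ℝ → ℂ) (a b : ℤ) (x : ℝ) : ℂ :=
  ∑ j ∈ Finset.Ioc a b, ∑ i ∈ Finset.Ioo a j, conv (dilate φ i) (f i) x * conv (dilate φ j) (g j) x

lemma BB_eq_Qab (φ : SchwartzMap ℝ ℂ) (f g : ℤ → ℝ → ℂ) (a b : ℤ) (x : ℝ) (L : ℕ) (ha : -L ≤ a) :
    BB (fun j => conv (dilate φ (j - L + 1)) (f (j - L + 1)) x)
        (fun j => conv (dilate φ (j - L + 1)) (g (j - L + 1)) x) (a + L).toNat (b + L).toNat =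
      Qab φ f g a b x := by
  unfold BB Qab
  refine Finset.sum_bij' (fun (j:ℕ) _ => (j:ℤ) - L + 1) (fun j _ => (j + L - 1).toNat) ?_ ?_ ?_ ?_ ?_
  · intro j hj; rw [Finset.mem_Ico] at hj; rw [Finset.mem_Ioc]; omega
  · intro j hj; rw [Finset.mem_Ioc] at hj; rw [Finset.mem_Ico]; omega
  · intro j hj; omega
  · intro j hj; rw [Finset.mem_Ioc] at hj; omega
  · intro j hj
    rw [Finset.mem_Ico] at hj
    refine Finset.sum_bij' (fun (i:ℕ) _ => (i:ℤ) - L + 1) (fun i _ => (i + L - 1).toNat) ?_ ?_ ?_ ?_ ?_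
    · intro i hi; rw [Finset.mem_Ico] at hi; rw [Finset.mem_Ioo]; omega
    · intro i hi; rw [Finset.mem_Ioo] at hi; rw [Finset.mem_Ico]; omega
    · intro i hi; omega
    · intro i hi; rw [Finset.mem_Ioo] at hi; omega
    · intro i hi; rfl

lemma measurable_sel (Q : ℤ → ℤ → ℝ → ℂ) (hQ : ∀ a b, Measurable (Q a b)) (N N' : ℝ → ℤ) (hN : Measurable N)
    (hN' : Measurable N') : Measurable fun x => Q (N x) (N' x) x := by
  have h : Measurable fun z : (ℤ × ℤ) × ℝ => Q z.1.1 z.1.2 z.2 :=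
    measurable_from_prod_countable_right fun z => hQ z.1 z.2
  exact h.comp ((hN.prodMk hN').prodMk measurable_id)

lemma measurable_Qab (φ : SchwartzMap ℝ ℂ) (f g : ℤ → ℝ → ℂ) (hf : ∀ i, Measurable (f i))
    (hg : ∀ i, Measurable (g i)) (N N' : ℝ → ℤ) (hN : Measurable N) (hN' : Measurable N') :
    Measurable fun x => Qab φ f g (N x) (N' x) x := by
  refine measurable_sel (Qab φ f g) (fun a b => ?_) N N' hN hN'
  unfold Qab
  refine Finset.measurable_fun_sum _ fun j _ => Finset.measurable_fun_sum _ fun i _ => ?_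
  exact Measurable.mul (f := fun x => conv (dilate φ i) (f i) x) (g := fun x => conv (dilate φ j) (g j) x)
    (measurable_conv φ i _ (hf i)) (measurable_conv φ j _ (hg j))

theorem full_int (φ : SchwartzMap ℝ ℂ) (h0 : ∫ x, φ x = 0) (p q r s ρ σ t u : ℝ) (hp : 1 < p) (hq : 1 < q)
    (hr : 1 ≤ r) (hr2 : r ≤ 2) (hs : 1 ≤ s) (hs2 : s ≤ 2) (h : Adm r ρ) (h' : Adm s σ) (ht : 0 < t)
    (hts : 1 / t = 1 / ρ + 1 / σ) (hu : 0 < u) (hpq : 1 / u = 1 / p + 1 / q) :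
    ∃ C : ℝ≥0, ∀ (f g : ℤ → ℝ → ℂ), (∀ i, Measurable (f i)) → (∀ i, Measurable (g i)) →
    ∫⁻ x, (∑' i, ‖f i x‖ₑ ^ r) ^ (p/r) ≠ ⊤ → ∫⁻ x, (∑' i, ‖g i x‖ₑ ^ s) ^ (q/s) ≠ ⊤ →
    ∀ (Nk : ℕ → ℝ → ℤ), IsJumpCollection Nk →
    ∫⁻ x, (∑' k, ‖Qab φ f g (Nk k x) (Nk (k+1) x) x‖ₑ ^ t) ^ (u/t) ≤
      C * ((∫⁻ x, (∑' i, ‖f i x‖ₑ ^ r) ^ (p/r)) + ∫⁻ x, (∑' i, ‖g i x‖ₑ ^ s) ^ (q/s)) := by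
  have hut : 0 < u / t := by positivity
  obtain ⟨C, H⟩ := level_int φ h0 p q r s ρ σ t u hp hq hr hr2 hs hs2 h h' ht hts hu hpq
  refine ⟨C, fun f g hf hg hfin hgin Nk ⟨hNm, hN⟩ => ?_⟩
  set a : ℕ → ℝ → ℝ≥0∞ := fun k x => ‖Qab φ f g (Nk k x) (Nk (k+1) x) x‖ₑ ^ t with ha
  have ham : ∀ k, Measurable (a k) := fun k =>
    (measurable_Qab φ f g hf hg _ _ (hNm k) (hNm (k+1))).enorm.pow_const t
  set W : ℕ → ℝ → ℝ≥0∞ := fun L x => ∑ k ∈ Finset.range L,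
    (if -(L:ℤ) ≤ Nk k x ∧ Nk (k+1) x ≤ L then a k x else 0) with hW
  have hWm : ∀ L, Measurable (W L) := fun L => Finset.measurable_fun_sum _ fun k _ =>
    Measurable.ite ((measurableSet_le measurable_const (hNm k)).inter
      (measurableSet_le (hNm (k+1)) measurable_const)) (ham k) measurable_const
  have hWmono : ∀ x, Monotone fun L => W L x := by
    intro x L L' hL
    refine (Finset.sum_le_sum fun k _ => ?_).trans
      (Finset.sum_le_sum_of_subset (Finset.range_subset_range.2 hL))
    by_cases hc : -(L:ℤ) ≤ Nk k x ∧ Nk (k+1) x ≤ L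
    · rw [if_pos hc, if_pos (by omega)]
    · rw [if_neg hc]; exact zero_le
  have hWV : ∀ L, ∫⁻ x, W L x ^ (u/t) ≤ C * ((∫⁻ x, (∑' i, ‖f i x‖ₑ ^ r) ^ (p/r)) + ∫⁻ x, (∑' i, ‖g i x‖ₑ ^ s) ^ (q/s)) := by
    intro L
    have hmono : ∀ x, Monotone fun k => Nk k x := fun x => monotone_nat_of_le_succ fun k => hN k x
    refine le_trans (lintegral_mono fun x => ?_) (H f g hf hg hfin hgin L L
      (fun k x => (max (-(L:ℤ)) (min (Nk k x) L) + L).toNat) ?_ ?_)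
    · simp only
      gcongr
      rw [ENNReal.ofReal_sum_of_nonneg fun _ _ => by positivity]
      refine Finset.sum_le_sum fun k _ => ?_
      split_ifs with hc
      · have h1 := hN k x
        rw [show max (-(L:ℤ)) (min (Nk k x) L) = Nk k x by omega,
          show max (-(L:ℤ)) (min (Nk (k+1) x) L) = Nk (k+1) x by omega, BB_eq_Qab _ _ _ _ _ _ _ hc.1,
          ofReal_norm_rpow _ _ ht.le]
      · exact zero_le
    · intro x k k' hk
      have := hmono x hk
      simp only at this ⊢
      omega
    · intro k x
      omega
  have hpt : ∀ x, (∑' k, a k x) ^ (u/t) ≤ ⨆ L, W L x ^ (u/t) := by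
    intro x
    set Y := ⨆ L, W L x ^ (u/t) with hY
    have : ∑' k, a k x ≤ Y ^ (1/(u/t)) := by
      refine ENNReal.tsum_le_of_sum_range_le fun n => ?_
      obtain ⟨L, hL1, hL2⟩ : ∃ L : ℕ, n ≤ L ∧ (∀ k, k < n → -(L:ℤ) ≤ Nk k x ∧ Nk (k+1) x ≤ L) := by
        refine ⟨n + ∑ k ∈ Finset.range n, ((Nk k x).natAbs + (Nk (k+1) x).natAbs), by omega, fun k hk => ?_⟩
        have := Finset.single_le_sum (f := fun k => (Nk k x).natAbs + (Nk (k+1) x).natAbs)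
          (fun _ _ => Nat.zero_le _) (Finset.mem_range.2 hk)
        omega
      calc ∑ k ∈ Finset.range n, a k x ≤ W L x := by
            refine (Finset.sum_le_sum fun k hk => ?_).trans
              (Finset.sum_le_sum_of_subset (Finset.range_subset_range.2 hL1))
            rw [if_pos (hL2 k (Finset.mem_range.1 hk))]
        _ = (W L x ^ (u/t)) ^ (1/(u/t)) := by
            rw [← ENNReal.rpow_mul, mul_one_div_cancel hut.ne', ENNReal.rpow_one]
        _ ≤ _ := by
            gcongr
            exact le_iSup (fun L => W L x ^ (u/t)) L
    calc _ ≤ (Y ^ (1/(u/t))) ^ (u/t) := by gcongr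
      _ = Y := by rw [← ENNReal.rpow_mul, one_div_mul_cancel hut.ne', ENNReal.rpow_one]
  calc _ ≤ ∫⁻ x, ⨆ L, W L x ^ (u/t) := lintegral_mono hpt
    _ = ⨆ L, ∫⁻ x, W L x ^ (u/t) := by
        refine lintegral_iSup (fun L => (hWm L).pow_const _) fun L L' hL x => ?_
        simp only
        gcongr
        exact hWmono x hL
    _ ≤ _ := iSup_le hWV

lemma exists_Adm (r ε : ℝ) (hr : 1 ≤ r) (hr2 : r ≤ 2) (hε : 0 < ε) : ∃ ρ, Adm r ρ ∧ 0 < ρ ∧ 1 / r - ε ≤ 1 / ρ := by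
  rcases hr2.lt_or_eq with h | rfl
  · exact ⟨r, Or.inl ⟨rfl, h⟩, by linarith, by linarith⟩
  · refine ⟨2 * (1 + ε), Or.inr ⟨rfl, by linarith⟩, by linarith, ?_⟩
    rw [le_div_iff₀ (by linarith)]
    nlinarith

lemma exists_exps (r s t : ℝ) (hr1 : 1 ≤ r) (hr2 : r ≤ 2) (hs1 : 1 ≤ s) (hs2 : s ≤ 2)
    (ht : 0 < t) (hts : 1 / t ≤ 1 / r + 1 / s) (hcase : max r s < 2 ∨ r * s / (r + s) < t) :
    ∃ ρ σ t' : ℝ, Adm r ρ ∧ Adm s σ ∧ 0 < t' ∧ 1 / t' = 1 / ρ + 1 / σ ∧ t' ≤ t := by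
  have hr0 : 0 < r := by linarith
  have hs0 : 0 < s := by linarith
  obtain ⟨ρ, σ, h1, h2, hρ, hσ, h3⟩ : ∃ ρ σ, Adm r ρ ∧ Adm s σ ∧ 0 < ρ ∧ 0 < σ ∧ 1 / t ≤ 1 / ρ + 1 / σ := by
    rcases hcase with h | h
    · exact ⟨r, s, Or.inl ⟨rfl, (le_max_left _ _).trans_lt h⟩, Or.inl ⟨rfl, (le_max_right _ _).trans_lt h⟩,
        hr0, hs0, hts⟩
    · have hlt : 1 / t < 1 / r + 1 / s := by
        have e : 1 / r + 1 / s = 1 / (r * s / (r + s)) := by field_simp; ring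
        rw [e]
        exact one_div_lt_one_div_of_lt (by positivity) h
      obtain ⟨ρ, a1, a2, a3⟩ := exists_Adm r ((1 / r + 1 / s - 1 / t)/2) hr1 hr2 (by linarith)
      obtain ⟨σ, b1, b2, b3⟩ := exists_Adm s ((1 / r + 1 / s - 1 / t)/2) hs1 hs2 (by linarith)
      exact ⟨ρ, σ, a1, b1, a2, b2, by linarith⟩
  have hpos : 0 < 1 / ρ + 1 / σ := by positivity
  refine ⟨ρ, σ, 1 / (1 / ρ + 1 / σ), h1, h2, by positivity, by rw [one_div_one_div], ?_⟩
  rw [div_le_iff₀ hpos]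
  rw [div_le_iff₀ ht] at h3
  linarith

lemma tsum_rpow_mono (a : ℕ → ℝ≥0∞) (t t' : ℝ) (ht' : 0 < t') (h : t' ≤ t) :
    (∑' k, a k ^ t) ^ (1/t) ≤ (∑' k, a k ^ t') ^ (1/t') := by
  have ht : 0 < t := by linarith
  set S := ∑' k, a k ^ t' with hS
  have h1 : ∀ k, a k ≤ S ^ (1/t') := by
    intro k
    calc a k = (a k ^ t') ^ (1/t') := by
          rw [← ENNReal.rpow_mul, mul_one_div_cancel ht'.ne', ENNReal.rpow_one]
      _ ≤ _ := by gcongr; exact ENNReal.le_tsum (f := fun k => a k ^ t') k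
  have hd : 0 ≤ t - t' := by linarith
  have h2 : ∑' k, a k ^ t ≤ S ^ (t/t') := by
    calc _ ≤ ∑' k, a k ^ t' * (S ^ (1/t')) ^ (t - t') := by
          refine ENNReal.tsum_le_tsum fun k => ?_
          rw [show t = t' + (t - t') by ring, ENNReal.rpow_add_of_nonneg _ _ ht'.le hd,
            show t' + (t - t') - t' = t - t' by ring]
          gcongr
          exact h1 k
      _ = S ^ (1:ℝ) * S ^ ((t - t')/t') := by
          rw [ENNReal.tsum_mul_right, ← ENNReal.rpow_mul, ENNReal.rpow_one, one_div_mul_eq_div]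
      _ = _ := by
          rw [← ENNReal.rpow_add_of_nonneg _ _ zero_le_one (by positivity)]
          congr 1
          field_simp
          ring
  calc _ ≤ (S ^ (t/t')) ^ (1/t) := by gcongr
    _ = _ := by rw [← ENNReal.rpow_mul]; congr 1; field_simp

lemma mixedNorm_eq (p r : ℝ) (hr : 0 < r) (f : ℤ → ℝ → ℂ) :
    mixedNorm p r f = (∫⁻ x, (∑' i, ‖f i x‖ₑ ^ r) ^ (p/r)) ^ (1/p) := by
  unfold mixedNorm
  simp only [ofReal_norm, ← ENNReal.rpow_mul, one_div_mul_eq_div]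

lemma I_scale (p r : ℝ) (hp : 0 < p) (hr : 0 < r) (f : ℤ → ℝ → ℂ) (A : ℝ≥0) (hA : 0 < A)
    (hfA : mixedNorm p r f ≤ A) :
    ∫⁻ x, (∑' i, ‖((A⁻¹ : ℝ≥0) : ℂ) * f i x‖ₑ ^ r) ^ (p/r) ≤ 1 := by
  have hpr : 0 ≤ p / r := by positivity
  have hc : ‖(((A⁻¹ : ℝ≥0) : ℝ) : ℂ)‖ₑ = ((A⁻¹ : ℝ≥0) : ℝ≥0∞) := by
    rw [← ofReal_norm, Complex.norm_real, Real.norm_of_nonneg (NNReal.coe_nonneg _)]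
    exact ENNReal.ofReal_coe_nnreal
  have hI : ∫⁻ x, (∑' i, ‖f i x‖ₑ ^ r) ^ (p/r) ≤ (A:ℝ≥0∞) ^ p := by
    rw [mixedNorm_eq p r hr, one_div, ENNReal.rpow_inv_le_iff hp] at hfA
    exact hfA
  have e : ∀ x, (∑' i, ‖((A⁻¹ : ℝ≥0) : ℂ) * f i x‖ₑ ^ r) ^ (p/r) =
      ((A⁻¹ : ℝ≥0) : ℝ≥0∞) ^ p * (∑' i, ‖f i x‖ₑ ^ r) ^ (p/r) := by
    intro x
    simp only [enorm_mul, hc, ENNReal.mul_rpow_of_nonneg _ _ hr.le]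
    rw [ENNReal.tsum_mul_left, ENNReal.mul_rpow_of_nonneg _ _ hpr, ← ENNReal.rpow_mul,
      mul_div_cancel₀ _ hr.ne']
  simp only [e]
  rw [lintegral_const_mul' _ _ (ENNReal.rpow_ne_top_of_nonneg hp.le ENNReal.coe_ne_top)]
  calc _ ≤ ((A⁻¹ : ℝ≥0) : ℝ≥0∞) ^ p * (A:ℝ≥0∞) ^ p := by gcongr
    _ = 1 := by
      rw [← ENNReal.mul_rpow_of_nonneg _ _ hp.le, ← ENNReal.coe_mul, inv_mul_cancel₀ hA.ne',
        ENNReal.coe_one, ENNReal.one_rpow]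

lemma conv_scale (k f : ℝ → ℂ) (c : ℂ) (x : ℝ) : conv k (fun y => c * f y) x = c * conv k f x := by
  unfold conv
  rw [← integral_const_mul]
  exact integral_congr_ae (Filter.Eventually.of_forall fun y => by simp only; ring)

lemma Qab_scale (φ : SchwartzMap ℝ ℂ) (f g : ℤ → ℝ → ℂ) (c c' : ℂ) (a b : ℤ) (x : ℝ) :
    Qab φ (fun i y => c * f i y) (fun i y => c' * g i y) a b x = (c * c') * Qab φ f g a b x := by
  unfold Qab
  rw [Finset.mul_sum]
  refine Finset.sum_congr rfl fun j _ => ?_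
  rw [Finset.mul_sum]
  refine Finset.sum_congr rfl fun i _ => ?_
  rw [conv_scale, conv_scale]
  ring

theorem final_bound
    (p q r s t Nb : ℝ) (hp : 1 < p) (hq : 1 < q)
    (hr1 : 1 ≤ r) (hr2 : r ≤ 2) (hs1 : 1 ≤ s) (hs2 : s ≤ 2)
    (ht : 0 < t) (hts : 1 / t ≤ 1 / r + 1 / s)
    (hcase : max r s < 2 ∨ r * s / (r + s) < t) (hNb : 0 < Nb)
    (φ : SchwartzMap ℝ ℂ)
    (hφ : ∀ ξ : ℝ, 𝓕 (⇑φ) ξ ≠ 0 → (2 : ℝ) ^ (-Nb) < |ξ| ∧ |ξ| < (2 : ℝ) ^ Nb) :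
    ∃ C : ℝ≥0, 0 < C ∧
      ∀ (f g : ℤ → ℝ → ℂ),
      (∀ i, Measurable (f i)) → (∀ j, Measurable (g j)) →
      mixedNorm p r f < ⊤ → mixedNorm q s g < ⊤ →
      ∀ (Nk : ℕ → ℝ → ℤ), IsJumpCollection Nk →
      (∫⁻ x : ℝ,
          ((∑' k : ℕ, (ENNReal.ofReal (norm
              (∑ j ∈ Finset.Ioc (Nk k x) (Nk (k + 1) x),
                ∑ i ∈ Finset.Ioo (Nk k x) j,
                  conv (dilate φ i) (f i) x * conv (dilate φ j) (g j) x))) ^ t) ^ (1 / t))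
            ^ (p * q / (p + q))) ^ ((p + q) / (p * q))
        ≤ (C : ℝ≥0∞) * mixedNorm p r f * mixedNorm q s g := by
  have hp0 : 0 < p := by linarith
  have hq0 : 0 < q := by linarith
  have hr0 : 0 < r := by linarith
  have hs0 : 0 < s := by linarith
  have h0 := integral_eq_zero_of_fourier Nb φ hφ
  obtain ⟨ρ, σ, t', h1, h2, ht', hts', htt⟩ := exists_exps r s t hr1 hr2 hs1 hs2 ht hts hcase
  set u := p * q / (p + q) with hu
  have hu0 : 0 < u := by positivity
  have hpq : 1 / u = 1 / p + 1 / q := by rw [hu]; field_simp; ring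
  have hinv : (p + q) / (p * q) = 1 / u := by rw [hu, one_div_div]
  obtain ⟨C, H⟩ := full_int φ h0 p q r s ρ σ t' u hp hq hr1 hr2 hs1 hs2 h1 h2 ht' hts' hu0 hpq
  refine ⟨(C * 2) ^ (1/u) + 1, by positivity, fun f g hf hg hfin hgin Nk hN => ?_⟩
  rw [hinv]
  set J := ∫⁻ x, (∑' k, ‖Qab φ f g (Nk k x) (Nk (k+1) x) x‖ₑ ^ t') ^ (u/t') with hJ
  have hLJ : (∫⁻ x : ℝ,
          ((∑' k : ℕ, (ENNReal.ofReal (norm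
              (∑ j ∈ Finset.Ioc (Nk k x) (Nk (k + 1) x),
                ∑ i ∈ Finset.Ioo (Nk k x) j,
                  conv (dilate φ i) (f i) x * conv (dilate φ j) (g j) x))) ^ t) ^ (1 / t))
            ^ u) ≤ J := by
    refine lintegral_mono fun x => ?_
    simp only [ofReal_norm]
    calc _ ≤ ((∑' k, ‖Qab φ f g (Nk k x) (Nk (k+1) x) x‖ₑ ^ t') ^ (1/t')) ^ u := by
          gcongr
          exact tsum_rpow_mono (fun k => ‖Qab φ f g (Nk k x) (Nk (k+1) x) x‖ₑ) t t' ht' htt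
      _ = _ := by rw [← ENNReal.rpow_mul, one_div_mul_eq_div]
  refine (ENNReal.rpow_le_rpow hLJ (by positivity)).trans ?_
  -- the bound for all majorants of the norms
  have key : ∀ A B : ℝ≥0, 0 < A → 0 < B → mixedNorm p r f ≤ A → mixedNorm q s g ≤ B →
      J ^ (1/u) ≤ (((C * 2) ^ (1/u) + 1) * A * B : ℝ≥0) := by
    intro A B hA hB hfA hgB
    have i1 := I_scale p r hp0 hr0 f A hA hfA
    have i2 := I_scale q s hq0 hs0 g B hB hgB
    have := H (fun i y => ((A⁻¹ : ℝ≥0) : ℂ) * f i y) (fun i y => ((B⁻¹ : ℝ≥0) : ℂ) * g i y)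
      (fun i => (hf i).const_mul _) (fun i => (hg i).const_mul _)
      (ne_top_of_le_ne_top ENNReal.one_ne_top i1) (ne_top_of_le_ne_top ENNReal.one_ne_top i2) Nk hN
    have hut : 0 ≤ u / t' := by positivity
    set c : ℝ≥0 := A⁻¹ * B⁻¹ with hc
    have hcn : ‖((A⁻¹ : ℝ≥0) : ℂ) * ((B⁻¹ : ℝ≥0) : ℂ)‖ₑ = (c : ℝ≥0∞) := by
      have : ((A⁻¹ : ℝ≥0) : ℂ) * ((B⁻¹ : ℝ≥0) : ℂ) = (((c : ℝ≥0) : ℝ) : ℂ) := by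
        rw [hc]; push_cast; rfl
      rw [this, ← ofReal_norm, Complex.norm_real, Real.norm_of_nonneg (NNReal.coe_nonneg _)]
      exact ENNReal.ofReal_coe_nnreal
    have e : ∀ x, (∑' k, ‖Qab φ (fun i y => ((A⁻¹ : ℝ≥0) : ℂ) * f i y) (fun i y => ((B⁻¹ : ℝ≥0) : ℂ) * g i y)
        (Nk k x) (Nk (k+1) x) x‖ₑ ^ t') ^ (u/t') =
        (c:ℝ≥0∞) ^ u * (∑' k, ‖Qab φ f g (Nk k x) (Nk (k+1) x) x‖ₑ ^ t') ^ (u/t') := by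
      intro x
      simp only [Qab_scale, enorm_mul _ (Qab φ f g _ _ _), hcn, ENNReal.mul_rpow_of_nonneg _ _ ht'.le]
      rw [ENNReal.tsum_mul_left, ENNReal.mul_rpow_of_nonneg _ _ hut, ← ENNReal.rpow_mul,
        mul_div_cancel₀ _ ht'.ne']
    simp only [e] at this
    rw [lintegral_const_mul' _ _ (ENNReal.rpow_ne_top_of_nonneg hu0.le ENNReal.coe_ne_top)] at this
    have h3 : (c:ℝ≥0∞) ^ u * J ≤ C * 2 := by
      refine this.trans ?_
      gcongr
      rw [← one_add_one_eq_two]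
      exact add_le_add i1 i2
    have h4 : (c:ℝ≥0∞) * J ^ (1/u) ≤ ((C * 2) ^ (1/u) : ℝ≥0) := by
      have := ENNReal.rpow_le_rpow h3 (z := 1/u) (by positivity)
      rw [ENNReal.mul_rpow_of_nonneg _ _ (by positivity), ← ENNReal.rpow_mul, mul_one_div_cancel hu0.ne',
        ENNReal.rpow_one] at this
      rw [ENNReal.coe_rpow_of_nonneg _ (by positivity)]
      push_cast
      exact this
    calc J ^ (1/u) = ((A * B : ℝ≥0) : ℝ≥0∞) * ((c:ℝ≥0∞) * J ^ (1/u)) := by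
          rw [← mul_assoc, ← ENNReal.coe_mul, show A * B * c = 1 by rw [hc]; field_simp, ENNReal.coe_one, one_mul]
      _ ≤ ((A * B : ℝ≥0) : ℝ≥0∞) * ((C * 2) ^ (1/u) : ℝ≥0) := by gcongr
      _ ≤ _ := by
          rw [← ENNReal.coe_mul]
          refine ENNReal.coe_le_coe.2 ?_
          calc A * B * (C * 2) ^ (1/u) ≤ A * B * ((C * 2) ^ (1/u) + 1) := by
                gcongr; exact le_self_add
            _ = _ := by ring
  lift mixedNorm p r f to ℝ≥0 using hfin.ne with a ha
  lift mixedNorm q s g to ℝ≥0 using hgin.ne with b hb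
  set D : ℝ≥0 := (C * 2) ^ (1/u) + 1 with hD
  have hlim : Filter.Tendsto (fun ε : ℝ≥0 => ((D * (a + ε) * (b + ε) : ℝ≥0) : ℝ≥0∞)) (nhdsWithin 0 (Set.Ioi 0))
      (nhds ((D * a * b : ℝ≥0) : ℝ≥0∞)) := by
    rw [ENNReal.tendsto_coe]
    have : Continuous fun ε : ℝ≥0 => D * (a + ε) * (b + ε) := by fun_prop
    have h := (this.tendsto 0).mono_left (nhdsWithin_le_nhds (s := Set.Ioi (0:ℝ≥0)))
    simpa using h
  have : J ^ (1/u) ≤ ((D * a * b : ℝ≥0) : ℝ≥0∞) := by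
    refine ge_of_tendsto hlim ?_
    filter_upwards [self_mem_nhdsWithin] with ε hε
    have hε' : 0 < ε := hε
    exact key (a + ε) (b + ε) (by positivity) (by positivity) (by exact_mod_cast le_self_add)
      (by exact_mod_cast le_self_add)
  rw [← ENNReal.coe_mul, ← ENNReal.coe_mul]
  exact this

/-- Strong-type bilinear variational paraproduct estimate for general (not necessarily
band-limited) families, with convolution against the dilates of `φ`. -/
theorem bilinear_variational_paraproduct_nonband
    (p q r s t Nb : ℝ) (hp : 1 < p) (hq : 1 < q)
    (hr1 : 1 ≤ r) (hr2 : r ≤ 2) (hs1 : 1 ≤ s) (hs2 : s ≤ 2)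
    (ht : 0 < t) (hts : 1 / t ≤ 1 / r + 1 / s)
    (hcase : max r s < 2 ∨ r * s / (r + s) < t) (hNb : 0 < Nb)
    (φ : SchwartzMap ℝ ℂ)
    (hφ : ∀ ξ : ℝ, 𝓕 (⇑φ) ξ ≠ 0 → (2 : ℝ) ^ (-Nb) < |ξ| ∧ |ξ| < (2 : ℝ) ^ Nb) :
    ∃ C : ℝ≥0, 0 < C ∧
      ∀ (f g : ℤ → ℝ → ℂ),
      (∀ i, Measurable (f i)) → (∀ j, Measurable (g j)) →
      mixedNorm p r f < ⊤ → mixedNorm q s g < ⊤ →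
      ∀ (Nk : ℕ → ℝ → ℤ), IsJumpCollection Nk →
      (∫⁻ x : ℝ,
          ((∑' k : ℕ, (ENNReal.ofReal (norm
              (∑ j ∈ Finset.Ioc (Nk k x) (Nk (k + 1) x),
                ∑ i ∈ Finset.Ioo (Nk k x) j,
                  conv (dilate φ i) (f i) x * conv (dilate φ j) (g j) x))) ^ t) ^ (1 / t))
            ^ (p * q / (p + q))) ^ ((p + q) / (p * q))
        ≤ (C : ℝ≥0∞) * mixedNorm p r f * mixedNorm q s g := by
  exact final_bound p q r s t Nb hp hq hr1 hr2 hs1 hs2 ht hts hcase hNb φ hφ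

end
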